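/- arXiv:2202.05250 — 6 statements merged into one kernel-verified Lean document; each statement's English description precedes it below -/
import Mathlib

section
/- Let d, m ≥ 1, let f_1,…,f_m : ℝ^d → ℝ be convex, twice continuously differentiable functions, w_1,…,w_m > 0, λ_1,…,λ_m > 0. Define F(θ) = Σ_{j=1}^m w_j·inf_{ξ∈ℝ^d}{ f_j(ξ) + λ_j‖θ − ξ‖₂ } and G(θ) = Σ_{j=1}^m w_j f_j(θ). Suppose there exist θ* ∈ ℝ^d, M > 0, ρ₀ > 0 and L_1,…,L_m > 0 such that ∇²f_j(θ) ⪯ L_j·I for all j and ∇²G(θ) ⪰ ρ₀·I hold for every θ ∈ B(θ*, M), and that ‖∇f_j(θ*)‖₂ + 2L_j·‖Σ_{k=1}^m w_k·∇f_k(θ*)‖₂/ρ₀ < λ_j < ‖∇f_j(θ*)‖₂ + L_j·M for every j. Then: (i) F(θ) = G(θ) for all θ ∈ B(θ*, R) where R = min_j (λ_j − ‖∇f_j(θ*)‖₂)/L_j; (ii) G has a unique global minimizer θ̃ satisfying ‖θ̃ − θ*‖₂ ≤ ‖Σ_{j=1}^m w_j·∇f_j(θ*)‖₂/ρ₀; and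 (iii) every minimizer (θ̂_1,…,θ̂_m, β̂) of (θ_1,…,θ_m,β) ↦ Σ_{j=1}^m w_j [ f_j(θ_j) + λ_j‖β − θ_j‖₂ ] satisfies θ̂_1 = ⋯ = θ̂_m = β̂ = θ̃. -/
open Metric Finset

/-- The quadratic form of the Hessian of `f` at `θ`, evaluated at `v`. -/
noncomputable def hessQ {d : ℕ} (f : EuclideanSpace ℝ (Fin d) → ℝ)
    (θ v : EuclideanSpace ℝ (Fin d)) : ℝ :=
  iteratedFDeriv ℝ 2 f θ ![v, v]

theorem aux_line {E : Type*} [NormedAddCommGroup E] [NormedSpace ℝ E] (f : E → ℝ)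
    (hf : ContDiff ℝ 2 f) (x v : E) (t : ℝ) :
    HasDerivAt (fun s : ℝ => f (x + s • v)) (fderiv ℝ f (x + t • v) v) t ∧
    HasDerivAt (fun s : ℝ => fderiv ℝ f (x + s • v) v)
      (fderiv ℝ (fderiv ℝ f) (x + t • v) v v) t := by
  have hl : HasDerivAt (fun s : ℝ => x + s • v) v t := by
    simpa using ((hasDerivAt_id t).smul_const v).const_add x
  have h1 : Differentiable ℝ f := hf.differentiable (by norm_num)
  have h2 : Differentiable ℝ (fderiv ℝ f) :=
    (hf.fderiv_right (m := 1) (by norm_num)).differentiable (by norm_num)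
  refine ⟨(h1 _).hasFDerivAt.comp_hasDerivAt t hl, ?_⟩
  have h3 := (h2 (x + t • v)).hasFDerivAt.comp_hasDerivAt t hl
  simpa using h3.clm_apply (hasDerivAt_const t v)

theorem aux_psd {E : Type*} [NormedAddCommGroup E] [NormedSpace ℝ E] (f : E → ℝ)
    (hf : ContDiff ℝ 2 f) (hc : ConvexOn ℝ Set.univ f) (x v : E) :
    0 ≤ fderiv ℝ (fderiv ℝ f) x v v := by
  have hcc : ConvexOn ℝ Set.univ (fun s : ℝ => f (x + s • v)) := by
    have h := hc.comp_affineMap (AffineMap.lineMap x (x + v) : ℝ →ᵃ[ℝ] E)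
    have he : (fun s : ℝ => f (x + s • v)) = f ∘ (AffineMap.lineMap x (x + v) : ℝ →ᵃ[ℝ] E) := by
      funext s
      simp [AffineMap.lineMap_apply, add_comm]
    rw [he]
    exact h
  have hm := hcc.monotoneOn_deriv (fun t _ => (aux_line f hf x v t).1.differentiableAt)
  have hm2 : Monotone (fun s : ℝ => fderiv ℝ f (x + s • v) v) := by
    intro a b hab
    have := hm (Set.mem_univ a) (Set.mem_univ b) hab
    rwa [(aux_line f hf x v a).1.deriv, (aux_line f hf x v b).1.deriv] at this
  have h3 := (aux_line f hf x v 0).2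
  have h4 := hm2.deriv_nonneg (x := 0)
  rw [h3.deriv] at h4
  simpa using h4

theorem aux_taylor {E : Type*} [NormedAddCommGroup E] [NormedSpace ℝ E] (f : E → ℝ)
    (hf : ContDiff ℝ 2 f) (x v : E) (c : ℝ)
    (h : ∀ t ∈ Set.Icc (0:ℝ) 1, c ≤ fderiv ℝ (fderiv ℝ f) (x + t • v) v v) :
    fderiv ℝ f x v + c ≤ fderiv ℝ f (x + v) v ∧
    f x + fderiv ℝ f x v + c / 2 ≤ f (x + v) := by
  have d1 : ∀ t : ℝ, HasDerivAt (fun s : ℝ => fderiv ℝ f (x + s • v) v - c * s)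
      (fderiv ℝ (fderiv ℝ f) (x + t • v) v v - c) t := fun t => by
    have := (aux_line f hf x v t).2.sub ((hasDerivAt_id t).const_mul c)
    rw [mul_one] at this
    exact this
  have m1 : MonotoneOn (fun s : ℝ => fderiv ℝ f (x + s • v) v - c * s) (Set.Icc 0 1) := by
    apply monotoneOn_of_deriv_nonneg (convex_Icc 0 1)
    · exact fun t _ => (d1 t).continuousAt.continuousWithinAt
    · exact fun t _ => (d1 t).differentiableAt.differentiableWithinAt
    · intro t ht
      rw [(d1 t).deriv]
      have := h t (interior_subset ht)
      linarith
  have d2 : ∀ t : ℝ, HasDerivAt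
      (fun s : ℝ => f (x + s • v) - fderiv ℝ f x v * s - c / 2 * s ^ 2)
      (fderiv ℝ f (x + t • v) v - fderiv ℝ f x v - c * t) t := fun t => by
    have := ((aux_line f hf x v t).1.sub ((hasDerivAt_id t).const_mul (fderiv ℝ f x v))).sub
      ((hasDerivAt_pow 2 t).const_mul (c / 2))
    have he : fderiv ℝ f (x + t • v) v - fderiv ℝ f x v - c * t
        = fderiv ℝ f (x + t • v) v - fderiv ℝ f x v * 1 - c / 2 * (((2 : ℕ) : ℝ) * t ^ (2 - 1)) := by
      norm_num
      ring
    rw [he]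
    exact this
  have m2 : MonotoneOn (fun s : ℝ => f (x + s • v) - fderiv ℝ f x v * s - c / 2 * s ^ 2)
      (Set.Icc 0 1) := by
    apply monotoneOn_of_deriv_nonneg (convex_Icc 0 1)
    · exact fun t _ => (d2 t).continuousAt.continuousWithinAt
    · exact fun t _ => (d2 t).differentiableAt.differentiableWithinAt
    · intro t ht
      rw [(d2 t).deriv]
      have ht' := interior_subset ht
      have := m1 (by simp : (0:ℝ) ∈ Set.Icc (0:ℝ) 1) ht' ht'.1
      simp at this
      linarith
  have e1 := m1 (by simp : (0:ℝ) ∈ Set.Icc (0:ℝ) 1) (by simp : (1:ℝ) ∈ Set.Icc (0:ℝ) 1)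
    zero_le_one
  have e2 := m2 (by simp : (0:ℝ) ∈ Set.Icc (0:ℝ) 1) (by simp : (1:ℝ) ∈ Set.Icc (0:ℝ) 1)
    zero_le_one
  simp at e1 e2
  constructor <;> linarith

theorem aux_first {E : Type*} [NormedAddCommGroup E] [NormedSpace ℝ E] (f : E → ℝ)
    (hf : ContDiff ℝ 2 f) (hc : ConvexOn ℝ Set.univ f) (x y : E) :
    f x + fderiv ℝ f x (y - x) ≤ f y := by
  have := (aux_taylor f hf x (y - x) 0 (fun t _ => aux_psd f hf hc _ _)).2
  simpa using this

theorem aux_lip {E : Type*} [NormedAddCommGroup E] [NormedSpace ℝ E] (f : E → ℝ)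
    (hf : ContDiff ℝ 2 f) (hc : ConvexOn ℝ Set.univ f) (x : E) (M L : ℝ) (hL : 0 < L)
    (h : ∀ y ∈ Metric.closedBall x M, ∀ v, fderiv ℝ (fderiv ℝ f) y v v ≤ L * ‖v‖ ^ 2)
    (hM : 0 < M) (y : E) (hy : y ∈ Metric.closedBall x M) :
    ‖fderiv ℝ f y‖ ≤ ‖fderiv ℝ f x‖ + L * ‖y - x‖ := by
  have h2 : Differentiable ℝ (fderiv ℝ f) :=
    (hf.fderiv_right (m := 1) (by norm_num)).differentiable (by norm_num)
  have key : ‖fderiv ℝ f y - fderiv ℝ f x‖ ≤ L * ‖y - x‖ := by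
    apply Convex.norm_image_sub_le_of_norm_fderiv_le (𝕜 := ℝ) (s := Metric.closedBall x M)
      (fun z _ => h2 z) _ (convex_closedBall x M) (Metric.mem_closedBall_self hM.le) hy
    intro z hz
    apply ContinuousLinearMap.opNorm_le_bound₂ _ hL.le
    intro u v
    have hs : IsSymmSndFDerivAt ℝ f z := hf.contDiffAt.isSymmSndFDerivAt (by simp)
    have hq : ∀ t : ℝ, 0 ≤ fderiv ℝ (fderiv ℝ f) z v v * (t * t)
        + 2 * fderiv ℝ (fderiv ℝ f) z u v * t + fderiv ℝ (fderiv ℝ f) z u u := fun t => by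
      have := aux_psd f hf hc z (u + t • v)
      simp only [map_add, map_smul, add_apply, smul_apply,
        smul_eq_mul] at this
      rw [hs.eq v u] at this
      linarith
    have hd := discrim_le_zero hq
    unfold discrim at hd
    have hu := h z hz u
    have hv := h z hz v
    have hu0 := aux_psd f hf hc z u
    have hv0 := aux_psd f hf hc z v
    have hmul := mul_le_mul hu hv hv0 (by positivity)
    rw [Real.norm_eq_abs]
    apply abs_le_of_sq_le_sq _ (by positivity)
    nlinarith
  have := norm_le_norm_add_norm_sub' (fderiv ℝ f y) (fderiv ℝ f x)
  linarith

theorem aux_min {E : Type*} [NormedAddCommGroup E] [NormedSpace ℝ E] [ProperSpace E] (G : E → ℝ)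
    (hG : ContDiff ℝ 2 G) (hc : ConvexOn ℝ Set.univ G) (x : E) (M ρ : ℝ) (hM : 0 < M) (hρ : 0 < ρ)
    (h : ∀ y ∈ Metric.closedBall x M, ∀ v, ρ * ‖v‖ ^ 2 ≤ fderiv ℝ (fderiv ℝ G) y v v)
    (hg : 2 * (‖fderiv ℝ G x‖ / ρ) < M) :
    ∃ z : E, (∀ y, G z ≤ G y) ∧ (∀ y, G y ≤ G z → y = z) ∧ fderiv ℝ G z = 0 ∧
      ‖z - x‖ ≤ ‖fderiv ℝ G x‖ / ρ := by
  have hx : x ∈ Metric.closedBall x M := Metric.mem_closedBall_self hM.le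
  have T : ∀ a ∈ Metric.closedBall x M, ∀ b ∈ Metric.closedBall x M,
      fderiv ℝ G a (b - a) + ρ * ‖b - a‖ ^ 2 ≤ fderiv ℝ G b (b - a) ∧
      G a + fderiv ℝ G a (b - a) + ρ * ‖b - a‖ ^ 2 / 2 ≤ G b := by
    intro a ha b hb
    have := aux_taylor G hG a (b - a) (ρ * ‖b - a‖ ^ 2)
      (fun t ht => h _ ((convex_closedBall x M).add_smul_sub_mem ha hb ht) _)
    simpa using this
  have hgρ : ‖fderiv ℝ G x‖ = ‖fderiv ℝ G x‖ / ρ * ρ := by field_simp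
  set r := ‖fderiv ℝ G x‖ / ρ with hr
  have hr0 : 0 ≤ r := by positivity
  have hop : ∀ v, |fderiv ℝ G x v| ≤ r * ρ * ‖v‖ := by
    intro v
    rw [← hgρ]
    exact (fderiv ℝ G x).le_opNorm v
  obtain ⟨z, hz, hmin⟩ := (isCompact_closedBall x M).exists_isMinOn ⟨x, hx⟩
    hG.continuous.continuousOn
  have hzM : ‖z - x‖ < M := by
    have hzle : ‖z - x‖ ≤ M := by simpa [dist_eq_norm] using hz
    have h1 := (T x hx z hz).2
    have h2 : G z ≤ G x := hmin hx
    have h3 := (abs_le.1 (hop (z - x))).1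
    by_contra hcon
    have he : ‖z - x‖ = M := le_antisymm hzle (not_lt.1 hcon)
    rw [he] at h1 h3
    have : 0 < ρ * M * (M - 2 * r) := by
      apply mul_pos (by positivity) (by linarith)
    nlinarith
  have hnh : Metric.closedBall x M ∈ nhds z :=
    Filter.mem_of_superset (Metric.isOpen_ball.mem_nhds (by simpa [dist_eq_norm] using hzM))
      Metric.ball_subset_closedBall
  have hloc : IsLocalMin G z := hmin.isLocalMin hnh
  have hglob : ∀ y, G z ≤ G y := IsMinOn.of_isLocalMin_of_convex_univ hloc hc
  have hd0 : fderiv ℝ G z = 0 := hloc.fderiv_eq_zero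
  refine ⟨z, hglob, ?_, hd0, ?_⟩
  · intro y hy
    have hcont : Filter.Tendsto (fun s : ℝ => z + s • (y - z)) (nhdsWithin 0 (Set.Ioi 0))
        (nhds z) := by
      have : Continuous (fun s : ℝ => z + s • (y - z)) := by fun_prop
      have h0 := this.tendsto 0
      simp only [zero_smul, add_zero] at h0
      exact h0.mono_left nhdsWithin_le_nhds
    have hev : ∀ᶠ s : ℝ in nhdsWithin 0 (Set.Ioi 0), s ∈ Set.Ioo (0:ℝ) 1 :=
      Ioo_mem_nhdsGT one_pos
    obtain ⟨s, hs1, hs2⟩ := ((hcont.eventually hnh).and hev).exists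
    have h1 := (T z hz _ hs1).2
    rw [hd0] at h1
    have h2 : G (z + s • (y - z)) ≤ (1 - s) * G z + s * G y := by
      have := hc.2 (Set.mem_univ z) (Set.mem_univ y) (sub_nonneg.2 hs2.2.le) hs2.1.le (by ring)
      have he : z + s • (y - z) = (1 - s) • z + s • y := by module
      rw [he]
      simpa using this
    have h3 : s * G y ≤ s * G z := mul_le_mul_of_nonneg_left hy hs2.1.le
    simp only [add_sub_cancel_left, zero_apply, norm_smul] at h1
    by_contra hne
    have : 0 < ‖y - z‖ := norm_pos_iff.2 (sub_ne_zero.2 hne)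
    have h5 : 0 < ‖s‖ := norm_pos_iff.2 hs2.1.ne'
    have : 0 < ρ * (‖s‖ * ‖y - z‖) ^ 2 / 2 := by positivity
    linarith
  · have h1 := (T x hx z hz).1
    rw [hd0] at h1
    have h3 := (abs_le.1 (hop (z - x))).1
    simp only [zero_apply] at h1
    rcases (norm_nonneg (z - x)).eq_or_lt with h0 | h0
    · rw [← h0]; exact hr0
    · have h4 : (ρ * ‖z - x‖) * ‖z - x‖ ≤ (ρ * ‖z - x‖) * r := by nlinarith
      exact le_of_mul_le_mul_left h4 (by positivity)

theorem aux_grad {E : Type*} [NormedAddCommGroup E] [InnerProductSpace ℝ E] [CompleteSpace E]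
    (f : E → ℝ) (x : E) : ‖gradient f x‖ = ‖fderiv ℝ f x‖ := by
  simp [gradient]

/-- Consensus lemma: under strong convexity of the pooled loss and suitable penalty
levels, the sum of infimal convolutions agrees with the pooled loss near `θ*`, the pooled
loss has a unique minimizer near `θ*`, and all ARMUL estimates collapse to it. -/
theorem stmt_11 (d m : ℕ) (hd : 1 ≤ d) (hm : 1 ≤ m)
    (f : Fin m → EuclideanSpace ℝ (Fin d) → ℝ)
    (hconv : ∀ j, ConvexOn ℝ Set.univ (f j)) (hC2 : ∀ j, ContDiff ℝ 2 (f j))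
    (w : Fin m → ℝ) (hw : ∀ j, 0 < w j) (lam : Fin m → ℝ) (hlam : ∀ j, 0 < lam j)
    (F G : EuclideanSpace ℝ (Fin d) → ℝ)
    (hF : ∀ θ, F θ = ∑ j, w j * sInf (Set.range fun ξ => f j ξ + lam j * ‖θ - ξ‖))
    (hG : ∀ θ, G θ = ∑ j, w j * f j θ)
    (θstar : EuclideanSpace ℝ (Fin d)) (M ρ₀ : ℝ) (Lc : Fin m → ℝ)
    (hM : 0 < M) (hρ₀ : 0 < ρ₀) (hL : ∀ j, 0 < Lc j)
    (hhessU : ∀ j, ∀ θ ∈ closedBall θstar M, ∀ v, hessQ (f j) θ v ≤ Lc j * ‖v‖ ^ 2)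
    (hhessG : ∀ θ ∈ closedBall θstar M, ∀ v, ρ₀ * ‖v‖ ^ 2 ≤ hessQ G θ v)
    (hlam1 : ∀ j, ‖gradient (f j) θstar‖ +
      2 * Lc j * ‖∑ k, w k • gradient (f k) θstar‖ / ρ₀ < lam j)
    (hlam2 : ∀ j, lam j < ‖gradient (f j) θstar‖ + Lc j * M)
    (R : ℝ)
    (hR : IsLeast (Set.range fun j => (lam j - ‖gradient (f j) θstar‖) / Lc j) R) :
    (∀ θ ∈ closedBall θstar R, F θ = G θ) ∧
    (∃ θt : EuclideanSpace ℝ (Fin d),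
      (∀ θ, G θt ≤ G θ) ∧
      (∀ θ', (∀ θ, G θ' ≤ G θ) → θ' = θt) ∧
      ‖θt - θstar‖ ≤ ‖∑ j, w j • gradient (f j) θstar‖ / ρ₀ ∧
      ∀ (θhat : Fin m → EuclideanSpace ℝ (Fin d)) (βhat : EuclideanSpace ℝ (Fin d)),
        (∀ (θ : Fin m → EuclideanSpace ℝ (Fin d)) (β : EuclideanSpace ℝ (Fin d)),
          ∑ j, w j * (f j (θhat j) + lam j * ‖βhat - θhat j‖) ≤
          ∑ j, w j * (f j (θ j) + lam j * ‖β - θ j‖)) →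
        βhat = θt ∧ ∀ j, θhat j = θt) := by
  classical
  have hess : ∀ (g : EuclideanSpace ℝ (Fin d) → ℝ) θ v,
      hessQ g θ v = fderiv ℝ (fderiv ℝ g) θ v v := by
    intro g θ v
    simp [hessQ, iteratedFDeriv_two_apply]
  simp only [hess] at hhessU hhessG
  have hfd : ∀ j, Differentiable ℝ (f j) := fun j => (hC2 j).differentiable (by norm_num)
  have hGe : G = fun θ => ∑ j, w j * f j θ := funext hG
  have hGC : ContDiff ℝ 2 G := by
    rw [hGe]
    exact ContDiff.sum (fun j _ => contDiff_const.mul (hC2 j))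
  have hGc : ConvexOn ℝ Set.univ G := by
    refine ⟨convex_univ, fun x _ y _ a b ha hb hab => ?_⟩
    simp only [hG, smul_eq_mul, Finset.mul_sum, ← Finset.sum_add_distrib]
    refine Finset.sum_le_sum fun j _ => ?_
    have := (hconv j).2 (Set.mem_univ x) (Set.mem_univ y) ha hb hab
    simp only [smul_eq_mul] at this
    have := mul_le_mul_of_nonneg_left this (hw j).le
    linarith
  have hGd : ∀ θ, fderiv ℝ G θ = ∑ j, w j • fderiv ℝ (f j) θ := by
    intro θ
    rw [hGe]
    exact (HasFDerivAt.fun_sum fun j _ => ((hfd j θ).hasFDerivAt.const_mul (w j))).fderiv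
  have hgn : ‖∑ k, w k • gradient (f k) θstar‖ = ‖fderiv ℝ G θstar‖ := by
    rw [hGd, ← (InnerProductSpace.toDual ℝ (EuclideanSpace ℝ (Fin d))).symm.norm_map]
    simp [gradient]
  rw [hgn] at hlam1 ⊢
  simp only [hgn, aux_grad] at hlam1 hlam2 hR
  have hlip := fun j => aux_lip (f j) (hC2 j) (hconv j) θstar M (Lc j) (hL j) (hhessU j) hM
  have hlam1' : ∀ j, ‖fderiv ℝ (f j) θstar‖ + Lc j * (2 * (‖fderiv ℝ G θstar‖ / ρ₀)) < lam j := by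
    intro j
    have := hlam1 j
    have e : 2 * Lc j * ‖fderiv ℝ G θstar‖ / ρ₀ = Lc j * (2 * (‖fderiv ℝ G θstar‖ / ρ₀)) := by ring
    rwa [e] at this
  have hr0 : 0 ≤ ‖fderiv ℝ G θstar‖ / ρ₀ := by positivity
  set r := ‖fderiv ℝ G θstar‖ / ρ₀ with hr
  have hrM : 2 * r < M := by
    have h1 := hlam1' ⟨0, hm⟩
    have h2 := hlam2 ⟨0, hm⟩
    exact lt_of_mul_lt_mul_left (by linarith) (hL ⟨0, hm⟩).le
  have hRj : ∀ j, Lc j * R ≤ lam j - ‖fderiv ℝ (f j) θstar‖ := by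
    intro j
    have := hR.2 ⟨j, rfl⟩
    simp only at this
    rw [le_div_iff₀ (hL j)] at this
    linarith
  have hRM : R ≤ M := by
    refine le_of_mul_le_mul_left ?_ (hL ⟨0, hm⟩)
    have := hRj ⟨0, hm⟩
    have := hlam2 ⟨0, hm⟩
    linarith
  have hlow : ∀ j θ ξ, f j θ - ‖fderiv ℝ (f j) θ‖ * ‖θ - ξ‖ ≤ f j ξ := by
    intro j θ ξ
    have h1 := aux_first (f j) (hC2 j) (hconv j) θ ξ
    have h2 := (abs_le.1 ((fderiv ℝ (f j) θ).le_opNorm (ξ - θ))).1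
    rw [norm_sub_rev θ ξ]
    linarith
  refine ⟨?_, ?_⟩
  · intro θ hθ
    have hθM := closedBall_subset_closedBall hRM hθ
    have hθR : ‖θ - θstar‖ ≤ R := by simpa [dist_eq_norm] using hθ
    rw [hF, hG]
    refine Finset.sum_congr rfl fun j _ => ?_
    congr 1
    apply IsLeast.csInf_eq
    refine ⟨⟨θ, by simp⟩, ?_⟩
    rintro _ ⟨ξ, rfl⟩
    have h1 := hlow j θ ξ
    have h2 := hlip j θ hθM
    have h3 := mul_le_mul_of_nonneg_left hθR (hL j).le
    have h4 : ‖fderiv ℝ (f j) θ‖ ≤ lam j := by linarith [hRj j]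
    have h5 := mul_le_mul_of_nonneg_right h4 (norm_nonneg (θ - ξ))
    simp only
    linarith
  · obtain ⟨θt, hmin, huniq, hd0, hdist⟩ :=
      aux_min G hGC hGc θstar M ρ₀ hM hρ₀ hhessG hrM
    refine ⟨θt, hmin, fun θ' h => huniq θ' (h θt), hdist, ?_⟩
    intro θhat βhat hopt
    have hθM : θt ∈ closedBall θstar M := by
      rw [mem_closedBall, dist_eq_norm]
      linarith
    have hlt : ∀ j, ‖fderiv ℝ (f j) θt‖ < lam j := by
      intro j
      have h2 := hlip j θt hθM
      have h3 := mul_le_mul_of_nonneg_left hdist (hL j).le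
      have h4 := mul_nonneg (hL j).le hr0
      have h5 := hlam1' j
      linarith
    have hobj := hopt (fun _ => θt) θt
    simp only [sub_self, norm_zero, mul_zero, add_zero] at hobj
    have hterm : ∀ j, w j * f j θt + w j * fderiv ℝ (f j) θt (βhat - θt)
        + w j * ((lam j - ‖fderiv ℝ (f j) θt‖) * ‖βhat - θhat j‖)
        ≤ w j * (f j (θhat j) + lam j * ‖βhat - θhat j‖) := by
      intro j
      rw [← mul_add, ← mul_add]
      refine mul_le_mul_of_nonneg_left ?_ (hw j).le
      have h1 := aux_first (f j) (hC2 j) (hconv j) θt (θhat j)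
      have h2 := (abs_le.1 ((fderiv ℝ (f j) θt).le_opNorm (βhat - θhat j))).2
      have h3 : fderiv ℝ (f j) θt (βhat - θt)
          = fderiv ℝ (f j) θt (βhat - θhat j) + fderiv ℝ (f j) θt (θhat j - θt) := by
        rw [← map_add]; congr 1; abel
      linarith
    have hsum := Finset.sum_le_sum fun j (_ : j ∈ Finset.univ) => hterm j
    rw [Finset.sum_add_distrib, Finset.sum_add_distrib] at hsum
    have hz : ∑ j, w j * fderiv ℝ (f j) θt (βhat - θt) = 0 := by
      have h1 := congrArg (fun T => T (βhat - θt)) (hGd θt)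
      simp only [hd0] at h1
      simpa using h1.symm
    have hnn : ∀ j ∈ Finset.univ,
        0 ≤ w j * ((lam j - ‖fderiv ℝ (f j) θt‖) * ‖βhat - θhat j‖) := fun j _ =>
      mul_nonneg (hw j).le (mul_nonneg (sub_nonneg.2 (hlt j).le) (norm_nonneg _))
    have hS := Finset.sum_nonneg hnn
    have hS0 : ∑ j, w j * ((lam j - ‖fderiv ℝ (f j) θt‖) * ‖βhat - θhat j‖) = 0 := by linarith
    have heq : ∀ j, θhat j = βhat := by
      intro j
      have h0 := (Finset.sum_eq_zero_iff_of_nonneg hnn).1 hS0 j (Finset.mem_univ j)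
      have h1 : ‖βhat - θhat j‖ = 0 := by
        rcases mul_eq_zero.1 h0 with h | h
        · exact absurd h (hw j).ne'
        · rcases mul_eq_zero.1 h with h | h
          · exact absurd h (sub_pos.2 (hlt j)).ne'
          · exact h
      exact (sub_eq_zero.1 (norm_eq_zero.1 h1)).symm
    have hβ : βhat = θt := by
      apply huniq
      rw [hG, hG]
      simpa [heq] using hobj
    exact ⟨hβ, fun j => (heq j).trans hβ⟩
end

section
/- Let d, m ≥ 1, let f_1,…,f_m : ℝ^d → ℝ be convex functions, w_1,…,w_m > 0, and λ_1,…,λ_m > 0. Suppose there exist S ⊆ {1,…,m} nonempty, θ* ∈ ℝ^d, M > 0 and, for each j ∈ S, constants 0 < ρ_j ≤ L_j < ∞ such that f_j is twice continuously differentiable with ρ_j·I ⪯ ∇²f_j(θ) ⪯ L_j·I for all θ ∈ B(θ*, M), and that ‖∇f_j(θ*)‖₂ + L_j·( 2‖Σ_{k∈S} w_k·∇f_k(θ*)‖₂ + Σ_{k∈S^c} w_k λ_k )/( Σ_{k∈S} w_k ρ_k ) < λ_j ≤ ‖∇f_j(θ*)‖₂ + L_j·M for every j ∈ S. Define G(θ)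 = Σ_{j∈S} w_j·inf_{ξ∈ℝ^d}{ f_j(ξ) + λ_j‖θ − ξ‖₂ }. Then G has a unique global minimizer θ̂_S with ‖θ̂_S − θ*‖₂ ≤ ‖Σ_{j∈S} w_j·∇f_j(θ*)‖₂/( Σ_{j∈S} w_j ρ_j ), and every minimizer (θ̂_1,…,θ̂_m, β̂) of (θ_1,…,θ_m,β) ↦ Σ_{j=1}^m w_j [ f_j(θ_j) + λ_j‖β − θ_j‖₂ ] satisfies θ̂_j = β̂ for all j ∈ S and ‖β̂ − θ̂_S‖₂ ≤ ( Σ_{j∈S^c} w_j λ_j )/( Σ_{j∈S} w_j ρ_j ). -/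
open Metric Finset

theorem aux_grad_ineq {E : Type*} [NormedAddCommGroup E] [NormedSpace ℝ E] {f : E → ℝ}
    (hc : ConvexOn ℝ Set.univ f) {x : E} (hf : DifferentiableAt ℝ f x) (y : E) :
    f x + fderiv ℝ f x (y - x) ≤ f y := by
  have h1 : ConvexOn ℝ Set.univ (f ∘ (AffineMap.lineMap x y : ℝ →ᵃ[ℝ] E)) := by
    simpa using hc.comp_affineMap (AffineMap.lineMap x y : ℝ →ᵃ[ℝ] E)
  have h2 : HasDerivAt (f ∘ (AffineMap.lineMap x y : ℝ →ᵃ[ℝ] E)) (fderiv ℝ f x (y - x)) 0 := by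
    have h3 : HasFDerivAt f (fderiv ℝ f x) ((AffineMap.lineMap x y : ℝ →ᵃ[ℝ] E) (0 : ℝ)) := by
      simpa using hf.hasFDerivAt
    exact h3.comp_hasDerivAt (0 : ℝ) AffineMap.hasDerivAt_lineMap
  have h4 := h1.le_slope_of_hasDerivAt (Set.mem_univ (0 : ℝ)) (Set.mem_univ (1 : ℝ))
    (by norm_num) h2
  simp [slope_def_field] at h4
  rw [map_sub]
  linarith

theorem aux_mono {d : ℕ} {f : EuclideanSpace ℝ (Fin d) → ℝ} (hf : ContDiff ℝ 2 f)
    {c : EuclideanSpace ℝ (Fin d)} {M ρ : ℝ}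
    (hh : ∀ θ ∈ closedBall c M, ∀ v, ρ * ‖v‖ ^ 2 ≤ hessQ f θ v)
    {x y : EuclideanSpace ℝ (Fin d)} (hx : x ∈ closedBall c M) (hy : y ∈ closedBall c M) :
    ρ * ‖y - x‖ ^ 2 ≤ fderiv ℝ f y (y - x) - fderiv ℝ f x (y - x) := by
  have hd : Differentiable ℝ (fderiv ℝ f) :=
    (hf.fderiv_right (m := 1) (by norm_num)).differentiable (by norm_num)
  have h2 : ∀ t : ℝ, HasDerivAt
      (fun t : ℝ => fderiv ℝ f ((AffineMap.lineMap x y : ℝ →ᵃ[ℝ] _) t) (y - x))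
      (fderiv ℝ (fderiv ℝ f) ((AffineMap.lineMap x y : ℝ →ᵃ[ℝ] _) t) (y - x) (y - x)) t := by
    intro t
    have h3 := (hd ((AffineMap.lineMap x y : ℝ →ᵃ[ℝ] _) t)).hasFDerivAt.comp_hasDerivAt t
      AffineMap.hasDerivAt_lineMap
    have h5 := h3.clm_apply (hasDerivAt_const t (y - x))
    simpa using h5
  have h6 := (convex_Icc (0 : ℝ) 1).mul_sub_le_image_sub_of_le_deriv
    (f := fun t : ℝ => fderiv ℝ f ((AffineMap.lineMap x y : ℝ →ᵃ[ℝ] _) t) (y - x))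
    (fun t _ => (h2 t).continuousAt.continuousWithinAt)
    (fun t _ => (h2 t).differentiableAt.differentiableWithinAt)
    (C := ρ * ‖y - x‖ ^ 2) (by
      intro t ht
      rw [(h2 t).deriv]
      have hm := hh _ ((convex_closedBall c M).lineMap_mem hx hy (interior_subset ht)) (y - x)
      rw [hessQ, iteratedFDeriv_two_apply] at hm
      simpa using hm) 0 (by simp) 1 (by simp) (by norm_num)
  simpa using h6

theorem aux_lip_s12 {d : ℕ} {f : EuclideanSpace ℝ (Fin d) → ℝ} (hf : ContDiff ℝ 2 f)
    {c : EuclideanSpace ℝ (Fin d)} {M L : ℝ} (hL : 0 ≤ L) (hM : 0 ≤ M)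
    (hh : ∀ θ ∈ closedBall c M, ∀ v, 0 ≤ hessQ f θ v ∧ hessQ f θ v ≤ L * ‖v‖ ^ 2)
    {x : EuclideanSpace ℝ (Fin d)} (hx : x ∈ closedBall c M) :
    ‖fderiv ℝ f x‖ ≤ ‖fderiv ℝ f c‖ + L * ‖x - c‖ := by
  have hd : Differentiable ℝ (fderiv ℝ f) :=
    (hf.fderiv_right (m := 1) (by norm_num)).differentiable (by norm_num)
  have key : ∀ z ∈ closedBall c M, ‖fderiv ℝ (fderiv ℝ f) z‖ ≤ L := by
    intro z hz
    have hsym : IsSymmSndFDerivAt ℝ f z := hf.contDiffAt.isSymmSndFDerivAt (by simp)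
    set B := fderiv ℝ (fderiv ℝ f) z with hB
    have hQ : ∀ v, 0 ≤ B v v ∧ B v v ≤ L * ‖v‖ ^ 2 := by
      intro v
      have := hh z hz v
      rw [hessQ, iteratedFDeriv_two_apply] at this
      simpa using this
    have hunit : ∀ u v : EuclideanSpace ℝ (Fin d), ‖u‖ = 1 → ‖v‖ = 1 → B u v ≤ L := by
      intro u v hu hv
      have e1 := (hQ (u + v)).2
      have e2 := (hQ (u - v)).1
      have e3 : B u v = B v u := hsym u v
      simp only [map_add, map_sub, ContinuousLinearMap.add_apply,
        ContinuousLinearMap.sub_apply] at e1 e2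
      have e4 : ‖u + v‖ ≤ 2 := by linarith [norm_add_le u v]
      have e5 : L * ‖u + v‖ ^ 2 ≤ L * 4 := by
        apply mul_le_mul_of_nonneg_left _ hL
        nlinarith [norm_nonneg (u + v)]
      linarith
    refine ContinuousLinearMap.opNorm_le_of_unit_norm hL fun u hu => ?_
    refine ContinuousLinearMap.opNorm_le_of_unit_norm hL fun v hv => ?_
    rw [Real.norm_eq_abs, abs_le]
    refine ⟨?_, hunit u v hu hv⟩
    have := hunit u (-v) hu (by simpa using hv)
    simp at this
    linarith
  have h := (convex_closedBall c M).norm_image_sub_le_of_norm_fderiv_le (𝕜 := ℝ)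
    (fun z _ => hd z) key (mem_closedBall_self hM) hx
  have := norm_sub_norm_le (fderiv ℝ f x) (fderiv ℝ f c)
  linarith

theorem aux_term {E : Type*} [NormedAddCommGroup E] [NormedSpace ℝ E] {f : E → ℝ}
    (hc : ConvexOn ℝ Set.univ f) {u : E} (hf : DifferentiableAt ℝ f u) {l : ℝ} (θ ξ : E) :
    f u + fderiv ℝ f u (θ - u) + (l - ‖fderiv ℝ f u‖) * ‖θ - ξ‖ ≤ f ξ + l * ‖θ - ξ‖ := by
  have h1 := aux_grad_ineq hc hf ξ
  have h2 : fderiv ℝ f u (θ - u) = fderiv ℝ f u (ξ - u) + fderiv ℝ f u (θ - ξ) := by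
    rw [← map_add]; congr 1; abel
  have h3 := (le_abs_self _).trans ((fderiv ℝ f u).le_opNorm (θ - ξ))
  nlinarith

/-- Robustness lemma (general weighted version): the sum over `S` of infimal convolutions
has a unique minimizer `θ̂_S` close to `θ*`, the ARMUL estimates of tasks in `S` collapse
to the coordinator `β̂`, and `β̂` is close to `θ̂_S`. -/
theorem stmt_12 (d m : ℕ) (hd : 1 ≤ d) (hm : 1 ≤ m)
    (f : Fin m → EuclideanSpace ℝ (Fin d) → ℝ)
    (hconv : ∀ j, ConvexOn ℝ Set.univ (f j))
    (w : Fin m → ℝ) (hw : ∀ j, 0 < w j) (lam : Fin m → ℝ) (hlam : ∀ j, 0 < lam j)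
    (S : Finset (Fin m)) (hS : S.Nonempty)
    (θstar : EuclideanSpace ℝ (Fin d)) (M : ℝ) (hM : 0 < M)
    (ρ L : Fin m → ℝ) (hρ : ∀ j ∈ S, 0 < ρ j) (hρL : ∀ j ∈ S, ρ j ≤ L j)
    (hC2 : ∀ j ∈ S, ContDiff ℝ 2 (f j))
    (hhess : ∀ j ∈ S, ∀ θ ∈ closedBall θstar M, ∀ v,
      ρ j * ‖v‖ ^ 2 ≤ hessQ (f j) θ v ∧ hessQ (f j) θ v ≤ L j * ‖v‖ ^ 2)
    (hlam1 : ∀ j ∈ S, ‖gradient (f j) θstar‖ +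
      L j * (2 * ‖∑ k ∈ S, w k • gradient (f k) θstar‖ + ∑ k ∈ Sᶜ, w k * lam k) /
        (∑ k ∈ S, w k * ρ k) < lam j)
    (hlam2 : ∀ j ∈ S, lam j ≤ ‖gradient (f j) θstar‖ + L j * M)
    (G : EuclideanSpace ℝ (Fin d) → ℝ)
    (hG : ∀ θ, G θ =
      ∑ j ∈ S, w j * sInf (Set.range fun ξ => f j ξ + lam j * ‖θ - ξ‖)) :
    ∃ θS : EuclideanSpace ℝ (Fin d),
      (∀ θ, G θS ≤ G θ) ∧
      (∀ θ', (∀ θ, G θ' ≤ G θ) → θ' = θS) ∧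
      ‖θS - θstar‖ ≤ ‖∑ j ∈ S, w j • gradient (f j) θstar‖ / (∑ j ∈ S, w j * ρ j) ∧
      ∀ (θhat : Fin m → EuclideanSpace ℝ (Fin d)) (βhat : EuclideanSpace ℝ (Fin d)),
        (∀ (θ : Fin m → EuclideanSpace ℝ (Fin d)) (β : EuclideanSpace ℝ (Fin d)),
          ∑ j, w j * (f j (θhat j) + lam j * ‖βhat - θhat j‖) ≤
          ∑ j, w j * (f j (θ j) + lam j * ‖β - θ j‖)) →
        (∀ j ∈ S, θhat j = βhat) ∧
        ‖βhat - θS‖ ≤ (∑ j ∈ Sᶜ, w j * lam j) / (∑ j ∈ S, w j * ρ j) := by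
  classical
  have hgn : ∀ j, ‖gradient (f j) θstar‖ = ‖fderiv ℝ (f j) θstar‖ := by
    intro j
    simp only [gradient, LinearIsometryEquiv.norm_map]
  have hgs : ‖∑ k ∈ S, w k • gradient (f k) θstar‖ = ‖∑ k ∈ S, w k • fderiv ℝ (f k) θstar‖ := by
    have : ∑ k ∈ S, w k • gradient (f k) θstar =
        (InnerProductSpace.toDual ℝ (EuclideanSpace ℝ (Fin d))).symm
          (∑ k ∈ S, w k • fderiv ℝ (f k) θstar) := by
      simp [gradient, map_sum]
    rw [this, LinearIsometryEquiv.norm_map]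
  simp only [hgn] at hlam1 hlam2
  rw [hgs] at hlam1 ⊢
  set P := ∑ k ∈ S, w k * ρ k with hP
  set Λ := ∑ k ∈ Sᶜ, w k * lam k with hΛ
  set F : EuclideanSpace ℝ (Fin d) → ℝ := fun θ => ∑ k ∈ S, w k * f k θ with hF
  set F' : EuclideanSpace ℝ (Fin d) → (EuclideanSpace ℝ (Fin d) →L[ℝ] ℝ) :=
    fun θ => ∑ k ∈ S, w k • fderiv ℝ (f k) θ with hF'
  change ∀ j ∈ S, _ + L j * (2 * ‖F' θstar‖ + Λ) / P < lam j at hlam1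
  set g := ‖F' θstar‖ with hg
  change ∃ θS, _ ∧ _ ∧ ‖θS - θstar‖ ≤ g / P ∧ _
  have hPpos : 0 < P := Finset.sum_pos (fun k hk => mul_pos (hw k) (hρ k hk)) hS
  have hΛ0 : 0 ≤ Λ := Finset.sum_nonneg fun k _ => (mul_pos (hw k) (hlam k)).le
  have hg0 : 0 ≤ g := norm_nonneg _
  have hLpos : ∀ j ∈ S, 0 < L j := fun j hj => (hρ j hj).trans_le (hρL j hj)
  have hdiff : ∀ j ∈ S, Differentiable ℝ (f j) := fun j hj =>
    (hC2 j hj).differentiable (by norm_num)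
  have hFd : ∀ θ, HasFDerivAt F (F' θ) θ := by
    intro θ
    refine HasFDerivAt.fun_sum fun k hk => ?_
    exact ((hdiff k hk) θ).hasFDerivAt.const_mul (w k)
  have hF'app : ∀ θ v, F' θ v = ∑ k ∈ S, w k * fderiv ℝ (f k) θ v := by
    intro θ v; simp [hF']
  obtain ⟨r, hr1, hrM, hr2⟩ : ∃ r, (2 * g + Λ) / P < r ∧ r ≤ M ∧
      ∀ j ∈ S, ‖fderiv ℝ (f j) θstar‖ + L j * r ≤ lam j := by
    refine ⟨S.inf' hS fun j => (lam j - ‖fderiv ℝ (f j) θstar‖) / L j, ?_, ?_, ?_⟩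
    · rw [Finset.lt_inf'_iff]
      intro j hj
      rw [lt_div_iff₀ (hLpos j hj)]
      have := hlam1 j hj
      rw [mul_div_assoc] at this
      linarith
    · obtain ⟨j, hj⟩ := hS
      refine (Finset.inf'_le _ hj).trans ?_
      rw [div_le_iff₀ (hLpos j hj)]
      linarith [hlam2 j hj]
    · intro j hj
      have h1 := Finset.inf'_le (fun j => (lam j - ‖fderiv ℝ (f j) θstar‖) / L j) hj
      rw [le_div_iff₀ (hLpos j hj)] at h1
      linarith
  have hr0 : 0 ≤ (2 * g + Λ) / P := by positivity
  have hgP : 0 ≤ g / P := by positivity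
  have hΛP : 0 ≤ Λ / P := by positivity
  have hsplit : (2 * g + Λ) / P = 2 * (g / P) + Λ / P := by ring
  have hrpos : 0 < r := hr0.trans_lt hr1
  have hsub : closedBall θstar r ⊆ closedBall θstar M := closedBall_subset_closedBall hrM
  have hlip : ∀ j ∈ S, ∀ u ∈ closedBall θstar r,
      ‖fderiv ℝ (f j) u‖ ≤ ‖fderiv ℝ (f j) θstar‖ + L j * ‖u - θstar‖ := by
    intro j hj u hu
    refine aux_lip_s12 (hC2 j hj) (hLpos j hj).le hM.le (fun θ hθ v => ?_) (hsub hu)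
    obtain ⟨h1, h2⟩ := hhess j hj θ hθ v
    exact ⟨le_trans (by have := hρ j hj; positivity) h1, h2⟩
  have hle : ∀ j ∈ S, ∀ u ∈ closedBall θstar r, ‖fderiv ℝ (f j) u‖ ≤ lam j := by
    intro j hj u hu
    have h1 := hlip j hj u hu
    have h2 : ‖u - θstar‖ ≤ r := by simpa [dist_eq_norm] using hu
    have h3 := mul_le_mul_of_nonneg_left h2 (hLpos j hj).le
    linarith [hr2 j hj]
  have hlt : ∀ j ∈ S, ∀ u, ‖u - θstar‖ < r → ‖fderiv ℝ (f j) u‖ < lam j := by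
    intro j hj u hu
    have h1 := hlip j hj u (by simpa [dist_eq_norm] using hu.le)
    have h3 := mul_lt_mul_of_pos_left hu (hLpos j hj)
    linarith [hr2 j hj]
  have hmono : ∀ x ∈ closedBall θstar r, ∀ y ∈ closedBall θstar r,
      P * ‖y - x‖ ^ 2 ≤ F' y (y - x) - F' x (y - x) := by
    intro x hx y hy
    rw [hF'app, hF'app, ← Finset.sum_sub_distrib, hP, Finset.sum_mul]
    refine Finset.sum_le_sum fun k hk => ?_
    have := aux_mono (hC2 k hk) (fun θ hθ v => (hhess k hk θ hθ v).1) (hsub hx) (hsub hy)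
    have := mul_le_mul_of_nonneg_left this (hw k).le
    linarith
  have hlow : ∀ u ∈ closedBall θstar r, ∀ θ, ∀ ξ : Fin m → EuclideanSpace ℝ (Fin d),
      F u + F' u (θ - u) ≤ ∑ j ∈ S, w j * (f j (ξ j) + lam j * ‖θ - ξ j‖) := by
    intro u hu θ ξ
    rw [hF'app, hF, ← Finset.sum_add_distrib]
    refine Finset.sum_le_sum fun k hk => ?_
    have h1 := aux_term (hconv k) (hdiff k hk u) (l := lam k) θ (ξ k)
    have h2 := mul_nonneg (sub_nonneg.2 (hle k hk u hu)) (norm_nonneg (θ - ξ k))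
    have h3 := mul_le_mul_of_nonneg_left
      (show f k u + fderiv ℝ (f k) u (θ - u) ≤ f k (ξ k) + lam k * ‖θ - ξ k‖ by linarith) (hw k).le
    linarith
  have hlowG : ∀ u ∈ closedBall θstar r, ∀ θ, F u + F' u (θ - u) ≤ G θ := by
    intro u hu θ
    rw [hG, hF'app, hF, ← Finset.sum_add_distrib]
    refine Finset.sum_le_sum fun k hk => ?_
    have h3 : f k u + fderiv ℝ (f k) u (θ - u) ≤
        sInf (Set.range fun ξ => f k ξ + lam k * ‖θ - ξ‖) := by
      refine le_csInf (Set.range_nonempty _) ?_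
      rintro _ ⟨ξ, rfl⟩
      have h1 := aux_term (hconv k) (hdiff k hk u) (l := lam k) θ ξ
      have h2 := mul_nonneg (sub_nonneg.2 (hle k hk u hu)) (norm_nonneg (θ - ξ))
      simp only
      linarith
    have h4 := mul_le_mul_of_nonneg_left h3 (hw k).le
    linarith
  have hupG : ∀ u ∈ closedBall θstar r, G u ≤ F u := by
    intro u hu
    rw [hG]
    refine Finset.sum_le_sum fun k hk => mul_le_mul_of_nonneg_left ?_ (hw k).le
    refine csInf_le ⟨f k u, ?_⟩ ⟨u, by simp⟩
    rintro _ ⟨ξ, rfl⟩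
    have h1 := aux_term (hconv k) (hdiff k hk u) (l := lam k) u ξ
    have h2 := mul_nonneg (sub_nonneg.2 (hle k hk u hu)) (norm_nonneg (u - ξ))
    simp only [sub_self, map_zero] at h1 ⊢
    linarith
  have hcen : θstar ∈ closedBall θstar r := mem_closedBall_self hrpos.le
  obtain ⟨θS, hθS, hmin⟩ := (isCompact_closedBall θstar r).exists_isMinOn ⟨θstar, hcen⟩
    (fun x _ => (hFd x).continuousAt.continuousWithinAt : ContinuousOn F (closedBall θstar r))
  have hdist : ‖θS - θstar‖ ≤ g / P := by
    have h1 : 0 ≤ F' θS (θstar - θS) :=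
      hmin.localize.hasFDerivWithinAt_nonneg (hFd θS).hasFDerivWithinAt
        (sub_mem_posTangentConeAt_of_segment_subset
          ((convex_closedBall θstar r).segment_subset hθS hcen))
    have h2 := hmono θstar hcen θS hθS
    have h3 : F' θS (θstar - θS) = - F' θS (θS - θstar) := by rw [← map_neg]; congr 1; abel
    have h4 := (neg_le_abs _).trans ((F' θstar).le_opNorm (θS - θstar))
    rw [le_div_iff₀ hPpos]
    by_contra hcon
    push Not at hcon
    rcases (norm_nonneg (θS - θstar)).eq_or_lt with h5 | h5
    · rw [← h5] at hcon; linarith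
    · have := mul_lt_mul_of_pos_right hcon h5
      nlinarith
  have hlin : ‖θS - θstar‖ < r := by linarith
  have hzero : F' θS = 0 := by
    have hloc : IsLocalMin F θS :=
      hmin.isLocalMin (closedBall_mem_nhds_of_mem (by simpa [dist_eq_norm] using hlin))
    exact hloc.hasFDerivAt_eq_zero (hFd θS)
  have hGS : ∀ θ, G θS ≤ G θ := by
    intro θ
    have := hlowG θS hθS θ
    rw [hzero] at this
    simp at this
    exact (hupG θS hθS).trans this
  have hseg : ∀ β : EuclideanSpace ℝ (Fin d), ∀ t : ℝ, 0 < t → t < 1 →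
      t * ‖β - θS‖ + g / P ≤ r → ∃ u ∈ closedBall θstar r,
        F θS ≤ F u ∧ ‖β - u‖ = (1 - t) * ‖β - θS‖ ∧
        (1 - t) * t * P * ‖β - θS‖ ^ 2 ≤ F' u (β - u) := by
    intro β t ht0 ht1 htr
    have hut : (θS + t • (β - θS)) - θS = t • (β - θS) := by abel
    have hub : β - (θS + t • (β - θS)) = (1 - t) • (β - θS) := by
      rw [sub_smul, one_smul]; abel
    have hu : θS + t • (β - θS) ∈ closedBall θstar r := by
      rw [mem_closedBall, dist_eq_norm]
      have h1 : θS + t • (β - θS) - θstar = t • (β - θS) + (θS - θstar) := by abel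
      rw [h1]
      refine (norm_add_le _ _).trans ?_
      rw [norm_smul, Real.norm_of_nonneg ht0.le]
      linarith
    refine ⟨θS + t • (β - θS), hu, hmin hu, ?_, ?_⟩
    · rw [hub, norm_smul, Real.norm_of_nonneg (by linarith)]
    · have h1 := hmono θS hθS _ hu
      rw [hut, hzero, norm_smul, Real.norm_of_nonneg ht0.le, map_smul] at h1
      simp only [ContinuousLinearMap.zero_apply, sub_zero, smul_eq_mul] at h1
      rw [hub, map_smul, smul_eq_mul]
      have h2 : t * P * ‖β - θS‖ ^ 2 ≤ F' (θS + t • (β - θS)) (β - θS) := by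
        refine le_of_mul_le_mul_left ?_ ht0
        linarith
      have h3 := mul_le_mul_of_nonneg_left h2 (show 0 ≤ 1 - t by linarith)
      linarith
  have hchoose : ∀ D c : ℝ, 0 ≤ c → c < D → c + g / P < r →
      ∃ t, 0 < t ∧ t < 1 ∧ c < t * D ∧ t * D + g / P ≤ r := by
    intro D c hc hcD hcr
    have hD : 0 < D := hc.trans_lt hcD
    obtain ⟨s, hs1, hs2⟩ := exists_between (lt_min hcD (show c < r - g / P by linarith))
    have hs3 := lt_of_lt_of_le hs2 (min_le_left _ _)
    have hs4 := lt_of_lt_of_le hs2 (min_le_right _ _)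
    have hs5 : s / D * D = s := div_mul_cancel₀ _ hD.ne'
    refine ⟨s / D, div_pos (by linarith) hD, (div_lt_one hD).2 hs3, ?_, ?_⟩
    · rw [hs5]; exact hs1
    · rw [hs5]; linarith
  refine ⟨θS, hGS, ?_, hdist, ?_⟩
  · intro θ' hθ'
    by_contra hne
    have hD : 0 < ‖θ' - θS‖ := norm_pos_iff.2 (sub_ne_zero.2 hne)
    obtain ⟨t, ht0, ht1, -, htr⟩ := hchoose _ 0 le_rfl hD (by linarith)
    obtain ⟨u, hu, hFu, -, hin⟩ := hseg θ' t ht0 ht1 htr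
    have h1 := hlowG u hu θ'
    have h2 := hθ' θS
    have h3 := hupG θS hθS
    have h4 : 0 < (1 - t) * t * P * ‖θ' - θS‖ ^ 2 := by
      have : 0 < 1 - t := by linarith
      positivity
    linarith
  · intro θhat βhat hmn
    have hcmp : ∀ u, ∑ j ∈ S, w j * (f j (θhat j) + lam j * ‖βhat - θhat j‖) ≤
        F u + Λ * ‖βhat - u‖ := by
      intro u
      have h1 := hmn (fun j => if j ∈ S then u else θhat j) u
      rw [← Finset.sum_add_sum_compl S, ← Finset.sum_add_sum_compl S (fun j => w j *
        (f j (if j ∈ S then u else θhat j) + lam j * ‖u - (if j ∈ S then u else θhat j)‖))] at h1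
      have h2 : ∑ j ∈ S, w j *
        (f j (if j ∈ S then u else θhat j) + lam j * ‖u - (if j ∈ S then u else θhat j)‖)
          = F u := by
        refine Finset.sum_congr rfl fun j hj => ?_
        simp [hj]
      have h3 : ∑ j ∈ Sᶜ, w j *
        (f j (if j ∈ S then u else θhat j) + lam j * ‖u - (if j ∈ S then u else θhat j)‖)
          ≤ ∑ j ∈ Sᶜ, w j * (f j (θhat j) + lam j * ‖βhat - θhat j‖) + Λ * ‖βhat - u‖ := by
        rw [hΛ, Finset.sum_mul, ← Finset.sum_add_distrib]
        refine Finset.sum_le_sum fun j hj => ?_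
        rw [if_neg (Finset.mem_compl.1 hj)]
        have h4 : ‖u - θhat j‖ ≤ ‖βhat - θhat j‖ + ‖βhat - u‖ := by
          have := norm_sub_le (βhat - θhat j) (βhat - u)
          have e : βhat - θhat j - (βhat - u) = u - θhat j := by abel
          rwa [e] at this
        have h5 := mul_le_mul_of_nonneg_left h4 (mul_pos (hw j) (hlam j)).le
        linarith
      linarith
    have hβ : ‖βhat - θS‖ ≤ Λ / P := by
      by_contra hcon
      push Not at hcon
      obtain ⟨t, ht0, ht1, htc, htr⟩ := hchoose _ _ hΛP hcon (by linarith)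
      obtain ⟨u, hu, hFu, hnu, hin⟩ := hseg βhat t ht0 ht1 htr
      have h1 := hlow u hu βhat θhat
      have h2 := hcmp u
      rw [hnu] at h2
      rw [div_lt_iff₀ hPpos] at htc
      have h3 : 0 < (1 - t) * ‖βhat - θS‖ :=
        mul_pos (by linarith) (hΛP.trans_lt hcon)
      have h4 := mul_lt_mul_of_pos_left htc h3
      nlinarith
    refine ⟨?_, hβ⟩
    have hβr : ‖βhat - θstar‖ < r := by
      have := norm_add_le (βhat - θS) (θS - θstar)
      rw [sub_add_sub_cancel] at this
      linarith
    have h1 := hcmp βhat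
    simp only [sub_self, norm_zero, mul_zero, add_zero] at h1
    have h2 : ∀ j ∈ S, w j * f j βhat + w j * ((lam j - ‖fderiv ℝ (f j) βhat‖) *
        ‖βhat - θhat j‖) ≤ w j * (f j (θhat j) + lam j * ‖βhat - θhat j‖) := by
      intro j hj
      have h3 := aux_term (hconv j) (hdiff j hj βhat) (l := lam j) βhat (θhat j)
      simp only [sub_self, map_zero, add_zero] at h3
      have h4 := mul_le_mul_of_nonneg_left h3 (hw j).le
      linarith
    have h3 := Finset.sum_le_sum h2
    rw [Finset.sum_add_distrib] at h3
    have hnn : ∀ j ∈ S, 0 ≤ w j * ((lam j - ‖fderiv ℝ (f j) βhat‖) * ‖βhat - θhat j‖) := by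
      intro j hj
      exact mul_nonneg (hw j).le
        (mul_nonneg (sub_nonneg.2 (hlt j hj βhat hβr).le) (norm_nonneg _))
    have h4 : ∑ j ∈ S, w j * ((lam j - ‖fderiv ℝ (f j) βhat‖) * ‖βhat - θhat j‖) = 0 :=
      le_antisymm (by linarith) (Finset.sum_nonneg hnn)
    intro j hj
    have h5 := (Finset.sum_eq_zero_iff_of_nonneg hnn).1 h4 j hj
    have h6 := sub_pos.2 (hlt j hj βhat hβr)
    have h7 : ‖βhat - θhat j‖ = 0 := by
      rcases mul_eq_zero.1 h5 with h | h
      · exact absurd h (hw j).ne'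
      · rcases mul_eq_zero.1 h with h | h
        · exact absurd h h6.ne'
        · exact h
    exact (sub_eq_zero.1 (norm_eq_zero.1 h7)).symm
end

section
/- Let d, m ≥ 1 and K ≥ 2. Let β*_1,…,β*_K ∈ ℝ^d, z*_1,…,z*_m ∈ {1,…,K}, define T(k) = {j : z*_j = k}, assume each T(k) is nonempty, and set m_min = min_k |T(k)|. Suppose f_1,…,f_m : ℝ^d → ℝ are convex and twice continuously differentiable, and there exist 0 < ρ ≤ L < ∞, η > 0 and M > 0 such that for every j: ρ·I ⪯ ∇²f_j(θ) ⪯ L·I for all θ ∈ B(β*_{z*_j}, M) and ‖∇f_j(β*_{z*_j})‖₂ ≤ η. Assume additionally min_{k≠l} ‖β*_k − β*_l‖₂ > (2η/ρ)·( 1 + 4√(K m L/(m_min ρ)) ) and (7ηL/ρ)·√(K m L/(m_min ρ)) < λ < L·M. Then for every minimizer (θ̂_1,…,θ̂_m, β̂_1,…,β̂_K, ẑ) over θ_j ∈ ℝ^d, β_k ∈ ℝ^d, z ∈ {1,…,K}^m of Σ_{j=1}^m [ f_j(θ_j) + λ‖β_{z_j} − θ_j‖₂ ], there exists a permutation τ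 of {1,…,K} such that ẑ_j = τ(z*_j) and θ̂_j = β̂_{ẑ_j} for all j, and for each k, β̂_{τ(k)} is a global minimizer of β ↦ Σ_{j∈T(k)} f_j(β) and satisfies ‖β̂_{τ(k)} − β*_k‖₂ ≤ ‖Σ_{j∈T(k)} ∇f_j(β*_k)‖₂/(ρ·|T(k)|). -/
open Metric Finset

lemma oneD (φ φ' φ'' : ℝ → ℝ) (c : ℝ) (h1 : ∀ s, HasDerivAt φ (φ' s) s)
    (h2 : ∀ s, HasDerivAt φ' (φ'' s) s) (hc : ∀ s ∈ Set.Icc (0:ℝ) 1, c ≤ φ'' s) :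
    c ≤ φ' 1 - φ' 0 ∧ φ 0 + φ' 0 + c / 2 ≤ φ 1 := by
  have key : ∀ s ∈ Set.Icc (0:ℝ) 1, c * s ≤ φ' s - φ' 0 := by
    intro s hs
    have hm : MonotoneOn (fun s => φ' s - c * s) (Set.Icc 0 1) := by
      have hd : ∀ s, HasDerivAt (fun s => φ' s - c * s) (φ'' s - c) s := fun s => by
        refine ((h2 s).sub ((hasDerivAt_id s).const_mul c)).congr_deriv ?_
        simp
      apply monotoneOn_of_deriv_nonneg (convex_Icc 0 1)
      · exact fun x _ => (hd x).continuousAt.continuousWithinAt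
      · exact fun x _ => (hd x).differentiableAt.differentiableWithinAt
      · intro x hx
        rw [(hd x).deriv]
        have := hc x (interior_subset hx)
        linarith
    have := hm (by simp : (0:ℝ) ∈ Set.Icc (0:ℝ) 1) hs hs.1
    simp at this
    linarith
  refine ⟨by simpa using key 1 (by simp), ?_⟩
  have hm : MonotoneOn (fun s => φ s - φ' 0 * s - c / 2 * s ^ 2) (Set.Icc 0 1) := by
    have hd : ∀ s, HasDerivAt (fun s => φ s - φ' 0 * s - c / 2 * s ^ 2)
        (φ' s - φ' 0 - c * s) s := fun s => by
      have := ((h1 s).sub ((hasDerivAt_id s).const_mul (φ' 0))).sub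
        (((hasDerivAt_id s).pow 2).const_mul (c / 2))
      refine this.congr_deriv ?_
      simp
      ring
    apply monotoneOn_of_deriv_nonneg (convex_Icc 0 1)
    · exact fun x _ => (hd x).continuousAt.continuousWithinAt
    · exact fun x _ => (hd x).differentiableAt.differentiableWithinAt
    · intro x hx
      rw [(hd x).deriv]
      have := key x (interior_subset hx)
      linarith
  have := hm (by simp : (0:ℝ) ∈ Set.Icc (0:ℝ) 1) (by simp : (1:ℝ) ∈ Set.Icc (0:ℝ) 1) zero_le_one
  simp at this
  linarith

section
variable {d : ℕ} {f : EuclideanSpace ℝ (Fin d) → ℝ} {b : EuclideanSpace ℝ (Fin d)}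
  {ρ L η M : ℝ}

lemma hessQ_eq (f : EuclideanSpace ℝ (Fin d) → ℝ) (θ v : EuclideanSpace ℝ (Fin d)) :
    hessQ f θ v = fderiv ℝ (fderiv ℝ f) θ v v := by
  simp [hessQ, iteratedFDeriv_two_apply]

lemma line (hC2 : ContDiff ℝ 2 f) (b v : EuclideanSpace ℝ (Fin d)) :
    (∀ s : ℝ, HasDerivAt (fun s : ℝ => f (b + s • v)) (fderiv ℝ f (b + s • v) v) s) ∧
    (∀ s : ℝ, HasDerivAt (fun s : ℝ => fderiv ℝ f (b + s • v) v) (hessQ f (b + s • v) v) s) := by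
  have hl : ∀ s : ℝ, HasDerivAt (fun s : ℝ => b + s • v) v s := fun s => by
    simpa using ((hasDerivAt_id s).smul_const v).const_add b
  have hd : Differentiable ℝ f := hC2.differentiable (by norm_num)
  have hd2 : Differentiable ℝ (fderiv ℝ f) :=
    (hC2.fderiv_right (m := 1) (by norm_num)).differentiable (by norm_num)
  constructor
  · intro s
    exact (hd _).hasFDerivAt.comp_hasDerivAt s (hl s)
  · intro s
    rw [hessQ_eq]
    have := (hd2 (b + s • v)).hasFDerivAt.comp_hasDerivAt s (hl s)
    have h3 := this.clm_apply (hasDerivAt_const s v)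
    simpa using h3

lemma seg_mem {p : EuclideanSpace ℝ (Fin d)} (hp : p ∈ closedBall b M) (hM : 0 ≤ M) :
    ∀ s ∈ Set.Icc (0:ℝ) 1, b + s • (p - b) ∈ closedBall b M := by
  intro s hs
  have := (convex_closedBall b M).add_smul_sub_mem (mem_closedBall_self hM) hp hs
  exact this

lemma taylor_lower (hC2 : ContDiff ℝ 2 f) (hM : 0 ≤ M)
    (hh : ∀ θ ∈ closedBall b M, ∀ v, ρ * ‖v‖ ^ 2 ≤ hessQ f θ v)
    {p : EuclideanSpace ℝ (Fin d)} (hp : p ∈ closedBall b M) :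
    ρ * ‖p - b‖ ^ 2 ≤ fderiv ℝ f p (p - b) - fderiv ℝ f b (p - b) ∧
    f b + fderiv ℝ f b (p - b) + ρ * ‖p - b‖ ^ 2 / 2 ≤ f p := by
  obtain ⟨h1, h2⟩ := line hC2 b (p - b)
  have := oneD _ _ _ (ρ * ‖p - b‖ ^ 2) h1 h2 (fun s hs => hh _ (seg_mem hp hM s hs) _)
  simpa using this

lemma taylor_upper (hC2 : ContDiff ℝ 2 f) (hM : 0 ≤ M)
    (hh : ∀ θ ∈ closedBall b M, ∀ v, hessQ f θ v ≤ L * ‖v‖ ^ 2)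
    {p : EuclideanSpace ℝ (Fin d)} (hp : p ∈ closedBall b M) :
    f p ≤ f b + fderiv ℝ f b (p - b) + L * ‖p - b‖ ^ 2 / 2 := by
  obtain ⟨h1, h2⟩ := line hC2 b (p - b)
  have := oneD _ _ _ (-(L * ‖p - b‖ ^ 2)) (fun s => (h1 s).neg) (fun s => (h2 s).neg)
    (fun s hs => neg_le_neg (hh _ (seg_mem hp hM s hs) _))
  have := this.2
  simp at this
  rw [map_sub]
  linarith

lemma hess_norm (hC2 : ContDiff ℝ 2 f) (hL : 0 ≤ L) {θ : EuclideanSpace ℝ (Fin d)}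
    (hh : ∀ v, 0 ≤ hessQ f θ v ∧ hessQ f θ v ≤ L * ‖v‖ ^ 2) :
    ‖fderiv ℝ (fderiv ℝ f) θ‖ ≤ L := by
  set B := fderiv ℝ (fderiv ℝ f) θ with hB
  have hs : ∀ u v, B u v = B v u := fun u v => by
    have : IsSymmSndFDerivAt ℝ f θ := hC2.contDiffAt.isSymmSndFDerivAt (by simp)
    exact this u v
  have h0 : ∀ u v, ‖u‖ = 1 → ‖v‖ = 1 → |B u v| ≤ L := by
    intro u v hu hv
    have e1 := hh (u + v)
    have e2 := hh (u - v)
    rw [hessQ_eq] at e1 e2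
    rw [← hB] at e1 e2
    simp only [map_add, map_sub, add_apply, sub_apply,
      hs v u] at e1 e2
    have n1 : ‖u + v‖ ^ 2 ≤ 4 := by
      have := norm_add_le u v
      nlinarith [norm_nonneg (u + v)]
    have n2 : ‖u - v‖ ^ 2 ≤ 4 := by
      have := norm_sub_le u v
      nlinarith [norm_nonneg (u - v)]
    have := mul_le_mul_of_nonneg_left n1 hL
    have := mul_le_mul_of_nonneg_left n2 hL
    rw [abs_le]
    constructor <;> linarith [e1.1, e1.2, e2.1, e2.2]
  refine ContinuousLinearMap.opNorm_le_of_unit_norm (𝕜 := ℝ) hL fun u hu => ?_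
  refine ContinuousLinearMap.opNorm_le_of_unit_norm (𝕜 := ℝ) hL fun v hv => ?_
  exact h0 u v hu hv

lemma grad_bound (hC2 : ContDiff ℝ 2 f) (hM : 0 ≤ M) (hL : 0 ≤ L)
    (hh : ∀ θ ∈ closedBall b M, ∀ v, 0 ≤ hessQ f θ v ∧ hessQ f θ v ≤ L * ‖v‖ ^ 2)
    (hg : ‖fderiv ℝ f b‖ ≤ η)
    {p : EuclideanSpace ℝ (Fin d)} (hp : p ∈ closedBall b M) :
    ‖fderiv ℝ f p‖ ≤ η + L * ‖p - b‖ := by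
  have hd2 : Differentiable ℝ (fderiv ℝ f) :=
    (hC2.fderiv_right (m := 1) (by norm_num)).differentiable (by norm_num)
  have := (convex_closedBall b M).norm_image_sub_le_of_norm_fderiv_le (𝕜 := ℝ)
    (f := fderiv ℝ f) (C := L) (fun x _ => hd2 x) (fun x hx => hess_norm hC2 hL (hh x hx))
    (mem_closedBall_self hM) hp
  have h2 := norm_sub_norm_le (fderiv ℝ f p) (fderiv ℝ f b)
  linarith

/-- convexity: tangent line below -/
lemma tangent (hC2 : ContDiff ℝ 2 f) (hc : ConvexOn ℝ Set.univ f)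
    (p θ : EuclideanSpace ℝ (Fin d)) : f p + fderiv ℝ f p (θ - p) ≤ f θ := by
  obtain ⟨h1, -⟩ := line hC2 p (θ - p)
  have hcc : ConvexOn ℝ Set.univ (fun s : ℝ => f (p + s • (θ - p))) := by
    refine ⟨convex_univ, ?_⟩
    intro x _ y _ a c ha hcn hac
    have := hc.2 (Set.mem_univ (p + x • (θ - p))) (Set.mem_univ (p + y • (θ - p))) ha hcn hac
    refine le_trans (le_of_eq ?_) this
    simp only
    congr 1
    obtain rfl : c = 1 - a := by linarith
    simp only [smul_eq_mul]
    module
  have := hcc.le_slope_of_hasDerivAt (Set.mem_univ 0) (Set.mem_univ 1) zero_lt_one (h1 0)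
  simp [slope_def_field] at this
  rw [map_sub]
  linarith

lemma infconv {lam : ℝ} (hC2 : ContDiff ℝ 2 f) (hc : ConvexOn ℝ Set.univ f)
    {p : EuclideanSpace ℝ (Fin d)} (hp : ‖fderiv ℝ f p‖ ≤ lam) (θ : EuclideanSpace ℝ (Fin d)) :
    f p ≤ f θ + lam * ‖p - θ‖ := by
  have h := tangent hC2 hc p θ
  have h2 := (fderiv ℝ f p).le_opNorm (θ - p)
  rw [Real.norm_eq_abs] at h2
  have h3 := (abs_le.1 h2).1
  have := mul_le_mul_of_nonneg_right hp (norm_nonneg (θ - p))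
  rw [norm_sub_rev p θ]
  linarith

lemma infconv_strict {lam : ℝ} (hC2 : ContDiff ℝ 2 f) (hc : ConvexOn ℝ Set.univ f)
    {p : EuclideanSpace ℝ (Fin d)} (hp : ‖fderiv ℝ f p‖ < lam) (θ : EuclideanSpace ℝ (Fin d))
    (hne : θ ≠ p) :
    f p < f θ + lam * ‖p - θ‖ := by
  have h := infconv hC2 hc (le_refl ‖fderiv ℝ f p‖) θ
  have : 0 < ‖p - θ‖ := norm_pos_iff.2 (sub_ne_zero.2 hne.symm)
  nlinarith

/-- lower bound on the inf-convolution -/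
lemma lower {lam t : ℝ} (hC2 : ContDiff ℝ 2 f) (hc : ConvexOn ℝ Set.univ f) (hM : 0 ≤ M)
    (hρ : 0 < ρ) (hL : 0 ≤ L)
    (hh : ∀ θ ∈ closedBall b M, ∀ v, ρ * ‖v‖ ^ 2 ≤ hessQ f θ v ∧ hessQ f θ v ≤ L * ‖v‖ ^ 2)
    (hg : ‖fderiv ℝ f b‖ ≤ η) (ht0 : 0 ≤ t) (htM : t ≤ M) (htl : η + L * t ≤ lam)
    (p θ : EuclideanSpace ℝ (Fin d)) (htp : t ≤ ‖p - b‖)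
    (hsgn : t = ‖p - b‖ ∨ (0 < t ∧ 0 ≤ ρ * t ^ 2 / 2 - η * t)) :
    f b + (ρ * t ^ 2 / 2 - η * t) ≤ f θ + lam * ‖p - θ‖ := by
  have near : ∀ q θ, ‖q - b‖ = t →
      f b + (ρ * t ^ 2 / 2 - η * t) ≤ f θ + lam * ‖q - θ‖ := by
    intro q θ hq
    have hqm : q ∈ closedBall b M := by rw [mem_closedBall, dist_eq_norm]; linarith
    have h1 := grad_bound hC2 hM hL (fun θ hθ v => ⟨by have := (hh θ hθ v).1; exact le_trans (by positivity) this, (hh θ hθ v).2⟩) hg hqm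
    rw [hq] at h1
    have h2 := infconv hC2 hc (h1.trans htl) θ
    have h3 := (taylor_lower hC2 hM (fun θ hθ v => (hh θ hθ v).1) hqm).2
    have h4 := (fderiv ℝ f b).le_opNorm (q - b)
    rw [Real.norm_eq_abs] at h4
    have h5 := (abs_le.1 h4).1
    rw [hq] at h3 h5
    have := mul_le_mul_of_nonneg_right hg ht0
    linarith
  rcases hsgn with h | ⟨htpos, h⟩
  · exact near p θ h.symm
  rcases eq_or_lt_of_le htp with h' | hlt
  · exact near p θ h'.symm
  have hr : 0 < ‖p - b‖ := lt_of_le_of_lt ht0 hlt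
  set s := t / ‖p - b‖ with hs
  have hs0 : 0 ≤ s := by positivity
  have hs1 : s ≤ 1 := by rw [hs, div_le_one hr]; exact htp
  have hq := near (b + s • (p - b)) (b + s • (θ - b)) (by
    rw [add_sub_cancel_left, norm_smul, Real.norm_of_nonneg hs0, hs]; field_simp)
  have hcv := hc.2 (Set.mem_univ b) (Set.mem_univ θ) (sub_nonneg.2 hs1) hs0 (by ring)
  have e1 : (1 - s) • b + s • θ = b + s • (θ - b) := by module
  have e2 : b + s • (p - b) - (b + s • (θ - b)) = s • (p - θ) := by module
  rw [e1] at hcv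
  rw [e2, norm_smul, Real.norm_of_nonneg hs0] at hq
  simp only [smul_eq_mul] at hcv
  set w := ρ * t ^ 2 / 2 - η * t
  have h5 : w ≤ s * (f θ + lam * ‖p - θ‖ - f b) := by nlinarith
  by_contra hcon
  push Not at hcon
  have hlt2 : f θ + lam * ‖p - θ‖ - f b < w := by linarith
  rcases le_or_gt 0 (f θ + lam * ‖p - θ‖ - f b) with h6 | h6
  · nlinarith
  · have : s * (f θ + lam * ‖p - θ‖ - f b) ≤ 0 := by nlinarith
    have hw : w = 0 := by linarith
    have : 0 ≤ s * (f θ + lam * ‖p - θ‖ - f b) := by linarith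
    have h7 : 0 < s := by positivity
    nlinarith
end

lemma numerics {ρ L η M lam A S K m mm : ℝ} (hρ : 0 < ρ) (hρL : ρ ≤ L) (hη : 0 < η)
    (hK : 2 ≤ K) (hmm : 1 ≤ mm) (hmK : K * mm ≤ m)
    (hA : A = Real.sqrt (m / mm)) (hS : S = Real.sqrt (K * m * L / (mm * ρ)))
    (hlam1 : 7 * η * L / ρ * S < lam) (hlam2 : lam < L * M) :
    A ^ 2 * mm = m ∧ 1 ≤ A ∧ A ≤ S ∧ 2 ≤ S ∧ 2 * L * A ^ 2 ≤ ρ * S ^ 2 ∧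
    5 * (η / ρ) * S ≤ M ∧ η + L * (5 * (η / ρ) * S) < lam := by
  have hL : 0 < L := hρ.trans_le hρL
  have hmm0 : 0 < mm := by linarith
  have hm0 : 0 < m := by nlinarith
  have hA0 : 0 ≤ A := hA ▸ Real.sqrt_nonneg _
  have hS0 : 0 ≤ S := hS ▸ Real.sqrt_nonneg _
  have hK0 : 0 < K := by linarith
  have hA2 : A ^ 2 = m / mm := by rw [hA, Real.sq_sqrt]; positivity
  have hS2 : S ^ 2 = K * m * L / (mm * ρ) := by rw [hS, Real.sq_sqrt]; positivity
  have e1 : A ^ 2 * mm = m := by rw [hA2]; field_simp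
  have e2 : ρ * S ^ 2 = K * L * A ^ 2 := by rw [hS2, hA2]; field_simp
  have e3 : K ≤ A ^ 2 := by rw [hA2, le_div_iff₀ hmm0]; exact hmK
  have hA1 : 1 ≤ A := by nlinarith
  have e4 : 2 * L * A ^ 2 ≤ ρ * S ^ 2 := by
    rw [e2]
    have : 0 ≤ L * A ^ 2 := by positivity
    nlinarith
  have e5 : 2 * A ^ 2 ≤ S ^ 2 := by
    have : ρ * (2 * A ^ 2) ≤ ρ * S ^ 2 := by nlinarith [sq_nonneg A]
    exact le_of_mul_le_mul_left this hρ
  have hAS : A ≤ S := by nlinarith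
  have hS2' : 2 ≤ S := by nlinarith
  have hu : 0 < η / ρ := by positivity
  have e6 : 7 * η * L / ρ * S = L * (7 * (η / ρ) * S) := by ring
  rw [e6] at hlam1
  have e7 : η = ρ * (η / ρ) := by field_simp
  have hus : 0 < (η / ρ) * S := by positivity
  refine ⟨e1, hA1, hAS, hS2', e4, ?_, ?_⟩
  · have : 7 * (η / ρ) * S < M := lt_of_mul_lt_mul_left (hlam1.trans hlam2) hL.le
    nlinarith
  · have : η ≤ L * (2 * (η / ρ) * S) := by
      calc η = ρ * (η / ρ) := e7
        _ ≤ L * (η / ρ) := by gcongr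
        _ ≤ L * (2 * (η / ρ) * S) := by
          have : η / ρ ≤ 2 * (η / ρ) * S := by nlinarith
          gcongr
    nlinarith

set_option maxHeartbeats 2000000 in
/-- Exact recovery for clustered ARMUL: under separation and balancedness, the estimated
labels recover the true clustering up to a permutation and the estimated centers are the
oracle per-cluster pooled minimizers. -/
theorem stmt_13 (d m K : ℕ) (hd : 1 ≤ d) (hm : 1 ≤ m) (hK : 2 ≤ K)
    (f : Fin m → EuclideanSpace ℝ (Fin d) → ℝ)
    (hconv : ∀ j, ConvexOn ℝ Set.univ (f j)) (hC2 : ∀ j, ContDiff ℝ 2 (f j))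
    (βs : Fin K → EuclideanSpace ℝ (Fin d)) (zs : Fin m → Fin K)
    (hTne : ∀ k : Fin K, (Finset.univ.filter fun j => zs j = k).Nonempty)
    (mmin : ℕ)
    (hmmin : IsLeast
      (Set.range fun k : Fin K => (Finset.univ.filter fun j => zs j = k).card) mmin)
    (ρ L η M lam : ℝ) (hρ : 0 < ρ) (hρL : ρ ≤ L) (hη : 0 < η) (hM : 0 < M)
    (hhess : ∀ j, ∀ θ ∈ closedBall (βs (zs j)) M, ∀ v,
      ρ * ‖v‖ ^ 2 ≤ hessQ (f j) θ v ∧ hessQ (f j) θ v ≤ L * ‖v‖ ^ 2)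
    (hgrad : ∀ j, ‖gradient (f j) (βs (zs j))‖ ≤ η)
    (hsep : ∀ k l : Fin K, k ≠ l →
      2 * η / ρ * (1 + 4 * Real.sqrt (K * m * L / (mmin * ρ))) < ‖βs k - βs l‖)
    (hlam1 : 7 * η * L / ρ * Real.sqrt (K * m * L / (mmin * ρ)) < lam)
    (hlam2 : lam < L * M)
    (θhat : Fin m → EuclideanSpace ℝ (Fin d)) (βhat : Fin K → EuclideanSpace ℝ (Fin d))
    (zhat : Fin m → Fin K)
    (hmin : ∀ (θ : Fin m → EuclideanSpace ℝ (Fin d))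
        (β : Fin K → EuclideanSpace ℝ (Fin d)) (z : Fin m → Fin K),
      ∑ j, (f j (θhat j) + lam * ‖βhat (zhat j) - θhat j‖) ≤
      ∑ j, (f j (θ j) + lam * ‖β (z j) - θ j‖)) :
    ∃ τ : Equiv.Perm (Fin K),
      (∀ j, zhat j = τ (zs j)) ∧ (∀ j, θhat j = βhat (zhat j)) ∧
      ∀ k : Fin K,
        (∀ β, ∑ j ∈ Finset.univ.filter (fun j => zs j = k), f j (βhat (τ k)) ≤
              ∑ j ∈ Finset.univ.filter (fun j => zs j = k), f j β) ∧
        ‖βhat (τ k) - βs k‖ ≤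
          ‖∑ j ∈ Finset.univ.filter (fun j => zs j = k), gradient (f j) (βs k)‖ /
            (ρ * ((Finset.univ.filter fun j => zs j = k).card : ℝ)) := by
  classical
  have hL : 0 < L := hρ.trans_le hρL
  obtain ⟨k0, hk0⟩ := hmmin.1
  have hmm1 : (1:ℝ) ≤ mmin := by
    have := (hTne k0).card_pos
    simp only at hk0
    exact_mod_cast (by omega : 1 ≤ mmin)
  have hTcard : ∀ k : Fin K, (mmin : ℝ) ≤ (Finset.univ.filter fun j => zs j = k).card :=
    fun k => by exact_mod_cast hmmin.2 ⟨k, rfl⟩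
  have hmK : (K : ℝ) * mmin ≤ m := by
    have h1 : ∑ k : Fin K, (Finset.univ.filter fun j => zs j = k).card = m := by
      rw [← Finset.card_eq_sum_card_fiberwise (f := zs) (s := Finset.univ)
        (t := Finset.univ) (by intro x _; simp)]
      simp
    have h2 : ∑ k : Fin K, (mmin : ℝ) ≤
        ∑ k : Fin K, ((Finset.univ.filter fun j => zs j = k).card : ℝ) :=
      Finset.sum_le_sum fun k _ => hTcard k
    have h3 : ∑ k : Fin K, ((Finset.univ.filter fun j => zs j = k).card : ℝ) = m := by
      exact_mod_cast h1
    rw [h3] at h2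
    simpa using h2
  set S := Real.sqrt (K * m * L / (mmin * ρ)) with hS
  obtain ⟨A, hA⟩ : ∃ A, A = Real.sqrt ((m:ℝ) / mmin) := ⟨_, rfl⟩
  obtain ⟨nA, hA1, hAS, hS2, hLA, hRM, hRl⟩ :=
    numerics hρ hρL hη (by exact_mod_cast hK) hmm1 hmK hA hS hlam1 hlam2
  obtain ⟨u, hu⟩ : ∃ u, u = η / ρ := ⟨_, rfl⟩
  have hu0 : 0 < u := by rw [hu]; positivity
  have hηu : η = ρ * u := by rw [hu]; field_simp
  rw [← hu] at hRM hRl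
  have hsep' : ∀ k l : Fin K, k ≠ l → 2 * u + 8 * u * S < ‖βs k - βs l‖ := by
    intro k l hkl
    have := hsep k l hkl
    have e : 2 * η / ρ * (1 + 4 * S) = 2 * u + 8 * u * S := by rw [hu]; ring
    linarith
  have hM0 := hM.le
  have hg : ∀ j, ‖fderiv ℝ (f j) (βs (zs j))‖ ≤ η := by
    intro j
    rw [← toDual_gradient, LinearIsometryEquiv.norm_map]
    exact hgrad j
  have hlam0 : 0 < lam := by
    have : 0 < L * (5 * u * S) := by positivity
    linarith
  have huA : 3 * u * A ≤ 5 * u * S := by nlinarith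
  -- lower bound for the inf-convolutions
  have hlow : ∀ j (t : ℝ), 0 ≤ t → t ≤ 5 * u * S → ∀ p θ, t ≤ ‖p - βs (zs j)‖ →
      (t = ‖p - βs (zs j)‖ ∨ 2 * u ≤ t) →
      f j (βs (zs j)) + (ρ * t ^ 2 / 2 - η * t) ≤ f j θ + lam * ‖p - θ‖ := by
    intro j t ht0 ht p θ htp hs
    refine lower (hC2 j) (hconv j) hM0 hρ hL.le (hhess j) (hg j) ht0 (ht.trans hRM) ?_ p θ htp ?_
    · have := mul_le_mul_of_nonneg_left ht hL.le
      linarith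
    · rcases hs with h | h
      · exact Or.inl h
      · refine Or.inr ⟨by linarith, ?_⟩
        have : ρ * t ^ 2 / 2 - η * t = ρ * t / 2 * (t - 2 * u) := by rw [hηu]; ring
        rw [this]
        exact mul_nonneg (by positivity) (by linarith)
  have huniv : ∀ j p θ, f j (βs (zs j)) - ρ * u ^ 2 / 2 ≤ f j θ + lam * ‖p - θ‖ := by
    intro j p θ
    rcases le_total ‖p - βs (zs j)‖ (5 * u * S) with h | h
    · have h1 := hlow j _ (norm_nonneg _) h p θ le_rfl (Or.inl rfl)
      have h2 : 0 ≤ ρ * (‖p - βs (zs j)‖ - u) ^ 2 := by positivity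
      rw [hηu] at h1
      nlinarith
    · have h1 := hlow j (5 * u * S) (by positivity) le_rfl p θ h (Or.inr (by nlinarith))
      have h2 : 0 ≤ ρ * (5 * u * S - u) ^ 2 := by positivity
      rw [hηu] at h1
      nlinarith
  -- optimality, one task at a time
  have hsingle : ∀ j θ l, f j (θhat j) + lam * ‖βhat (zhat j) - θhat j‖ ≤
      f j θ + lam * ‖βhat l - θ‖ := by
    intro j θ l
    have h := hmin (Function.update θhat j θ) βhat (Function.update zhat j l)
    rw [← Finset.add_sum_erase _ _ (Finset.mem_univ j),
      ← Finset.add_sum_erase _ (fun i => f i (Function.update θhat j θ i) +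
        lam * ‖βhat (Function.update zhat j l i) - Function.update θhat j θ i‖)
        (Finset.mem_univ j)] at h
    have e : ∑ i ∈ Finset.univ.erase j, (f i (Function.update θhat j θ i) +
        lam * ‖βhat (Function.update zhat j l i) - Function.update θhat j θ i‖) =
        ∑ i ∈ Finset.univ.erase j, (f i (θhat i) + lam * ‖βhat (zhat i) - θhat i‖) := by
      refine Finset.sum_congr rfl fun i hi => ?_
      have hne := Finset.ne_of_mem_erase hi
      simp [Function.update_of_ne hne]
    rw [e] at h
    simp only [Function.update_self] at h
    linarith
  -- each true centre is close to an estimated one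
  have hnear : ∀ k, ∃ j, zs j = k ∧ ‖βhat (zhat j) - βs k‖ < 3 * u * A := by
    intro k
    by_contra hcon
    push Not at hcon
    have h0 := hmin (fun j => βs (zs j)) βs zs
    simp only [sub_self, norm_zero, mul_zero, add_zero] at h0
    have hterm : ∀ j, f j (βs (zs j)) - ρ * u ^ 2 / 2 +
        (if zs j = k then ρ * u ^ 2 * A ^ 2 else 0) ≤
        f j (θhat j) + lam * ‖βhat (zhat j) - θhat j‖ := by
      intro j
      split_ifs with hj
      · have hfar := hcon j hj
        rw [← hj] at hfar
        have h1 := hlow j (3 * u * A) (by positivity) huA (βhat (zhat j)) (θhat j) hfar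
          (Or.inr (by nlinarith))
        rw [hηu] at h1
        have e : ρ * (3 * u * A) ^ 2 / 2 - ρ * u * (3 * u * A) =
          ρ * u ^ 2 * A ^ 2 + ρ * u ^ 2 * (7 / 2 * A ^ 2 - 3 * A) := by ring
        have h2 : 0 ≤ ρ * u ^ 2 * (7 / 2 * A ^ 2 - 3 * A) :=
          mul_nonneg (by positivity) (by nlinarith)
        have h3 : 0 ≤ ρ * u ^ 2 := by positivity
        linarith
      · have := huniv j (βhat (zhat j)) (θhat j)
        linarith
    have hsum := Finset.sum_le_sum fun j (_ : j ∈ Finset.univ) => hterm j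
    rw [Finset.sum_add_distrib, Finset.sum_sub_distrib, ← Finset.sum_filter] at hsum
    simp only [Finset.sum_const, Finset.card_univ, Fintype.card_fin, nsmul_eq_mul] at hsum
    have h4 := mul_le_mul_of_nonneg_right (hTcard k)
      (by positivity : 0 ≤ ρ * u ^ 2 * A ^ 2)
    have h5 : (mmin : ℝ) * (ρ * u ^ 2 * A ^ 2) = m * (ρ * u ^ 2) := by rw [← nA]; ring
    have h6 : (0:ℝ) < m * (ρ * u ^ 2) := by
      have : (0:ℝ) < m := by exact_mod_cast hm
      positivity
    linarith
  choose J hJz hJn using hnear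
  have hinj : Function.Injective (fun k => zhat (J k)) := by
    intro k l hkl
    by_contra hne
    have h1 := hsep' k l hne
    have h2 := hJn k
    have h3 := hJn l
    simp only at hkl
    rw [← hkl] at h3
    have h4 : ‖βs k - βs l‖ ≤ ‖βhat (zhat (J k)) - βs k‖ + ‖βhat (zhat (J k)) - βs l‖ := by
      rw [norm_sub_rev (βhat (zhat (J k))) (βs k)]
      exact norm_sub_le_norm_sub_add_norm_sub _ _ _
    have h5 : u * A ≤ u * S := by gcongr
    have h6 : 0 < u * A := by positivity
    linarith
  obtain ⟨τ, hτ⟩ : ∃ τ : Equiv.Perm (Fin K), ∀ k, τ k = zhat (J k) :=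
    ⟨Equiv.ofBijective _ (Finite.injective_iff_bijective.1 hinj), fun k => rfl⟩
  have hclose : ∀ k, ‖βhat (τ k) - βs k‖ < 3 * u * A := fun k => by rw [hτ]; exact hJn k
  have hball : ∀ k, βhat (τ k) ∈ closedBall (βs k) M := fun k => by
    rw [mem_closedBall, dist_eq_norm]
    linarith [hclose k]
  have hz : ∀ j, zhat j = τ (zs j) := by
    intro j
    by_contra hne
    obtain ⟨l, hl⟩ := τ.surjective (zhat j)
    have hlk : zs j ≠ l := by
      rintro rfl
      exact hne hl.symm
    have h1 := hsingle j (βhat (τ (zs j))) (τ (zs j))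
    simp only [sub_self, norm_zero, mul_zero, add_zero] at h1
    have h2 := taylor_upper (hC2 j) hM0 (fun θ hθ v => (hhess j θ hθ v).2) (hball (zs j))
    have h3 := (fderiv ℝ (f j) (βs (zs j))).le_opNorm (βhat (τ (zs j)) - βs (zs j))
    rw [Real.norm_eq_abs] at h3
    have h4 := (abs_le.1 h3).2
    have hc := hclose (zs j)
    have h5 : ‖fderiv ℝ (f j) (βs (zs j))‖ * ‖βhat (τ (zs j)) - βs (zs j)‖ ≤
        η * (3 * u * A) := mul_le_mul (hg j) hc.le (norm_nonneg _) hη.le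
    have h6 : L * ‖βhat (τ (zs j)) - βs (zs j)‖ ^ 2 ≤ L * (3 * u * A) ^ 2 := by gcongr
    have hs := hsep' (zs j) l hlk
    have hcl := hclose l
    have h7 : ‖βs (zs j) - βs l‖ ≤ ‖βhat (τ l) - βs (zs j)‖ + ‖βhat (τ l) - βs l‖ := by
      rw [norm_sub_rev (βhat (τ l)) (βs (zs j))]
      exact norm_sub_le_norm_sub_add_norm_sub _ _ _
    have h8 : 5 * u * S ≤ ‖βhat (zhat j) - βs (zs j)‖ := by
      rw [← hl]
      have : u * A ≤ u * S := by gcongr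
      linarith
    have h9 := hlow j (5 * u * S) (by positivity) le_rfl _ (θhat j) h8 (Or.inr (by nlinarith))
    rw [hηu] at h9 h5
    have h10 : ρ * u * (5 * u * S) + (ρ * u * (3 * u * A) + L * (3 * u * A) ^ 2 / 2) <
        ρ * (5 * u * S) ^ 2 / 2 := by
      have e : ρ * (5 * u * S) ^ 2 / 2 - (ρ * u * (5 * u * S) +
        (ρ * u * (3 * u * A) + L * (3 * u * A) ^ 2 / 2)) =
        u ^ 2 * (25 / 2 * (ρ * S ^ 2) - 5 * (ρ * S) - 3 * (ρ * A) - 9 / 2 * (L * A ^ 2)) := by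
        ring
      have a1 : 2 * (ρ * S) ≤ ρ * S ^ 2 := by nlinarith [mul_nonneg hρ.le (by linarith : 0 ≤ S)]
      have a2 : ρ * A ≤ L * A ^ 2 := by
        calc ρ * A ≤ L * A := by gcongr
          _ ≤ L * A ^ 2 := by gcongr; nlinarith
      have a3 : 0 < L * A ^ 2 := by positivity
      have : 0 < u ^ 2 * (25 / 2 * (ρ * S ^ 2) - 5 * (ρ * S) - 3 * (ρ * A)
          - 9 / 2 * (L * A ^ 2)) := mul_pos (by positivity) (by linarith)
      linarith
    linarith
  have hgr : ∀ j, ‖fderiv ℝ (f j) (βhat (τ (zs j)))‖ < lam := by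
    intro j
    have h1 := grad_bound (hC2 j) hM0 hL.le (fun θ hθ v =>
      ⟨le_trans (by positivity) (hhess j θ hθ v).1, (hhess j θ hθ v).2⟩) (hg j) (hball (zs j))
    have h2 : L * ‖βhat (τ (zs j)) - βs (zs j)‖ ≤ L * (5 * u * S) := by
      have := hclose (zs j)
      gcongr
      linarith
    linarith
  have hθ : ∀ j, θhat j = βhat (zhat j) := by
    intro j
    by_contra hne
    rw [hz j] at hne
    have h1 := infconv_strict (hC2 j) (hconv j) (hgr j) (θhat j) hne
    have h2 := hsingle j (βhat (τ (zs j))) (τ (zs j))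
    rw [hz j] at h2
    simp only [sub_self, norm_zero, mul_zero, add_zero] at h2
    linarith
  refine ⟨τ, hz, hθ, fun k => ?_⟩
  have hglob : ∀ β, ∑ j ∈ Finset.univ.filter (fun j => zs j = k), f j (βhat (τ k)) ≤
      ∑ j ∈ Finset.univ.filter (fun j => zs j = k), f j β := by
    intro β
    have h := hmin (fun j => if zs j = k then β else θhat j) (Function.update βhat (τ k) β) zhat
    rw [← Finset.sum_filter_add_sum_filter_not _ (fun j => zs j = k),
      ← Finset.sum_filter_add_sum_filter_not Finset.univ (fun j => zs j = k)
        (fun j => f j (if zs j = k then β else θhat j) + _)] at h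
    have e1 : ∑ j ∈ Finset.univ.filter (fun j => zs j = k),
        (f j (θhat j) + lam * ‖βhat (zhat j) - θhat j‖) =
        ∑ j ∈ Finset.univ.filter (fun j => zs j = k), f j (βhat (τ k)) := by
      refine Finset.sum_congr rfl fun j hj => ?_
      rw [Finset.mem_filter] at hj
      rw [hθ j, hz j, hj.2]
      simp
    have e2 : ∑ j ∈ Finset.univ.filter (fun j => zs j = k),
        (f j (if zs j = k then β else θhat j) +
          lam * ‖Function.update βhat (τ k) β (zhat j) - (if zs j = k then β else θhat j)‖) =
        ∑ j ∈ Finset.univ.filter (fun j => zs j = k), f j β := by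
      refine Finset.sum_congr rfl fun j hj => ?_
      rw [Finset.mem_filter] at hj
      rw [hz j, hj.2]
      simp
    have e3 : ∑ j ∈ Finset.univ.filter (fun j => ¬ zs j = k),
        (f j (if zs j = k then β else θhat j) +
          lam * ‖Function.update βhat (τ k) β (zhat j) - (if zs j = k then β else θhat j)‖) =
        ∑ j ∈ Finset.univ.filter (fun j => ¬ zs j = k),
          (f j (θhat j) + lam * ‖βhat (zhat j) - θhat j‖) := by
      refine Finset.sum_congr rfl fun j hj => ?_
      rw [Finset.mem_filter] at hj
      have hne : zhat j ≠ τ k := by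
        rw [hz j]
        exact fun h => hj.2 (τ.injective h)
      rw [Function.update_of_ne hne, if_neg hj.2]
    rw [e1, e2, e3] at h
    linarith
  refine ⟨hglob, ?_⟩
  set T := Finset.univ.filter (fun j => zs j = k) with hT
  have hdiff : ∀ j, Differentiable ℝ (f j) := fun j => (hC2 j).differentiable (by norm_num)
  have hzero : ∑ j ∈ T, fderiv ℝ (f j) (βhat (τ k)) = 0 := by
    have hF : HasFDerivAt (fun β => ∑ j ∈ T, f j β) (∑ j ∈ T, fderiv ℝ (f j) (βhat (τ k)))
        (βhat (τ k)) := HasFDerivAt.fun_sum fun j _ => (hdiff j _).hasFDerivAt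
    have hlm : IsLocalMin (fun β => ∑ j ∈ T, f j β) (βhat (τ k)) :=
      Filter.Eventually.of_forall hglob
    exact hlm.hasFDerivAt_eq_zero hF
  have hTpos : (0:ℝ) < T.card := by linarith [hTcard k]
  have hmono : ∑ j ∈ T, ρ * ‖βhat (τ k) - βs k‖ ^ 2 ≤
      ∑ j ∈ T, (fderiv ℝ (f j) (βhat (τ k)) (βhat (τ k) - βs k) -
        fderiv ℝ (f j) (βs k) (βhat (τ k) - βs k)) := by
    refine Finset.sum_le_sum fun j hj => ?_
    have hj2 : zs j = k := by simpa [hT] using hj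
    subst hj2
    exact (taylor_lower (hC2 j) hM0 (fun θ hθ v => (hhess j θ hθ v).1) (hball (zs j))).1
  have hz1 : ∑ j ∈ T, fderiv ℝ (f j) (βhat (τ k)) (βhat (τ k) - βs k) = 0 := by
    have := congrArg (fun φ => φ (βhat (τ k) - βs k)) hzero
    simpa only [_root_.sum_apply, zero_apply] using this
  have hz2 : ∑ j ∈ T, fderiv ℝ (f j) (βs k) (βhat (τ k) - βs k) =
      inner ℝ (∑ j ∈ T, gradient (f j) (βs k)) (βhat (τ k) - βs k) := by
    rw [sum_inner]
    exact Finset.sum_congr rfl fun j _ => inner_gradient_left.symm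
  rw [Finset.sum_sub_distrib, hz1, hz2, Finset.sum_const, nsmul_eq_mul] at hmono
  have hcs := abs_le.1 (abs_real_inner_le_norm (∑ j ∈ T, gradient (f j) (βs k))
    (βhat (τ k) - βs k))
  rw [le_div_iff₀ (mul_pos hρ hTpos)]
  rcases eq_or_lt_of_le (norm_nonneg (βhat (τ k) - βs k)) with h0 | h0
  · rw [← h0]
    simp
  · refine le_of_mul_le_mul_right ?_ h0
    nlinarith [hcs.1]
end

section
/- Let d, m ≥ 1, K ≥ 2 and α ∈ (0, 1]. Let f_1,…,f_m : ℝ^d → ℝ be convex functions, β*_1,…,β*_K ∈ ℝ^d, z*_1,…,z*_m ∈ {1,…,K}, T(k) = {j : z*_j = k}. Suppose there exist 0 < ρ ≤ L < ∞, η > 0, M > 0 and S ⊆ {1,…,m} with |S^c|/m ≤ αρ/(6K²L) such that: (i) for every j ∈ S, f_j is twice continuously differentiable with ‖∇f_j(β*_{z*_j})‖₂ ≤ η and ρ·I ⪯ ∇²f_j(θ) ⪯ L·I for all θ ∈ B(β*_{z*_j}, M); (ii) min_k |T(k)| ≥ (αm/K)·(1 + ρ/(6LK)). Suppose also 9KLη/(√α·ρ)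 < λ < ρ·min{ M, min_{k≠l} ‖β*_k − β*_l‖₂/6 }. Then for every minimizer (θ̂_1,…,θ̂_m, β̂_1,…,β̂_K, ẑ) of Σ_{j=1}^m [ f_j(θ_j) + λ‖β_{z_j} − θ_j‖₂ ] over θ_j ∈ ℝ^d, β_k ∈ ℝ^d, z ∈ {1,…,K}^m subject to min_k |{j : z_j = k}| ≥ αm/K, there exists a permutation τ of {1,…,K} such that ẑ_j = τ(z*_j) and θ̂_j = β̂_{ẑ_j} hold for all j ∈ S, and for each k, ‖β̂_{τ(k)} − β̂_k^{oracle}‖₂ ≤ λ·|S^c|/(ρ·|T(k)∩S|), where β̂_k^{oracle} is a global minimizer of β ↦ Σ_{j∈T(k)∩S} f_j(β). -/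
open Metric Finset

lemma cvx_ineq {F : Type*} [AddCommGroup F] [Module ℝ F] {s : Set F} {f : F → ℝ}
    (h : ConvexOn ℝ s f) {x y : F} (hx : x ∈ s) (hy : y ∈ s) {a b : ℝ} (ha : 0 ≤ a) (hb : 0 ≤ b)
    (hab : a + b = 1) : f (a • x + b • y) ≤ a * f x + b * f y :=
  h.2 hx hy ha hb hab

lemma oneD_conv (φ φ' φ'' : ℝ → ℝ) (c : ℝ) (h1 : ∀ s, HasDerivAt φ (φ' s) s)
    (h2 : ∀ s, HasDerivAt φ' (φ'' s) s) (hc : ∀ s ∈ Set.Icc (0:ℝ) 1, c ≤ φ'' s) :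
    ConvexOn ℝ (Set.Icc (0:ℝ) 1) (fun s => φ s - c / 2 * s ^ 2) := by
  have d1 : ∀ s, HasDerivAt (fun s => φ s - c / 2 * s ^ 2) (φ' s - c * s) s := by
    intro s
    have := (h1 s).sub (((hasDerivAt_id s).pow 2).const_mul (c / 2))
    refine this.congr_deriv ?_
    simp; ring
  have d2 : ∀ s, HasDerivAt (fun s => φ' s - c * s) (φ'' s - c) s := by
    intro s
    have := (h2 s).sub ((hasDerivAt_id s).const_mul c)
    refine this.congr_deriv ?_
    simp
  refine convexOn_of_hasDerivWithinAt2_nonneg (f' := fun s => φ' s - c * s)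
    (f'' := fun s => φ'' s - c) (convex_Icc 0 1)
    (fun s _ => (d1 s).continuousAt.continuousWithinAt) (fun s _ => (d1 s).hasDerivWithinAt)
    (fun s _ => (d2 s).hasDerivWithinAt) ?_
  intro s hs
  have := hc s (interior_subset hs)
  linarith

lemma oneD_taylor (φ φ' φ'' : ℝ → ℝ) (c : ℝ) (h1 : ∀ s, HasDerivAt φ (φ' s) s)
    (h2 : ∀ s, HasDerivAt φ' (φ'' s) s) (hc : ∀ s ∈ Set.Icc (0:ℝ) 1, c ≤ φ'' s) :
    φ 0 + φ' 0 + c / 2 ≤ φ 1 := by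
  have hcv := oneD_conv φ φ' φ'' c h1 h2 hc
  have d1 : HasDerivAt (fun s => φ s - c / 2 * s ^ 2) (φ' 0) 0 := by
    have := (h1 0).sub (((hasDerivAt_id (0:ℝ)).pow 2).const_mul (c / 2))
    refine this.congr_deriv ?_
    simp
  have := hcv.le_slope_of_hasDerivAt (x := 0) (y := 1) (by simp) (by simp) (by norm_num) d1
  simp [slope_def_field] at this
  linarith

section loc
variable {d : ℕ}

lemma line_d1 (f : EuclideanSpace ℝ (Fin d) → ℝ) (hf : ContDiff ℝ 2 f) (x v : EuclideanSpace ℝ (Fin d)) (s : ℝ) :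
    HasDerivAt (fun s : ℝ => f (x + s • v)) (fderiv ℝ f (x + s • v) v) s := by
  have h : HasFDerivAt f (fderiv ℝ f (x + s • v)) (x + s • v) :=
    ((hf.differentiable (by norm_num)) _).hasFDerivAt
  have hl : HasDerivAt (fun s : ℝ => x + s • v) v s := by
    simpa using ((hasDerivAt_id s).smul_const v).const_add x
  exact h.comp_hasDerivAt s hl

lemma line_d2 (f : EuclideanSpace ℝ (Fin d) → ℝ) (hf : ContDiff ℝ 2 f) (x v : EuclideanSpace ℝ (Fin d)) (s : ℝ) :
    HasDerivAt (fun s : ℝ => fderiv ℝ f (x + s • v) v) (hessQ f (x + s • v) v) s := by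
  have hd : Differentiable ℝ (fderiv ℝ f) :=
    (hf.fderiv_right (m := 1) (by norm_num)).differentiable (by norm_num)
  have h : HasFDerivAt (fderiv ℝ f) (fderiv ℝ (fderiv ℝ f) (x + s • v)) (x + s • v) :=
    (hd _).hasFDerivAt
  have hl : HasDerivAt (fun s : ℝ => x + s • v) v s := by
    simpa using ((hasDerivAt_id s).smul_const v).const_add x
  have h2 := h.comp_hasDerivAt s hl
  have h3 := h2.clm_apply (hasDerivAt_const s v)
  refine h3.congr_deriv ?_
  simp [hessQ, iteratedFDeriv_two_apply]

lemma grad_bd (f : EuclideanSpace ℝ (Fin d) → ℝ) (x v : EuclideanSpace ℝ (Fin d)) (η : ℝ)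
    (h : ‖gradient f x‖ ≤ η) : |fderiv ℝ f x v| ≤ η * ‖v‖ := by
  have h1 : ‖fderiv ℝ f x‖ = ‖gradient f x‖ := by
    simp [gradient]
  have := (fderiv ℝ f x).le_opNorm v
  rw [h1] at this
  exact this.trans (mul_le_mul_of_nonneg_right h (norm_nonneg _))

lemma F1 (f : EuclideanSpace ℝ (Fin d) → ℝ) (hf : ContDiff ℝ 2 f) (b : EuclideanSpace ℝ (Fin d)) (ρ L η M : ℝ)
    (hg : ‖gradient f b‖ ≤ η)
    (hh : ∀ θ ∈ closedBall b M, ∀ v, ρ * ‖v‖ ^ 2 ≤ hessQ f θ v ∧ hessQ f θ v ≤ L * ‖v‖ ^ 2)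
    (x : EuclideanSpace ℝ (Fin d)) (hx : ‖x - b‖ ≤ M) :
    f b - η * ‖x - b‖ + ρ / 2 * ‖x - b‖ ^ 2 ≤ f x ∧
    f x ≤ f b + η * ‖x - b‖ + L / 2 * ‖x - b‖ ^ 2 := by
  have hin : ∀ s ∈ Set.Icc (0:ℝ) 1, b + s • (x - b) ∈ closedBall b M := by
    intro s hs
    rw [mem_closedBall, dist_eq_norm, add_sub_cancel_left, norm_smul, Real.norm_eq_abs,
      abs_of_nonneg hs.1]
    exact (mul_le_of_le_one_left (norm_nonneg _) hs.2).trans hx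
  have hgb := abs_le.1 (grad_bd f b (x - b) η hg)
  have t1 := oneD_taylor _ _ _ (ρ * ‖x - b‖ ^ 2) (line_d1 f hf b (x - b)) (line_d2 f hf b (x - b))
    (fun s hs => (hh _ (hin s hs) _).1)
  have t2 := oneD_taylor _ _ _ (-(L * ‖x - b‖ ^ 2)) (fun s => (line_d1 f hf b (x - b) s).neg)
    (fun s => (line_d2 f hf b (x - b) s).neg)
    (fun s hs => neg_le_neg (hh _ (hin s hs) _).2)
  simp at t1 t2
  simp only [map_sub] at hgb
  constructor <;> linarith

lemma F2 (f : EuclideanSpace ℝ (Fin d) → ℝ) (hf : ContDiff ℝ 2 f) (b : EuclideanSpace ℝ (Fin d)) (ρ L M : ℝ)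
    (hh : ∀ θ ∈ closedBall b M, ∀ v, ρ * ‖v‖ ^ 2 ≤ hessQ f θ v ∧ hessQ f θ v ≤ L * ‖v‖ ^ 2)
    (x y : EuclideanSpace ℝ (Fin d)) (hx : x ∈ closedBall b M) (hy : y ∈ closedBall b M) (s : ℝ) (hs0 : 0 ≤ s)
    (hs1 : s ≤ 1) :
    f (x + s • (y - x)) ≤ (1 - s) * f x + s * f y - ρ / 2 * (s * (1 - s)) * ‖y - x‖ ^ 2 := by
  have hin : ∀ s ∈ Set.Icc (0:ℝ) 1, x + s • (y - x) ∈ closedBall b M := by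
    intro s hs
    exact (convex_closedBall b M).add_smul_sub_mem hx hy hs
  have t1 := oneD_conv _ _ _ (ρ * ‖y - x‖ ^ 2) (line_d1 f hf x (y - x)) (line_d2 f hf x (y - x))
    (fun s hs => (hh _ (hin s hs) _).1)
  have := cvx_ineq t1 (x := 0) (y := 1) (by simp) (by simp) (a := 1 - s) (b := s)
    (by linarith) hs0 (by ring)
  simp at this
  nlinarith

lemma F3 (f : EuclideanSpace ℝ (Fin d) → ℝ) (hf : ContDiff ℝ 2 f) (hcv : ConvexOn ℝ Set.univ f) (b : EuclideanSpace ℝ (Fin d))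
    (ρ L η M lam : ℝ) (hρ : 0 < ρ) (hlam : 0 < lam) (hlM : lam < ρ * M) (hη : 0 ≤ η)
    (hg : ‖gradient f b‖ ≤ η)
    (hh : ∀ θ ∈ closedBall b M, ∀ v, ρ * ‖v‖ ^ 2 ≤ hessQ f θ v ∧ hessQ f θ v ≤ L * ‖v‖ ^ 2)
    (c : ℝ) (hc0 : η ≤ c * lam) (hc1 : c ≤ 1 / 2) (β θ : EuclideanSpace ℝ (Fin d)) :
    (c * lam - η) * ‖β - b‖ - c ^ 2 * lam ^ 2 / (2 * ρ) ≤ f θ + lam * ‖β - θ‖ - f b := by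
  have hR : lam / ρ < M := by rw [div_lt_iff₀ hρ]; linarith
  have hR0 : 0 < lam / ρ := by positivity
  have key : (c * lam - η) * ‖θ - b‖ - c ^ 2 * lam ^ 2 / (2 * ρ) ≤ f θ - f b := by
    by_cases hr : ‖θ - b‖ ≤ lam / ρ
    · have h1 := (F1 f hf b ρ L η M hg hh θ (by linarith)).1
      have h2 : 0 ≤ ρ / 2 * (‖θ - b‖ - c * lam / ρ) ^ 2 := by positivity
      have h3 : ρ / 2 * (‖θ - b‖ - c * lam / ρ) ^ 2 =
        ρ / 2 * ‖θ - b‖ ^ 2 - c * lam * ‖θ - b‖ + c ^ 2 * lam ^ 2 / (2 * ρ) := by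
        field_simp; ring
      linarith
    · push Not at hr
      set r := ‖θ - b‖ with hrd
      have hr0 : 0 < r := hR0.trans hr
      set s := lam / ρ / r with hs
      have hs0 : 0 < s := by positivity
      have hs1 : s < 1 := by rw [hs, div_lt_one hr0]; exact hr
      have hsr : s * r = lam / ρ := by rw [hs]; field_simp
      have hn : ‖(b + s • (θ - b)) - b‖ = lam / ρ := by
        rw [add_sub_cancel_left, norm_smul, Real.norm_eq_abs, abs_of_pos hs0, ← hrd, hsr]
      have h1 := (F1 f hf b ρ L η M hg hh (b + s • (θ - b)) (by rw [hn]; exact hR.le)).1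
      rw [hn] at h1
      have h2 := cvx_ineq hcv (x := b) (y := θ) (by simp) (by simp) (a := 1 - s) (b := s)
        (by linarith) hs0.le (by ring)
      have e1 : (1 - s) • b + s • θ = b + s • (θ - b) := by module
      rw [e1] at h2
      have h3 : ρ / 2 * (lam / ρ) ^ 2 = lam / 2 * (s * r) := by rw [hsr]; field_simp
      rw [h3, ← hsr] at h1
      have h4 : s * (r * (lam / 2 - η)) ≤ s * (f θ - f b) := by nlinarith
      have h5 := le_of_mul_le_mul_left h4 hs0
      have h6 : 0 ≤ c ^ 2 * lam ^ 2 / (2 * ρ) := by positivity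
      have h7 : (c * lam - η) * r ≤ r * (lam / 2 - η) := by nlinarith [mul_pos hlam hr0]
      linarith
  have htri : ‖β - b‖ ≤ ‖β - θ‖ + ‖θ - b‖ := norm_sub_le_norm_sub_add_norm_sub β θ b
  have h1 : (c * lam - η) * ‖β - b‖ ≤ (c * lam - η) * (‖β - θ‖ + ‖θ - b‖) :=
    mul_le_mul_of_nonneg_left htri (by linarith)
  have h2 : (c * lam - η) * ‖β - θ‖ ≤ lam * ‖β - θ‖ :=
    mul_le_mul_of_nonneg_right (by nlinarith) (norm_nonneg _)
  nlinarith

lemma F4 (f : EuclideanSpace ℝ (Fin d) → ℝ) (hf : ContDiff ℝ 2 f) (hcv : ConvexOn ℝ Set.univ f) (b : EuclideanSpace ℝ (Fin d))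
    (ρ L η M lam : ℝ) (hρ : 0 < ρ) (hρL : ρ ≤ L) (hlam : 0 < lam) (hlM : lam < ρ * M) (hη : 0 ≤ η)
    (hη1 : η ≤ lam / 18) (hg : ‖gradient f b‖ ≤ η)
    (hh : ∀ θ ∈ closedBall b M, ∀ v, ρ * ‖v‖ ^ 2 ≤ hessQ f θ v ∧ hessQ f θ v ≤ L * ‖v‖ ^ 2)
    (β θ : EuclideanSpace ℝ (Fin d)) (hβ : ‖β - b‖ ≤ 2 / 5 * lam / L) :
    f β + lam / 30 * ‖β - θ‖ ≤ f θ + lam * ‖β - θ‖ := by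
  have hL : 0 < L := by linarith
  by_cases hne : β = θ
  · subst hne; simp
  set q := ‖β - θ‖ with hq
  have hq0 : 0 < q := norm_pos_iff.2 (sub_ne_zero.2 hne)
  set r := 2 / 5 * lam / L with hr
  have hr0 : 0 < r := by positivity
  have hLr : L * r = 2 / 5 * lam := by rw [hr]; field_simp
  have hM : 0 < M := by
    by_contra h
    push Not at h
    nlinarith
  have hrM : 2 * r ≤ M := by
    have : L * (2 * r) ≤ L * M := by nlinarith
    exact le_of_mul_le_mul_left this hL
  set u := β + (r / q) • (β - θ) with hu
  have hub : ‖u - b‖ ≤ 2 * r := by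
    have : u - b = (β - b) + (r / q) • (β - θ) := by rw [hu]; abel
    rw [this]
    refine (norm_add_le _ _).trans ?_
    rw [norm_smul, Real.norm_eq_abs, abs_of_pos (by positivity), ← hq, div_mul_cancel₀ _ hq0.ne']
    linarith
  have h1 := (F1 f hf b ρ L η M hg hh u (by linarith)).2
  have h2 := (F1 f hf b ρ L η M hg hh β (by linarith)).1
  have h3 := cvx_ineq hcv (x := u) (y := θ) (by simp) (by simp) (a := q / (q + r)) (b := r / (q + r))
    (by positivity) (by positivity) (by field_simp)
  have e1 : (q / (q + r)) • u + (r / (q + r)) • θ = β := by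
    rw [hu, smul_add, smul_smul]
    have : q / (q + r) * (r / q) = r / (q + r) := by field_simp
    rw [this, smul_sub]
    have h : (q / (q + r)) • β + (r / (q + r)) • β = β := by
      rw [← add_smul]
      have : q / (q + r) + r / (q + r) = 1 := by field_simp
      rw [this, one_smul]
    rw [add_sub, sub_add_cancel, h]
  rw [e1] at h3
  have h4 : (q + r) * f β ≤ q * f u + r * f θ := by
    have := mul_le_mul_of_nonneg_left h3 (by positivity : 0 ≤ q + r)
    refine this.trans (le_of_eq ?_)
    field_simp
  have hu2 : ‖u - b‖ ^ 2 ≤ (2 * r) ^ 2 := by gcongr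
  have h5 : f u - f β ≤ 3 * η * r + 2 * L * r ^ 2 := by
    have a1 : η * ‖u - b‖ ≤ η * (2 * r) := mul_le_mul_of_nonneg_left hub hη
    have a2 : η * ‖β - b‖ ≤ η * r := mul_le_mul_of_nonneg_left hβ hη
    have a3 : L / 2 * ‖u - b‖ ^ 2 ≤ L / 2 * (2 * r) ^ 2 :=
      mul_le_mul_of_nonneg_left hu2 (by positivity)
    have a4 : 0 ≤ ρ / 2 * ‖β - b‖ ^ 2 := by positivity
    nlinarith
  have h6 : f u - f β ≤ r * (29 / 30 * lam) := by
    have : 2 * L * r ^ 2 = r * (4 / 5 * lam) := by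
      calc 2 * L * r ^ 2 = 2 * r * (L * r) := by ring
        _ = _ := by rw [hLr]; ring
    nlinarith
  have h7 : r * (f β) ≤ r * (f θ + q * (29 / 30 * lam)) := by
    have := mul_le_mul_of_nonneg_left h6 hq0.le
    nlinarith
  have := le_of_mul_le_mul_left h7 hr0
  linarith
end loc

set_option maxHeartbeats 1000000 in
lemma lemA (m K : ℕ) (hm : 1 ≤ m) (hK : 2 ≤ K) (S : Finset (Fin m)) (zhat : Fin m → Fin K)
    (t : Fin K → ℝ) (ht : ∀ k, 0 ≤ t k) (w : Fin m → ℝ) (α κ e : ℝ) (hα : 0 < α)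
    (hκ0 : 0 < κ) (hκ1 : κ ≤ 1) (he0 : 0 ≤ e) (he1 : e ≤ κ / (9 * K))
    (he2 : e ^ 2 ≤ α * κ ^ 2 / (81 * K ^ 2))
    (hw : ∀ j ∈ S, ∀ c, e ≤ c → c ≤ 1 / 2 → (c - e) * t (zhat j) - c ^ 2 / 2 ≤ w j)
    (hsum : ∑ j ∈ S, w j ≤ ∑ j ∈ Sᶜ, t (zhat j))
    (hB : ((Sᶜ : Finset (Fin m)).card : ℝ) ≤ α * κ * m / (6 * K ^ 2))
    (hcard : ∀ k : Fin K,
      α * m / K ≤ ((Finset.univ.filter fun j => zhat j = k).card : ℝ)) (k₀ : Fin K) :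
    t k₀ ≤ 2 / 5 * κ := by
  have hK' : (2:ℝ) ≤ K := by exact_mod_cast hK
  have hm' : (1:ℝ) ≤ m := by exact_mod_cast hm
  have hK0 : (0:ℝ) < K := by linarith
  have hm0 : (0:ℝ) < m := by linarith
  obtain ⟨a, ha⟩ : ∃ a, a = α * m / K := ⟨_, rfl⟩
  obtain ⟨p, hp⟩ : ∃ p, p = κ / K := ⟨_, rfl⟩
  have ha0 : 0 < a := by rw [ha]; positivity
  have hp0 : 0 < p := by rw [hp]; positivity
  have hp1 : p ≤ κ / 2 := by
    rw [hp]; gcongr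
  have he1' : e ≤ p / 9 := by
    refine he1.trans (le_of_eq ?_); rw [hp]; field_simp
  have he2' : m * e ^ 2 ≤ a * p * κ / 81 := by
    calc m * e ^ 2 ≤ m * (α * κ ^ 2 / (81 * K ^ 2)) := by gcongr
      _ = _ := by rw [ha, hp]; field_simp
  have hB' : ((Sᶜ : Finset (Fin m)).card : ℝ) ≤ p / 6 * a := by
    refine hB.trans (le_of_eq ?_); rw [hp, ha]; field_simp
  obtain ⟨n, hn⟩ : ∃ n : Fin K → ℝ, ∀ k, n k = ((S.filter fun j => zhat j = k).card : ℝ) :=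
    ⟨_, fun _ => rfl⟩
  obtain ⟨b, hb⟩ : ∃ n : Fin K → ℝ, ∀ k, n k = ((Sᶜ.filter fun j => zhat j = k).card : ℝ) :=
    ⟨_, fun _ => rfl⟩
  have hb0 : ∀ k, 0 ≤ b k := fun k => by rw [hb]; positivity
  have hsb : ∑ k, b k = ((Sᶜ : Finset (Fin m)).card : ℝ) := by
    rw [Finset.card_eq_sum_card_fiberwise (f := zhat) (t := Finset.univ) (fun _ _ => by simp)]
    push_cast
    exact Finset.sum_congr rfl fun k _ => hb k
  have hsn : ∑ k, n k ≤ m := by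
    have h1 : ∑ k, n k = (S.card : ℝ) := by
      rw [Finset.card_eq_sum_card_fiberwise (f := zhat) (t := Finset.univ) (fun _ _ => by simp)]
      push_cast
      exact Finset.sum_congr rfl fun k _ => hn k
    rw [h1]
    have := Finset.card_le_univ S
    simp only [Fintype.card_fin] at this
    exact_mod_cast this
  have hbB : ∀ k, b k ≤ p / 6 * a := fun k => by
    refine le_trans ?_ hB'
    rw [← hsb]
    exact Finset.single_le_sum (fun i _ => hb0 i) (Finset.mem_univ k)
  have hnb : ∀ k, a ≤ n k + b k := fun k => by
    rw [ha]
    refine (hcard k).trans (le_of_eq ?_)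
    rw [hn, hb, ← Nat.cast_add, ← Finset.card_union_of_disjoint, ← Finset.filter_union,
      Finset.union_compl]
    exact Finset.disjoint_filter_filter disjoint_compl_right
  have hna : ∀ k, 11 / 12 * a ≤ n k := fun k => by
    have h1 := hnb k
    have h2 := hbB k
    have h3 : p / 6 * a ≤ 1 / 12 * a := by
      apply mul_le_mul_of_nonneg_right _ ha0.le
      linarith
    linarith
  have hn0 : ∀ k, 0 < n k := fun k => by
    have := hna k
    linarith
  have hbn : ∀ k, b k ≤ 2 / 11 * p * n k := fun k => by
    have h1 := hbB k
    have h2 := mul_le_mul_of_nonneg_left (hna k) hp0.le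
    linarith
  have hQge : ∀ k, ∀ c, e ≤ c → c ≤ 1 / 2 →
      n k * ((c - e) * t k - c ^ 2 / 2) ≤ ∑ j ∈ S.filter (fun j => zhat j = k), w j := by
    intro k c h1 h2
    rw [hn, ← nsmul_eq_mul]
    apply Finset.card_nsmul_le_sum
    intro j hj
    rw [Finset.mem_filter] at hj
    have := hw j hj.1 c h1 h2
    rwa [hj.2] at this
  have hQsum : ∑ k, (∑ j ∈ S.filter (fun j => zhat j = k), w j - b k * t k) ≤ 0 := by
    rw [Finset.sum_sub_distrib, Finset.sum_fiberwise]
    have : ∑ k, b k * t k = ∑ j ∈ Sᶜ, t (zhat j) := by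
      rw [← Finset.sum_fiberwise (s := Sᶜ) (g := zhat)]
      refine Finset.sum_congr rfl fun k _ => ?_
      rw [hb, ← nsmul_eq_mul, ← Finset.sum_const]
      refine Finset.sum_congr rfl fun j hj => ?_
      rw [(Finset.mem_filter.1 hj).2]
    linarith
  have hQlow : ∀ k, 0 ≤ ∑ j ∈ S.filter (fun j => zhat j = k), w j - b k * t k
      + (n k * e ^ 2 + b k * (2 / 11 * p)) := by
    intro k
    have hr : b k / n k ≤ 2 / 11 * p := by
      rw [div_le_iff₀ (hn0 k)]; exact hbn k
    have hr0 : 0 ≤ b k / n k := div_nonneg (hb0 k) (hn0 k).le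
    have h1 := hQge k (e + b k / n k) (by linarith) (by linarith)
    obtain ⟨r, hrd⟩ : ∃ r, r = b k / n k := ⟨_, rfl⟩
    have hbr : b k = n k * r := by
      rw [hrd]; have := (hn0 k).ne'; field_simp
    rw [← hrd] at h1 hr hr0
    have h2 : n k * ((e + r) ^ 2 / 2) ≤ n k * e ^ 2 + n k * r ^ 2 := by
      have : 0 ≤ n k * (e - r) ^ 2 := mul_nonneg (hn0 k).le (sq_nonneg _)
      nlinarith
    have h3 : n k * r ^ 2 ≤ b k * (2 / 11 * p) := by
      rw [hbr, mul_assoc, pow_two]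
      exact mul_le_mul_of_nonneg_left (mul_le_mul_of_nonneg_left hr hr0) (hn0 k).le
    rw [hbr] at h3 ⊢
    nlinarith
  have hfin : ∑ j ∈ S.filter (fun j => zhat j = k₀), w j - b k₀ * t k₀
      ≤ m * e ^ 2 + p / 6 * a * (2 / 11 * p) := by
    have h1 := Finset.single_le_sum (fun k _ => hQlow k) (Finset.mem_univ k₀)
    rw [Finset.sum_add_distrib, Finset.sum_add_distrib, ← Finset.sum_mul, ← Finset.sum_mul,
      hsb] at h1
    have h2 : (∑ k, n k) * e ^ 2 ≤ m * e ^ 2 := mul_le_mul_of_nonneg_right hsn (sq_nonneg _)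
    have h3 : ((Sᶜ : Finset (Fin m)).card : ℝ) * (2 / 11 * p) ≤ p / 6 * a * (2 / 11 * p) :=
      mul_le_mul_of_nonneg_right hB' (by positivity)
    have h4 : 0 ≤ n k₀ * e ^ 2 := mul_nonneg (hn0 k₀).le (sq_nonneg _)
    have h5 : 0 ≤ b k₀ * (2 / 11 * p) := mul_nonneg (hb0 k₀) (by positivity)
    linarith
  by_contra hcon
  push Not at hcon
  have h1 := hQge k₀ (2 / 5 * κ) (by linarith) (by linarith)
  have h2 : b k₀ * t k₀ ≤ 2 / 11 * p * n k₀ * t k₀ := mul_le_mul_of_nonneg_right (hbn k₀) (ht k₀)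
  have h3 : 1 / 4 * κ * (2 / 5 * κ) ≤ (2 / 5 * κ - e - 2 / 11 * p) * t k₀ := by
    apply mul_le_mul _ hcon.le (by positivity) (by linarith)
    linarith
  have h4 : n k₀ * (κ ^ 2 / 50) ≤ m * e ^ 2 + p / 6 * a * (2 / 11 * p) := by
    have := mul_le_mul_of_nonneg_left h3 (hn0 k₀).le
    nlinarith
  have h5 : 11 / 12 * a * (κ ^ 2 / 50) ≤ n k₀ * (κ ^ 2 / 50) :=
    mul_le_mul_of_nonneg_right (hna k₀) (by positivity)
  have h6 : a * p * κ ≤ a * (κ / 2) * κ := by gcongr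
  have h7 : a * (p * p) ≤ a * (κ / 2 * (κ / 2)) := by gcongr
  have h8 : 0 < a * κ ^ 2 := by positivity
  linarith

set_option maxHeartbeats 4000000 in
/-- Robustness of clustered ARMUL with cardinality constraints: the labels of the good
tasks in `S` are recovered up to a permutation, and each estimated center is close to the
oracle minimizer pooled over its cluster intersected with `S`. -/
theorem stmt_14 (d m K : ℕ) (hd : 1 ≤ d) (hm : 1 ≤ m) (hK : 2 ≤ K)
    (α : ℝ) (hα0 : 0 < α) (hα1 : α ≤ 1)
    (f : Fin m → EuclideanSpace ℝ (Fin d) → ℝ)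
    (hconv : ∀ j, ConvexOn ℝ Set.univ (f j))
    (βs : Fin K → EuclideanSpace ℝ (Fin d)) (zs : Fin m → Fin K)
    (ρ L η M lam : ℝ) (hρ : 0 < ρ) (hρL : ρ ≤ L) (hη : 0 < η) (hM : 0 < M)
    (S : Finset (Fin m))
    (hSc : ((Sᶜ : Finset (Fin m)).card : ℝ) / m ≤ α * ρ / (6 * K ^ 2 * L))
    (hC2 : ∀ j ∈ S, ContDiff ℝ 2 (f j))
    (hgrad : ∀ j ∈ S, ‖gradient (f j) (βs (zs j))‖ ≤ η)
    (hhess : ∀ j ∈ S, ∀ θ ∈ closedBall (βs (zs j)) M, ∀ v,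
      ρ * ‖v‖ ^ 2 ≤ hessQ (f j) θ v ∧ hessQ (f j) θ v ≤ L * ‖v‖ ^ 2)
    (hbal : ∀ k : Fin K, α * m / K * (1 + ρ / (6 * L * K)) ≤
      ((Finset.univ.filter fun j => zs j = k).card : ℝ))
    (hlam1 : 9 * K * L * η / (Real.sqrt α * ρ) < lam)
    (hlam2 : lam < ρ * M)
    (hlam3 : ∀ k l : Fin K, k ≠ l → lam < ρ * (‖βs k - βs l‖ / 6))
    (θhat : Fin m → EuclideanSpace ℝ (Fin d)) (βhat : Fin K → EuclideanSpace ℝ (Fin d))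
    (zhat : Fin m → Fin K)
    (hcard : ∀ k : Fin K,
      α * m / K ≤ ((Finset.univ.filter fun j => zhat j = k).card : ℝ))
    (hmin : ∀ (θ : Fin m → EuclideanSpace ℝ (Fin d))
        (β : Fin K → EuclideanSpace ℝ (Fin d)) (z : Fin m → Fin K),
      (∀ k : Fin K, α * m / K ≤ ((Finset.univ.filter fun j => z j = k).card : ℝ)) →
      ∑ j, (f j (θhat j) + lam * ‖βhat (zhat j) - θhat j‖) ≤
      ∑ j, (f j (θ j) + lam * ‖β (z j) - θ j‖)) :
    ∃ τ : Equiv.Perm (Fin K),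
      (∀ j ∈ S, zhat j = τ (zs j) ∧ θhat j = βhat (zhat j)) ∧
      ∀ k : Fin K, ∀ βo : EuclideanSpace ℝ (Fin d),
        (∀ β, ∑ j ∈ (Finset.univ.filter fun j => zs j = k) ∩ S, f j βo ≤
              ∑ j ∈ (Finset.univ.filter fun j => zs j = k) ∩ S, f j β) →
        ‖βhat (τ k) - βo‖ ≤
          lam * ((Sᶜ : Finset (Fin m)).card : ℝ) /
            (ρ * (((Finset.univ.filter fun j => zs j = k) ∩ S).card : ℝ)) := by
  have hK' : (2:ℝ) ≤ K := by exact_mod_cast hK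
  have hm' : (1:ℝ) ≤ m := by exact_mod_cast hm
  have hK0 : (0:ℝ) < K := by linarith
  have hm0 : (0:ℝ) < m := by linarith
  have hL : 0 < L := by linarith
  have hsα : 0 < Real.sqrt α := Real.sqrt_pos.2 hα0
  have hsα1 : Real.sqrt α ≤ 1 := Real.sqrt_le_one.2 hα1
  have hlam : 0 < lam := lt_of_le_of_lt (by positivity) hlam1
  obtain ⟨κ, hκ⟩ : ∃ κ, κ = ρ / L := ⟨_, rfl⟩
  obtain ⟨e, he⟩ : ∃ e, e = η / lam := ⟨_, rfl⟩
  have hκ0 : 0 < κ := by rw [hκ]; positivity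
  have hκ1 : κ ≤ 1 := by rw [hκ, div_le_one hL]; exact hρL
  have he0 : 0 ≤ e := by rw [he]; positivity
  have hηe : η = e * lam := by rw [he]; field_simp
  have heA : e ≤ Real.sqrt α * κ / (9 * K) := by
    rw [div_lt_iff₀ (by positivity)] at hlam1
    rw [he, hκ, div_le_div_iff₀ hlam (by positivity)]
    have : η * (9 * K) * L ≤ (Real.sqrt α * (ρ / L) * lam) * L := by
      have : Real.sqrt α * (ρ / L) * lam * L = lam * (Real.sqrt α * ρ) := by field_simp
      rw [this]; linarith
    exact le_of_mul_le_mul_right this hL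
  have he1 : e ≤ κ / (9 * K) := by
    refine heA.trans ?_
    gcongr
    exact mul_le_of_le_one_left hκ0.le hsα1
  have he2 : e ^ 2 ≤ α * κ ^ 2 / (81 * K ^ 2) := by
    calc e ^ 2 ≤ (Real.sqrt α * κ / (9 * K)) ^ 2 := by gcongr
      _ = (Real.sqrt α) ^ 2 * κ ^ 2 / (81 * K ^ 2) := by rw [div_pow, mul_pow]; ring
      _ = _ := by rw [Real.sq_sqrt hα0.le]
  have he18 : e ≤ 1 / 18 := by
    refine he1.trans ?_
    rw [div_le_div_iff₀ (by positivity) (by norm_num)]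
    nlinarith
  have hη18 : η ≤ lam / 18 := by rw [hηe]; nlinarith
  have hB : ((Sᶜ : Finset (Fin m)).card : ℝ) ≤ α * κ * m / (6 * K ^ 2) := by
    rw [div_le_iff₀ hm0] at hSc
    refine hSc.trans (le_of_eq ?_)
    rw [hκ]; field_simp
  obtain ⟨A, hA⟩ : ∃ A : Fin K → Finset (Fin m),
      ∀ k, A k = (Finset.univ.filter fun j => zs j = k) ∩ S := ⟨_, fun _ => rfl⟩
  have hAmem : ∀ k j, j ∈ A k ↔ zs j = k ∧ j ∈ S := fun k j => by rw [hA]; simp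
  have hAcard : ∀ k, α * m / K ≤ ((A k).card : ℝ) := by
    intro k
    have h1 : (Finset.univ.filter fun j => zs j = k).card ≤ (A k).card + (Sᶜ).card := by
      rw [hA]
      refine le_trans (Finset.card_le_card ?_) (Finset.card_union_le _ _)
      intro j hj
      by_cases hjS : j ∈ S
      · simp only [Finset.mem_union, Finset.mem_inter]; exact Or.inl ⟨hj, hjS⟩
      · simp [hjS]
    have h2 : ((Finset.univ.filter fun j => zs j = k).card : ℝ) ≤ (A k).card + (Sᶜ).card := by
      exact_mod_cast h1
    have h3 := hbal k
    have h4 : α * m / K * (1 + ρ / (6 * L * K)) = α * m / K + α * κ * m / (6 * K ^ 2) := by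
      rw [hκ]; field_simp
    linarith
  have feas : ∀ (π : Equiv.Perm (Fin K)) (z : Fin m → Fin K), (∀ j ∈ S, z j = π (zs j)) →
      ∀ k : Fin K, α * m / K ≤ ((Finset.univ.filter fun j => z j = k).card : ℝ) := by
    intro π z hz k
    refine (hAcard (π.symm k)).trans ?_
    have : A (π.symm k) ⊆ Finset.univ.filter fun j => z j = k := by
      intro j hj
      rw [hAmem] at hj
      simp [hz j hj.2, hj.1]
    exact_mod_cast Finset.card_le_card this
  haveI : Nonempty (Fin K) := ⟨⟨0, by omega⟩⟩
  have hσ : ∀ k', ∃ k, ∀ l, ‖βhat k' - βs k‖ ≤ ‖βhat k' - βs l‖ := fun k' =>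
    Finite.exists_min (fun l => ‖βhat k' - βs l‖)
  choose σ hσ using hσ
  obtain ⟨w, hwd⟩ : ∃ w : Fin m → ℝ, ∀ j, w j = ρ / lam ^ 2 *
    (f j (θhat j) + lam * ‖βhat (zhat j) - θhat j‖ - f j (βs (zs j))) := ⟨_, fun _ => rfl⟩
  obtain ⟨t, htd⟩ : ∃ t : Fin K → ℝ, ∀ k, t k = ρ / lam * ‖βhat k - βs (σ k)‖ :=
    ⟨_, fun _ => rfl⟩
  have ht0 : ∀ k, 0 ≤ t k := fun k => by rw [htd]; positivity
  have hw : ∀ j ∈ S, ∀ c, e ≤ c → c ≤ 1 / 2 →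
      (c - e) * (ρ / lam * ‖βhat (zhat j) - βs (zs j)‖) - c ^ 2 / 2 ≤ w j := by
    intro j hj c h1 h2
    have h3 := F3 (f j) (hC2 j hj) (hconv j) (βs (zs j)) ρ L η M lam hρ hlam hlam2 hη.le
      (hgrad j hj) (hhess j hj) c (by rw [hηe]; exact mul_le_mul_of_nonneg_right h1 hlam.le) h2
      (βhat (zhat j)) (θhat j)
    rw [hwd]
    have h4 := mul_le_mul_of_nonneg_left h3 (by positivity : 0 ≤ ρ / lam ^ 2)
    refine le_trans (le_of_eq ?_) h4
    rw [hηe]; field_simp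
  have hsum : ∑ j ∈ S, w j ≤ ∑ j ∈ Sᶜ, t (zhat j) := by
    have h := hmin (fun j => if j ∈ S then βs (zs j) else θhat j) βs
      (fun j => if j ∈ S then zs j else σ (zhat j))
      (feas (Equiv.refl _) _ (fun j hj => by simp [hj]))
    rw [← Finset.sum_add_sum_compl S, ← Finset.sum_add_sum_compl S (fun j => f j _ + _)] at h
    have h1 : ∑ j ∈ S, (f j (if j ∈ S then βs (zs j) else θhat j) +
        lam * ‖βs (if j ∈ S then zs j else σ (zhat j)) - (if j ∈ S then βs (zs j) else θhat j)‖)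
        = ∑ j ∈ S, f j (βs (zs j)) :=
      Finset.sum_congr rfl fun j hj => by simp [hj]
    have h2 : ∑ j ∈ Sᶜ, (f j (if j ∈ S then βs (zs j) else θhat j) +
        lam * ‖βs (if j ∈ S then zs j else σ (zhat j)) - (if j ∈ S then βs (zs j) else θhat j)‖)
        ≤ ∑ j ∈ Sᶜ, ((f j (θhat j) + lam * ‖βhat (zhat j) - θhat j‖) +
          lam ^ 2 / ρ * t (zhat j)) := by
      refine Finset.sum_le_sum fun j hj => ?_
      rw [Finset.mem_compl] at hj
      simp only [hj, if_false]
      have h3 : lam ^ 2 / ρ * t (zhat j) = lam * ‖βhat (zhat j) - βs (σ (zhat j))‖ := by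
        rw [htd]; field_simp
      rw [h3]
      have h4 : ‖βs (σ (zhat j)) - θhat j‖ ≤
          ‖βs (σ (zhat j)) - βhat (zhat j)‖ + ‖βhat (zhat j) - θhat j‖ :=
        norm_sub_le_norm_sub_add_norm_sub _ _ _
      rw [norm_sub_rev (βs (σ (zhat j))) (βhat (zhat j))] at h4
      have := mul_le_mul_of_nonneg_left h4 hlam.le
      linarith
    have h2' : ∑ j ∈ Sᶜ, ((f j (θhat j) + lam * ‖βhat (zhat j) - θhat j‖) +
          lam ^ 2 / ρ * t (zhat j)) =
        ∑ j ∈ Sᶜ, (f j (θhat j) + lam * ‖βhat (zhat j) - θhat j‖) +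
          lam ^ 2 / ρ * ∑ j ∈ Sᶜ, t (zhat j) := by
      rw [Finset.mul_sum, ← Finset.sum_add_distrib]
    rw [h2'] at h2
    have h5 : ∑ j ∈ S, w j = ρ / lam ^ 2 * (∑ j ∈ S, (f j (θhat j) +
        lam * ‖βhat (zhat j) - θhat j‖) - ∑ j ∈ S, f j (βs (zs j))) := by
      rw [← Finset.sum_sub_distrib, Finset.mul_sum]
      exact Finset.sum_congr rfl fun j _ => hwd j
    rw [h5]
    have h6 : ∑ j ∈ S, (f j (θhat j) + lam * ‖βhat (zhat j) - θhat j‖) -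
        ∑ j ∈ S, f j (βs (zs j)) ≤ lam ^ 2 / ρ * ∑ j ∈ Sᶜ, t (zhat j) := by linarith
    refine (mul_le_mul_of_nonneg_left h6 (by positivity : 0 ≤ ρ / lam ^ 2)).trans (le_of_eq ?_)
    field_simp
  have htb : ∀ k, t k ≤ 2 / 5 * κ := by
    refine lemA m K hm hK S zhat t ht0 w α κ e hα0 hκ0 hκ1 he0 he1 he2 ?_ hsum hB hcard
    intro j hj c h1 h2
    refine le_trans ?_ (hw j hj c h1 h2)
    have h3 := mul_le_mul_of_nonneg_left (hσ (zhat j) (zs j)) (by positivity : 0 ≤ ρ / lam)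
    rw [← htd] at h3
    have := mul_le_mul_of_nonneg_left h3 (sub_nonneg.2 h1)
    linarith
  have hnb : ∀ k, ‖βhat k - βs (σ k)‖ ≤ 2 / 5 * lam / L := by
    intro k
    have h1 := htb k
    rw [htd, hκ] at h1
    have h2 := mul_le_mul_of_nonneg_left h1 (by positivity : 0 ≤ lam / ρ)
    refine le_trans (le_of_eq ?_) (h2.trans (le_of_eq ?_))
    · field_simp
    · field_simp
  -- points assigned to the wrong centre pay a lot
  have hfar : ∀ j ∈ S, σ (zhat j) ≠ zs j → 2 ≤ w j := by
    intro j hj hne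
    have h1 := hw j hj (1 / 2) (by linarith) le_rfl
    have h2 := hlam3 _ _ hne
    have h3 : ‖βs (σ (zhat j)) - βs (zs j)‖ ≤
        ‖βs (σ (zhat j)) - βhat (zhat j)‖ + ‖βhat (zhat j) - βs (zs j)‖ :=
      norm_sub_le_norm_sub_add_norm_sub _ _ _
    rw [norm_sub_rev (βs (σ (zhat j))) (βhat (zhat j))] at h3
    have h4 := htb (zhat j)
    rw [htd] at h4
    have h5 : 6 ≤ ρ / lam * ‖βs (σ (zhat j)) - βs (zs j)‖ := by
      rw [div_mul_eq_mul_div, le_div_iff₀ hlam]; linarith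
    have h6 := mul_le_mul_of_nonneg_left h3 (by positivity : 0 ≤ ρ / lam)
    have h7 : 28 / 5 ≤ ρ / lam * ‖βhat (zhat j) - βs (zs j)‖ := by
      rw [mul_add] at h6
      linarith
    nlinarith
  have hwlow : ∀ j ∈ S, -(e ^ 2 / 2) ≤ w j := by
    intro j hj
    have := hw j hj e le_rfl (by linarith)
    linarith
  have hsurj : Function.Surjective σ := by
    intro k
    by_contra hcon
    push Not at hcon
    have h1 : ∑ j ∈ Sᶜ, t (zhat j) ≤ ((Sᶜ : Finset (Fin m)).card : ℝ) * (2 / 5 * κ) := by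
      rw [← nsmul_eq_mul]
      exact Finset.sum_le_card_nsmul _ _ _ fun j _ => htb _
    have hsub : A k ⊆ S := fun j hj => ((hAmem k j).1 hj).2
    have h2 : ((A k).card : ℝ) * 2 ≤ ∑ j ∈ A k, (w j + e ^ 2 / 2) := by
      rw [← nsmul_eq_mul]
      refine Finset.card_nsmul_le_sum _ _ _ fun j hj => ?_
      have h3 := (hAmem k j).1 hj
      have := hfar j h3.2 (by rw [h3.1]; exact hcon _)
      have := sq_nonneg e
      linarith
    have h3 : ∑ j ∈ A k, (w j + e ^ 2 / 2) ≤ ∑ j ∈ S, (w j + e ^ 2 / 2) :=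
      Finset.sum_le_sum_of_subset_of_nonneg hsub fun j hj _ => by
        have := hwlow j hj
        linarith
    rw [Finset.sum_add_distrib (s := S), Finset.sum_const, nsmul_eq_mul] at h3
    have h4 : (S.card : ℝ) ≤ m := by
      have := Finset.card_le_univ S
      simp only [Fintype.card_fin] at this
      exact_mod_cast this
    have h5 : (S.card : ℝ) * (e ^ 2 / 2) ≤ m * (e ^ 2 / 2) :=
      mul_le_mul_of_nonneg_right h4 (by positivity)
    have h6 := hAcard k
    obtain ⟨a, ha⟩ : ∃ a, a = α * m / K := ⟨_, rfl⟩
    have ha0 : 0 < a := by rw [ha]; positivity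
    rw [← ha] at h6
    have h7 : α * κ * m / (6 * K ^ 2) ≤ a := by
      rw [ha, div_le_div_iff₀ (by positivity) hK0]
      have : κ * K ≤ 6 * K ^ 2 := by nlinarith
      have := mul_le_mul_of_nonneg_left this (by positivity : 0 ≤ α * m)
      linarith
    have h8 : m * e ^ 2 ≤ a := by
      calc m * e ^ 2 ≤ m * (α * κ ^ 2 / (81 * K ^ 2)) := by gcongr
        _ ≤ a := by
          rw [ha, ← mul_div_assoc, div_le_div_iff₀ (by positivity) hK0]
          have hκ2 : κ ^ 2 ≤ 1 := by nlinarith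
          have hκ3 : κ ^ 2 * K ≤ 1 * K := mul_le_mul_of_nonneg_right hκ2 hK0.le
          have : κ ^ 2 * K ≤ 81 * K ^ 2 := by nlinarith
          have := mul_le_mul_of_nonneg_left this (by positivity : 0 ≤ α * m)
          linarith
    have h9 : ((Sᶜ : Finset (Fin m)).card : ℝ) * (2 / 5 * κ) ≤ a * (2 / 5) := by
      apply mul_le_mul (hB.trans h7) (by linarith) (by positivity) ha0.le
    linarith
  have hbij : Function.Bijective σ := Finite.injective_iff_bijective.1
    (Finite.injective_iff_surjective.2 hsurj)
  obtain ⟨τ, hτ⟩ : ∃ τ : Equiv.Perm (Fin K), ∀ k k', σ k' = k ↔ k' = τ k := by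
    refine ⟨(Equiv.ofBijective σ hbij).symm, fun k k' => ?_⟩
    rw [Equiv.eq_symm_apply]; rfl
  have hστ : ∀ k, σ (τ k) = k := fun k => (hτ k (τ k)).2 rfl
  have hnear : ∀ k, ‖βhat (τ k) - βs k‖ ≤ 2 / 5 * lam / L := fun k => by
    have := hnb (τ k)
    rwa [hστ] at this
  have hMr : 2 / 5 * lam / L ≤ M := by
    rw [div_le_iff₀ hL]
    have := mul_le_mul_of_nonneg_right hρL hM.le
    linarith
  have hterm : ∀ j ∈ S, f j (βhat (τ (zs j))) ≤
      f j (θhat j) + lam * ‖βhat (zhat j) - θhat j‖ ∧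
      (¬ (zhat j = τ (zs j) ∧ θhat j = βhat (zhat j)) → f j (βhat (τ (zs j))) <
      f j (θhat j) + lam * ‖βhat (zhat j) - θhat j‖) := by
    intro j hj
    by_cases hz : zhat j = τ (zs j)
    · have h1 := F4 (f j) (hC2 j hj) (hconv j) (βs (zs j)) ρ L η M lam hρ hρL hlam hlam2 hη.le hη18
        (hgrad j hj) (hhess j hj) (βhat (zhat j)) (θhat j) (by rw [hz]; exact hnear _)
      rw [← hz]
      constructor
      · have : 0 ≤ lam / 30 * ‖βhat (zhat j) - θhat j‖ := by positivity
        linarith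
      · intro hne
        have h2 : 0 < ‖βhat (zhat j) - θhat j‖ := by
          rw [norm_pos_iff, sub_ne_zero]
          intro h
          exact hne ⟨rfl, h.symm⟩
        have : 0 < lam / 30 * ‖βhat (zhat j) - θhat j‖ := by positivity
        linarith
    · have h1 := hfar j hj (fun h => hz ((hτ _ _).1 h))
      rw [hwd] at h1
      have h2 := (F1 (f j) (hC2 j hj) (βs (zs j)) ρ L η M (hgrad j hj) (hhess j hj)
        (βhat (τ (zs j))) ((hnear _).trans hMr)).2
      have h3 := hnear (zs j)
      set D := ‖βhat (τ (zs j)) - βs (zs j)‖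
      have hD : 0 ≤ D := norm_nonneg _
      have h4 : L * D ≤ 2 / 5 * lam := by
        rw [le_div_iff₀ hL] at h3; linarith
      have h4' : ρ * D ≤ lam := by
        have := mul_le_mul_of_nonneg_right hρL hD
        linarith
      have h5 : ρ / lam ^ 2 * (f j (βhat (τ (zs j))) - f j (βs (zs j))) < 2 := by
        have h6 : ρ * (f j (βhat (τ (zs j))) - f j (βs (zs j))) < 2 * lam ^ 2 := by
          have a1 : ρ * (η * D) ≤ lam / 18 * lam := by
            calc ρ * (η * D) = η * (ρ * D) := by ring
              _ ≤ lam / 18 * lam := mul_le_mul hη18 h4' (by positivity) (by positivity)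
          have a2 : ρ * (L / 2 * D ^ 2) ≤ 1 / 2 * (lam * (2 / 5 * lam)) := by
            calc ρ * (L / 2 * D ^ 2) = 1 / 2 * ((ρ * D) * (L * D)) := by ring
              _ ≤ 1 / 2 * (lam * (2 / 5 * lam)) := by
                have := mul_le_mul h4' h4 (by positivity) (by positivity)
                linarith
          have a3 := mul_le_mul_of_nonneg_left h2 hρ.le
          have a4 : 0 < lam ^ 2 := by positivity
          nlinarith
        rw [div_mul_eq_mul_div, div_lt_iff₀ (by positivity)]
        exact h6
      have h7 := lt_of_mul_lt_mul_left (h5.trans_le h1) (by positivity : 0 ≤ ρ / lam ^ 2)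
      have h8 : f j (βhat (τ (zs j))) < f j (θhat j) + lam * ‖βhat (zhat j) - θhat j‖ := by
        linarith
      exact ⟨h8.le, fun _ => h8⟩
  have hrec : ∀ j ∈ S, zhat j = τ (zs j) ∧ θhat j = βhat (zhat j) := by
    by_contra hcon
    push Not at hcon
    obtain ⟨j₀, hj₀, hne⟩ := hcon
    have hlt := Finset.sum_lt_sum (fun j hj => (hterm j hj).1)
      ⟨j₀, hj₀, (hterm j₀ hj₀).2 (fun h => hne h.1 h.2)⟩
    have h := hmin (fun j => if j ∈ S then βhat (τ (zs j)) else θhat j) βhat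
      (fun j => if j ∈ S then τ (zs j) else zhat j)
      (feas τ _ (fun j hj => by simp [hj]))
    rw [← Finset.sum_add_sum_compl S, ← Finset.sum_add_sum_compl S (fun j => f j _ + _)] at h
    have h1 : ∑ j ∈ S, (f j (if j ∈ S then βhat (τ (zs j)) else θhat j) +
        lam * ‖βhat (if j ∈ S then τ (zs j) else zhat j) -
          (if j ∈ S then βhat (τ (zs j)) else θhat j)‖)
        = ∑ j ∈ S, f j (βhat (τ (zs j))) :=
      Finset.sum_congr rfl fun j hj => by simp [hj]
    have h2 : ∑ j ∈ Sᶜ, (f j (if j ∈ S then βhat (τ (zs j)) else θhat j) +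
        lam * ‖βhat (if j ∈ S then τ (zs j) else zhat j) -
          (if j ∈ S then βhat (τ (zs j)) else θhat j)‖)
        = ∑ j ∈ Sᶜ, (f j (θhat j) + lam * ‖βhat (zhat j) - θhat j‖) :=
      Finset.sum_congr rfl fun j hj => by simp only [Finset.mem_compl.1 hj, if_false]
    linarith
  refine ⟨τ, hrec, ?_⟩
  intro k βo hβo
  rw [← hA] at hβo ⊢
  obtain ⟨B, hBd⟩ : ∃ B : ℝ, B = ((Sᶜ : Finset (Fin m)).card : ℝ) := ⟨_, rfl⟩
  obtain ⟨n, hnd⟩ : ∃ n : ℝ, n = ((A k).card : ℝ) := ⟨_, rfl⟩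
  have hn0 : 0 < n := by
    rw [hnd]
    exact lt_of_lt_of_le (by positivity) (hAcard k)
  have hB0 : 0 ≤ B := by rw [hBd]; exact Nat.cast_nonneg _
  rw [← hBd, ← hnd]
  -- near-optimality of the estimated centre for the pooled loss
  have hF : ∀ x, ∑ j ∈ A k, f j (βhat (τ k)) ≤
      ∑ j ∈ A k, f j x + lam * B * ‖x - βhat (τ k)‖ := by
    intro x
    have h := hmin (fun j => if j ∈ A k then x else θhat j) (Function.update βhat (τ k) x) zhat
      hcard
    have h1 : ∀ j ∈ Finset.univ, f j (if j ∈ A k then x else θhat j) +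
        lam * ‖Function.update βhat (τ k) x (zhat j) - (if j ∈ A k then x else θhat j)‖ ≤
        (f j (θhat j) + lam * ‖βhat (zhat j) - θhat j‖) +
        ((if j ∈ A k then (f j x - f j (βhat (τ k))) else 0) +
        (if j ∈ Sᶜ then lam * ‖x - βhat (τ k)‖ else 0)) := by
      intro j _
      by_cases hjA : j ∈ A k
      · have h2 := (hAmem k j).1 hjA
        have h3 := hrec j h2.2
        rw [h2.1] at h3
        simp [hjA, h2.2, h3.1, h3.2]
      · by_cases hjS : j ∈ S
        · have h3 := hrec j hjS
          have h4 : zhat j ≠ τ k := by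
            rw [h3.1]
            intro h
            exact hjA ((hAmem k j).2 ⟨τ.injective h, hjS⟩)
          simp [hjA, hjS, Function.update_of_ne h4]
        · simp only [hjA, if_false, Finset.mem_compl, hjS, not_false_eq_true, if_true]
          by_cases h4 : zhat j = τ k
          · rw [h4, Function.update_self]
            have h5 : ‖x - θhat j‖ ≤ ‖x - βhat (τ k)‖ + ‖βhat (τ k) - θhat j‖ :=
              norm_sub_le_norm_sub_add_norm_sub _ _ _
            have := mul_le_mul_of_nonneg_left h5 hlam.le
            linarith
          · rw [Function.update_of_ne h4]
            have : 0 ≤ lam * ‖x - βhat (τ k)‖ := by positivity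
            linarith
    have h2 := h.trans (Finset.sum_le_sum h1)
    have h3 : ∑ j, ((f j (θhat j) + lam * ‖βhat (zhat j) - θhat j‖) +
        ((if j ∈ A k then (f j x - f j (βhat (τ k))) else 0) +
        (if j ∈ Sᶜ then lam * ‖x - βhat (τ k)‖ else 0))) =
        ∑ j, (f j (θhat j) + lam * ‖βhat (zhat j) - θhat j‖) +
        (∑ j, (if j ∈ A k then (f j x - f j (βhat (τ k))) else 0) +
        ∑ j, (if j ∈ Sᶜ then lam * ‖x - βhat (τ k)‖ else 0)) := by
      rw [← Finset.sum_add_distrib, ← Finset.sum_add_distrib]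
    rw [h3, Finset.sum_ite_mem, Finset.sum_ite_mem,
      Finset.univ_inter, Finset.univ_inter, Finset.sum_sub_distrib, Finset.sum_const,
      nsmul_eq_mul, ← hBd] at h2
    linarith
  have hin1 : βhat (τ k) ∈ closedBall (βs k) M := by
    rw [mem_closedBall, dist_eq_norm]
    exact (hnear k).trans hMr
  have hin2 : βo ∈ closedBall (βs k) M := by
    rw [mem_closedBall, dist_eq_norm]
    have hne : (A k).Nonempty := by
      rw [← Finset.card_pos]
      rw [hnd] at hn0
      exact_mod_cast hn0
    obtain ⟨j, hj, hle⟩ := Finset.exists_le_of_sum_le hne (hβo (βs k))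
    have h2 := (hAmem k j).1 hj
    have h3 := F3 (f j) (hC2 j h2.2) (hconv j) (βs (zs j)) ρ L η M lam hρ hlam hlam2 hη.le
      (hgrad j h2.2) (hhess j h2.2) (1 / 2) (by linarith) le_rfl βo βo
    rw [h2.1, sub_self, norm_zero] at h3
    have h4 : (1 / 2 * lam - η) * ‖βo - βs k‖ ≤ (1 / 2) ^ 2 * lam ^ 2 / (2 * ρ) := by linarith
    have h5 : 1 / 4 * lam * ‖βo - βs k‖ ≤ (1 / 2 * lam - η) * ‖βo - βs k‖ :=
      mul_le_mul_of_nonneg_right (by linarith) (norm_nonneg _)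
    have h6 : (1 / 2) ^ 2 * lam ^ 2 / (2 * ρ) ≤ 1 / 4 * lam * M := by
      rw [div_le_iff₀ (by positivity)]
      have := mul_le_mul_of_nonneg_left hlam2.le hlam.le
      nlinarith [mul_pos hlam hlam]
    exact le_of_mul_le_mul_left (h5.trans (h4.trans h6)) (by positivity)
  obtain ⟨W, hW⟩ : ∃ W, W = ‖βo - βhat (τ k)‖ := ⟨_, rfl⟩
  have hW0 : 0 ≤ W := by rw [hW]; positivity
  have hSC : ∀ s : ℝ, 0 ≤ s → s ≤ 1 →
      ∑ j ∈ A k, f j (βhat (τ k) + s • (βo - βhat (τ k))) ≤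
      (1 - s) * ∑ j ∈ A k, f j (βhat (τ k)) + s * ∑ j ∈ A k, f j βo
        - n * (ρ / 2 * (s * (1 - s)) * W ^ 2) := by
    intro s hs0 hs1
    rw [hnd, ← nsmul_eq_mul, ← Finset.sum_const, Finset.mul_sum, Finset.mul_sum,
      ← Finset.sum_add_distrib, ← Finset.sum_sub_distrib, hW]
    refine Finset.sum_le_sum fun j hj => ?_
    have h2 := (hAmem k j).1 hj
    have h3 := hhess j h2.2
    rw [h2.1] at h3
    exact F2 (f j) (hC2 j h2.2) (βs k) ρ L M h3 _ _ hin1 hin2 s hs0 hs1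
  have hkey : ∀ s : ℝ, 0 < s → s < 1 → (1 - s) * (n * ρ * W ^ 2) ≤ lam * B * W := by
    intro s hs0 hs1
    have h1 := hSC s hs0.le hs1.le
    have h2 := hSC (1 - s) (by linarith) (by linarith)
    have h3 := hF (βhat (τ k) + s • (βo - βhat (τ k)))
    rw [add_sub_cancel_left, norm_smul, Real.norm_eq_abs, abs_of_pos hs0, ← hW] at h3
    have h4 := hβo (βhat (τ k) + (1 - s) • (βo - βhat (τ k)))
    have h5 : s * ((1 - s) * (n * ρ * W ^ 2)) ≤ s * (lam * B * W) := by
      nlinarith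
    exact le_of_mul_le_mul_left h5 hs0
  have hfinal : n * ρ * W ^ 2 ≤ lam * B * W := by
    by_contra hcon
    push Not at hcon
    have hY : 0 ≤ lam * B * W := by positivity
    set X := n * ρ * W ^ 2
    set Y := lam * B * W
    have hX : 0 < X := lt_of_le_of_lt hY hcon
    have h1 := hkey ((X - Y) / (2 * X)) (div_pos (by linarith) (by linarith))
      (by rw [div_lt_one (by linarith)]; linarith)
    have h2 : (1 - (X - Y) / (2 * X)) * X = (X + Y) / 2 := by field_simp; ring
    linarith
  rw [norm_sub_rev, ← hW, le_div_iff₀ (by positivity)]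
  rcases hW0.eq_or_lt with h | h
  · rw [← h, zero_mul]; positivity
  · have : W * (W * (ρ * n)) ≤ W * (lam * B) := by linarith
    exact le_of_mul_le_mul_left this h
end

section
/- Let f : ℝ^d → ℝ be convex and twice continuously differentiable with a global minimizer x₀, and suppose there exist ρ > 0 and r > 0 such that ∇²f(x) ⪰ ρ·I for all x ∈ B(x₀, r). Then ‖∇f(x)‖₂ ≥ ρ·min{ ‖x − x₀‖₂, r } for every x ∈ ℝ^d. Moreover, if g : ℝ^d → ℝ is convex and λ-Lipschitz (with respect to the Euclidean norm) for some λ < ρr, then f + g has a unique global minimizer and it belongs to B(x₀, λ/ρ). -/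
open Metric

section helpers

variable {d : ℕ} {f : EuclideanSpace ℝ (Fin d) → ℝ}

lemma aux_line_s17 (a v : EuclideanSpace ℝ (Fin d)) (t : ℝ) :
    HasDerivAt (fun s : ℝ => a + s • v) v t := by
  simpa using ((hasDerivAt_id t).smul_const v).const_add a

lemma aux_d1 (hC2 : ContDiff ℝ 2 f) (a v : EuclideanSpace ℝ (Fin d)) (t : ℝ) :
    HasDerivAt (fun s : ℝ => f (a + s • v)) (fderiv ℝ f (a + t • v) v) t := by
  have h := (hC2.differentiable (by norm_num) (a + t • v)).hasFDerivAt
  exact h.comp_hasDerivAt t (aux_line_s17 a v t)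

lemma aux_d2 (hC2 : ContDiff ℝ 2 f) (a v : EuclideanSpace ℝ (Fin d)) (t : ℝ) :
    HasDerivAt (fun s : ℝ => fderiv ℝ f (a + s • v) v) (hessQ f (a + t • v) v) t := by
  have h1 : ContDiff ℝ 1 (fderiv ℝ f) := hC2.fderiv_right (by norm_num)
  have h := (h1.differentiable (by norm_num) (a + t • v)).hasFDerivAt
  have h2 := h.comp_hasDerivAt t (aux_line_s17 a v t)
  have h3 := h2.clm_apply (hasDerivAt_const t v)
  simpa [hessQ, iteratedFDeriv_two_apply] using h3

lemma aux_conv (hconv : ConvexOn ℝ Set.univ f) (a v : EuclideanSpace ℝ (Fin d)) :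
    ConvexOn ℝ Set.univ (fun s : ℝ => f (a + s • v)) := by
  refine ⟨convex_univ, fun x _ y _ p q hp hq hpq => ?_⟩
  have h := hconv.2 (Set.mem_univ (a + x • v)) (Set.mem_univ (a + y • v)) hp hq hpq
  have e : a + (p • x + q • y) • v = p • (a + x • v) + q • (a + y • v) := by
    have : a = (p + q) • a := by rw [hpq, one_smul]
    conv_lhs => rw [this]
    simp only [smul_eq_mul]
    module
  simp only [e]
  exact h

lemma aux_mono_s17 (hconv : ConvexOn ℝ Set.univ f) (hC2 : ContDiff ℝ 2 f)
    (a v : EuclideanSpace ℝ (Fin d)) {s t : ℝ} (hst : s ≤ t) :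
    fderiv ℝ f (a + s • v) v ≤ fderiv ℝ f (a + t • v) v := by
  have h := (aux_conv hconv a v).monotoneOn_deriv
    (fun x _ => (aux_d1 hC2 a v x).differentiableAt)
  have := h (Set.mem_univ s) (Set.mem_univ t) hst
  rwa [(aux_d1 hC2 a v s).deriv, (aux_d1 hC2 a v t).deriv] at this

lemma aux_key (hconv : ConvexOn ℝ Set.univ f) (hC2 : ContDiff ℝ 2 f)
    (x₀ : EuclideanSpace ℝ (Fin d)) (hmin : ∀ y, f x₀ ≤ f y)
    (ρ r : ℝ) (hr : 0 < r)
    (hhess : ∀ x ∈ closedBall x₀ r, ∀ v, ρ * ‖v‖ ^ 2 ≤ hessQ f x v)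
    (v : EuclideanSpace ℝ (Fin d)) (hv : v ≠ 0) :
    ρ * min ‖v‖ r * ‖v‖ ≤ fderiv ℝ f (x₀ + (1 : ℝ) • v) v := by
  have hv' : 0 < ‖v‖ := norm_pos_iff.mpr hv
  set t := min ‖v‖ r / ‖v‖ with ht
  have ht0 : 0 ≤ t := by positivity
  have ht1 : t ≤ 1 := by
    rw [ht, div_le_one hv']; exact min_le_left _ _
  have htv : t * ‖v‖ = min ‖v‖ r := by rw [ht]; field_simp
  have h0 : fderiv ℝ f (x₀ + (0 : ℝ) • v) v = 0 := by
    have : IsLocalMin f x₀ := Filter.Eventually.of_forall hmin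
    simp [this.fderiv_eq_zero]
  have hm := Convex.mul_sub_le_image_sub_of_le_deriv (convex_Icc (0 : ℝ) t)
    (f := fun s : ℝ => fderiv ℝ f (x₀ + s • v) v)
    (fun s _ => (aux_d2 hC2 x₀ v s).continuousAt.continuousWithinAt)
    (fun s _ => (aux_d2 hC2 x₀ v s).differentiableAt.differentiableWithinAt)
    (C := ρ * ‖v‖ ^ 2)
    (fun s hs => by
      rw [(aux_d2 hC2 x₀ v s).deriv]
      rw [interior_Icc] at hs
      apply hhess
      rw [mem_closedBall, dist_eq_norm, add_sub_cancel_left, norm_smul, Real.norm_of_nonneg hs.1.le]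
      calc s * ‖v‖ ≤ t * ‖v‖ := by gcongr; exact hs.2.le
        _ ≤ r := by rw [htv]; exact min_le_right _ _)
    0 ⟨le_rfl, ht0⟩ t ⟨ht0, le_rfl⟩ ht0
  simp only [h0, sub_zero] at hm
  have := aux_mono_s17 hconv hC2 x₀ v ht1
  calc ρ * min ‖v‖ r * ‖v‖ = ρ * ‖v‖ ^ 2 * t := by rw [← htv]; ring
    _ ≤ _ := hm.trans this

lemma aux_loc (hconv : ConvexOn ℝ Set.univ f) (hC2 : ContDiff ℝ 2 f)
    (x₀ : EuclideanSpace ℝ (Fin d)) (hmin : ∀ y, f x₀ ≤ f y)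
    (ρ r : ℝ) (hρ : 0 < ρ) (hr : 0 < r)
    (hhess : ∀ x ∈ closedBall x₀ r, ∀ v, ρ * ‖v‖ ^ 2 ≤ hessQ f x v)
    (g : EuclideanSpace ℝ (Fin d) → ℝ) (lam : ℝ) (hl0 : 0 ≤ lam) (hl : lam < ρ * r)
    (hg : ∀ x y, |g x - g y| ≤ lam * ‖x - y‖)
    (v : EuclideanSpace ℝ (Fin d))
    (hz : ∀ t : ℝ, 0 ≤ t → t ≤ 1 → f (x₀ + v) + g (x₀ + v) ≤ f (x₀ + t • v) + g (x₀ + t • v)) :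
    ‖v‖ ≤ lam / ρ := by
  by_cases hv : v = 0
  · subst hv; simp; positivity
  have hv' : 0 < ‖v‖ := norm_pos_iff.mpr hv
  have key := aux_key hconv hC2 x₀ hmin ρ r hr hhess v hv
  have hD : fderiv ℝ f (x₀ + (1 : ℝ) • v) v ≤ lam * ‖v‖ := by
    have h := (aux_d1 hC2 x₀ v 1).hasDerivWithinAt (s := Set.Iio 1)
    rw [hasDerivWithinAt_iff_tendsto_slope' (by simp)] at h
    refine le_of_tendsto h ?_
    have : Set.Ico (0 : ℝ) 1 ∈ nhdsWithin (1 : ℝ) (Set.Iio 1) := Ico_mem_nhdsLT (by norm_num)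
    filter_upwards [this] with t ht
    have h1 := hz t ht.1 ht.2.le
    have h2 := (le_abs_self _).trans (hg (x₀ + t • v) (x₀ + v))
    have e : x₀ + t • v - (x₀ + v) = (t - 1) • v := by module
    rw [e, norm_smul, Real.norm_of_nonpos (by linarith [ht.2])] at h2
    rw [slope_comm, slope_def_field, div_le_iff₀ (by linarith [ht.2])]
    simp only [one_smul]
    nlinarith
  have h3 : ρ * min ‖v‖ r ≤ lam := le_of_mul_le_mul_right (key.trans hD) hv'
  rw [le_div_iff₀ hρ]
  rcases le_total ‖v‖ r with h | h
  · rw [min_eq_left h] at h3; linarith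
  · rw [min_eq_right h] at h3; linarith

lemma aux_strict (hC2 : ContDiff ℝ 2 f)
    (x₀ : EuclideanSpace ℝ (Fin d)) (ρ r : ℝ) (hρ : 0 < ρ)
    (hhess : ∀ x ∈ closedBall x₀ r, ∀ v, ρ * ‖v‖ ^ 2 ≤ hessQ f x v)
    (a b : EuclideanSpace ℝ (Fin d)) (ha : a ∈ closedBall x₀ r) (hb : b ∈ closedBall x₀ r)
    (hab : a ≠ b) : f ((1/2 : ℝ) • a + (1/2 : ℝ) • b) < 1/2 * f a + 1/2 * f b := by
  have hv : 0 < ‖b - a‖ := norm_pos_iff.mpr (sub_ne_zero.mpr hab.symm)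
  have hd1 : deriv (fun s : ℝ => f (a + s • (b - a))) =
      fun s => fderiv ℝ f (a + s • (b - a)) (b - a) :=
    funext fun s => (aux_d1 hC2 a (b - a) s).deriv
  have h : StrictConvexOn ℝ (Set.Icc (0 : ℝ) 1) (fun s : ℝ => f (a + s • (b - a))) := by
    refine strictConvexOn_of_deriv2_pos (convex_Icc 0 1)
      (fun s _ => (aux_d1 hC2 a (b - a) s).continuousAt.continuousWithinAt) fun s hs => ?_
    rw [interior_Icc] at hs
    simp only [Function.iterate_succ, Function.iterate_zero, Function.comp, id]
    rw [hd1, (aux_d2 hC2 a (b - a) s).deriv]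
    refine lt_of_lt_of_le (by positivity) (hhess _ ?_ _)
    exact (convex_closedBall x₀ r).add_smul_sub_mem ha hb ⟨hs.1.le, hs.2.le⟩
  have h2 := h.2 (show (0 : ℝ) ∈ Set.Icc (0 : ℝ) 1 by simp) (show (1 : ℝ) ∈ Set.Icc (0 : ℝ) 1 by simp)
    (by norm_num) (show (0 : ℝ) < 1/2 by norm_num) (show (0 : ℝ) < 1/2 by norm_num) (by norm_num)
  have e : a + ((1/2 : ℝ) • (0 : ℝ) + (1/2 : ℝ) • (1 : ℝ)) • (b - a)
      = (1/2 : ℝ) • a + (1/2 : ℝ) • b := by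
    simp only [smul_eq_mul]; module
  simp only [e] at h2
  simpa using h2

end helpers

/-- Gradient lower bound for a locally strongly convex function, and stability of its
minimizer under an additive convex Lipschitz perturbation. -/
theorem stmt_17 {d : ℕ} (hd : 1 ≤ d) (f : EuclideanSpace ℝ (Fin d) → ℝ)
    (hconv : ConvexOn ℝ Set.univ f) (hC2 : ContDiff ℝ 2 f)
    (x₀ : EuclideanSpace ℝ (Fin d)) (hmin : ∀ y, f x₀ ≤ f y)
    (ρ r : ℝ) (hρ : 0 < ρ) (hr : 0 < r)
    (hhess : ∀ x ∈ closedBall x₀ r, ∀ v, ρ * ‖v‖ ^ 2 ≤ hessQ f x v) :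
    (∀ x, ρ * min ‖x - x₀‖ r ≤ ‖gradient f x‖) ∧
    ∀ (g : EuclideanSpace ℝ (Fin d) → ℝ) (lam : ℝ),
      ConvexOn ℝ Set.univ g → 0 ≤ lam → lam < ρ * r →
      (∀ x y, |g x - g y| ≤ lam * ‖x - y‖) →
      ∃ xmin, (∀ y, f xmin + g xmin ≤ f y + g y) ∧
        (∀ x', (∀ y, f x' + g x' ≤ f y + g y) → x' = xmin) ∧
        xmin ∈ closedBall x₀ (lam / ρ) := by
  refine ⟨fun x => ?_, fun g lam hgc hl0 hl hg => ?_⟩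
  · by_cases hx : x - x₀ = 0
    · simp [hx, hr.le]
    have hv' : 0 < ‖x - x₀‖ := norm_pos_iff.mpr hx
    have key := aux_key hconv hC2 x₀ hmin ρ r hr hhess (x - x₀) hx
    rw [one_smul, add_sub_cancel] at key
    have hn : ‖gradient f x‖ = ‖fderiv ℝ f x‖ := by simp [gradient]
    rw [hn]
    refine le_of_mul_le_mul_right (key.trans ?_) hv'
    exact (le_abs_self _).trans ((fderiv ℝ f x).le_opNorm _)
  have hlr : lam / ρ < r := by rw [div_lt_iff₀ hρ]; linarith
  have hgcont : Continuous g := by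
    have : LipschitzWith ⟨lam, hl0⟩ g := LipschitzWith.of_dist_le_mul fun x y => by
      rw [Real.dist_eq, dist_eq_norm]; exact hg x y
    exact this.continuous
  have hFc : Continuous (fun x => f x + g x) := hC2.continuous.add hgcont
  obtain ⟨z, hz, hzmin⟩ := (isCompact_closedBall x₀ r).exists_isMinOn
    ⟨x₀, mem_closedBall_self hr.le⟩ hFc.continuousOn
  have hloc : ∀ w, w ∈ closedBall x₀ r ∧ (∀ y ∈ closedBall x₀ r, f w + g w ≤ f y + g y) ∨
      (∀ y, f w + g w ≤ f y + g y) → w ∈ closedBall x₀ (lam / ρ) := by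
    intro w hw
    rw [mem_closedBall, dist_eq_norm]
    refine aux_loc hconv hC2 x₀ hmin ρ r hρ hr hhess g lam hl0 hl hg (w - x₀) fun t h0 h1 => ?_
    rw [add_sub_cancel]
    rcases hw with ⟨hw, h⟩ | h
    · exact h _ ((convex_closedBall x₀ r).add_smul_sub_mem (mem_closedBall_self hr.le) hw ⟨h0, h1⟩)
    · exact h _
  have hzl := hloc z (Or.inl ⟨hz, fun y hy => hzmin hy⟩)
  have hzg : ∀ y, f z + g z ≤ f y + g y := by
    have hlm : IsLocalMin (fun x => f x + g x) z := by
      refine hzmin.isLocalMin ?_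
      refine Filter.mem_of_superset (isOpen_ball.mem_nhds ?_) (ball_subset_closedBall)
      exact lt_of_le_of_lt hzl hlr
    exact fun y => IsMinOn.of_isLocalMin_of_convex_univ hlm (hconv.add hgc) y
  refine ⟨z, hzg, fun x' hx' => ?_, hzl⟩
  by_contra hne
  have hxl := hloc x' (Or.inr hx')
  have hs := aux_strict hC2 x₀ ρ r hρ hhess x' z
    (closedBall_subset_closedBall hlr.le hxl) hz hne
  have hg2 := hgc.2 (Set.mem_univ x') (Set.mem_univ z)
    (show (0 : ℝ) ≤ 1/2 by norm_num) (show (0 : ℝ) ≤ 1/2 by norm_num) (by norm_num)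
  simp only [smul_eq_mul] at hg2
  have h1 := hx' ((1/2 : ℝ) • x' + (1/2 : ℝ) • z)
  have h2 := hzg ((1/2 : ℝ) • x' + (1/2 : ℝ) • z)
  linarith
end

section
/- Let d, m ≥ 1, 0 < ρ ≤ L < ∞, δ > 0, M > 0, r > 0, λ > 0, and θ*_1,…,θ*_m ∈ ℝ^d. Suppose each f_j : ℝ^d → ℝ is convex and twice continuously differentiable with ρ·I ⪯ ∇²f_j(θ) ⪯ L·I for all θ ∈ B(θ*_j, M) and ‖∇f_j(θ*_j)‖₂ ≤ δ, and suppose 3δL/ρ + Lr < λ < L·M. Define f̃_j(θ) = inf_{ξ∈ℝ^d} { f_j(ξ) + λ‖θ − ξ‖₂ } and let H : [0,∞) → ℝ be given by H(t) = t²/2 for 0 ≤ t ≤ r and H(t) = r(t − r/2) for t > r. Then: (i) for every j, f̃_j(θ) = f_j(θ) for all θ ∈ B(θ*_j, 2δ/ρ + r); (ii) each f_j has a unique global minimizer θ̃_j, which also uniquely minimizes f̃_j, and ‖θ̃_j − θ*_j‖₂ ≤ δ/ρ; (iii) for every (θ_1,…,θ_m) ∈ (ℝ^d)^m, Σ_{j=1}^m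 f̃_j(θ_j) − Σ_{j=1}^m f̃_j(θ*_j) ≥ ρ·Σ_{j=1}^m H( (‖θ_j − θ*_j‖₂ − δ/ρ)_+ ) − mδ²/ρ, where (x)_+ = max{x, 0}. -/
open Metric Finset

theorem hub_lip (r : ℝ) (hr : 0 < r) (a b c : ℝ) (ha : 0 ≤ a) (hb : 0 ≤ b) (hc : 0 ≤ c)
    (h : b ≤ a + c) :
    (if b ≤ r then b ^ 2 / 2 else r * (b - r / 2)) ≤
      (if a ≤ r then a ^ 2 / 2 else r * (a - r / 2)) + r * c := by
  split_ifs with h1 h2 h2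
  · rcases le_total b a with h3 | h3
    · nlinarith [mul_nonneg hr.le hc]
    · nlinarith [mul_nonneg hr.le hc, mul_nonneg (sub_nonneg.2 h3) (sub_nonneg.2 h1),
        mul_nonneg (sub_nonneg.2 h3) (sub_nonneg.2 h2),
        mul_le_mul_of_nonneg_left h hr.le]
  · nlinarith [mul_nonneg hr.le hc]
  · nlinarith [mul_le_mul_of_nonneg_left h hr.le, sq_nonneg (r - a)]
  · nlinarith [mul_le_mul_of_nonneg_left h hr.le]

theorem hub_pos (r : ℝ) (hr : 0 < r) (t : ℝ) (ht : 0 < t) :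
    0 < (if t ≤ r then t ^ 2 / 2 else r * (t - r / 2)) := by
  split_ifs with h
  · positivity
  · push Not at h
    exact mul_pos hr (by linarith)

section core
variable {E : Type*} [NormedAddCommGroup E] [InnerProductSpace ℝ E]

theorem hasDerivAt_line (x w : E) (t : ℝ) : HasDerivAt (fun t : ℝ => x + t • w) w t := by
  simpa using ((hasDerivAt_id t).smul_const w).const_add x

theorem grad_ineq (f : E → ℝ) (hc : ConvexOn ℝ Set.univ f) (hd : Differentiable ℝ f)
    (x y : E) : f x + fderiv ℝ f x (y - x) ≤ f y := by
  have h1 : ConvexOn ℝ Set.univ (fun t : ℝ => f (AffineMap.lineMap x y t)) := by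
    exact hc.comp_affineMap (AffineMap.lineMap x y : ℝ →ᵃ[ℝ] E)
  have e : (fun t : ℝ => f (AffineMap.lineMap x y t)) = fun t : ℝ => f (x + t • (y - x)) := by
    funext t; rw [AffineMap.lineMap_apply]; simp [add_comm]
  rw [e] at h1
  have h2 : HasDerivAt (fun t : ℝ => f (x + t • (y - x))) (fderiv ℝ f x (y - x)) 0 := by
    have := ((hd (x + (0:ℝ) • (y - x))).hasFDerivAt).comp_hasDerivAt (0:ℝ)
      (hasDerivAt_line x (y - x) 0)
    rw [zero_smul, add_zero] at this
    exact this
  have h3 := h1.le_slope_of_hasDerivAt (Set.mem_univ 0) (Set.mem_univ 1) one_pos h2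
  rw [slope_def_field] at h3
  simp at h3
  rw [map_sub]
  linarith

theorem line_mem {s : Set E} (hs : Convex ℝ s) {x y : E} (hx : x ∈ s) (hy : y ∈ s) {t : ℝ}
    (h0 : 0 ≤ t) (h1 : t ≤ 1) : x + t • (y - x) ∈ s :=
  hs.add_smul_sub_mem hx hy ⟨h0, h1⟩

theorem grad_mono (f : E → ℝ) (hC : ContDiff ℝ 2 f) (s : Set E) (hs : Convex ℝ s) (ρ : ℝ)
    (hQ : ∀ x ∈ s, ∀ v, ρ * ‖v‖ ^ 2 ≤ fderiv ℝ (fderiv ℝ f) x v v) (x y : E)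
    (hx : x ∈ s) (hy : y ∈ s) :
    ρ * ‖y - x‖ ^ 2 ≤ fderiv ℝ f y (y - x) - fderiv ℝ f x (y - x) := by
  have hd1 : Differentiable ℝ (fderiv ℝ f) :=
    (hC.fderiv_right (m := 1) (by norm_num)).differentiable (by norm_num)
  have hder : ∀ t : ℝ, HasDerivAt (fun t : ℝ => fderiv ℝ f (x + t • (y - x)) (y - x))
      (fderiv ℝ (fderiv ℝ f) (x + t • (y - x)) (y - x) (y - x)) t := fun t => by
    have := ((hd1 (x + t • (y - x))).hasFDerivAt).comp_hasDerivAt t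
      (hasDerivAt_line x (y - x) t)
    simpa using this.clm_apply (hasDerivAt_const t (y - x))
  obtain ⟨t, ht, he⟩ := exists_hasDerivAt_eq_slope _ _ (zero_lt_one' ℝ)
    (fun t _ => (hder t).continuousAt.continuousWithinAt) (fun t _ => hder t)
  have := hQ _ (line_mem hs hx hy ht.1.le ht.2.le) (y - x)
  rw [he] at this
  simpa using this

theorem strong (f : E → ℝ) (hC : ContDiff ℝ 2 f) (s : Set E) (hs : Convex ℝ s) (ρ : ℝ)
    (hQ : ∀ x ∈ s, ∀ v, ρ * ‖v‖ ^ 2 ≤ fderiv ℝ (fderiv ℝ f) x v v) (x y : E)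
    (hx : x ∈ s) (hy : y ∈ s) :
    f x + fderiv ℝ f x (y - x) + ρ / 2 * ‖y - x‖ ^ 2 ≤ f y := by
  have hd : Differentiable ℝ f := hC.differentiable (by norm_num)
  have hder : ∀ t : ℝ, HasDerivAt
      (fun t : ℝ => f (x + t • (y - x)) - t * fderiv ℝ f x (y - x) - ρ / 2 * ‖y - x‖ ^ 2 * t ^ 2)
      (fderiv ℝ f (x + t • (y - x)) (y - x) - fderiv ℝ f x (y - x) - ρ * ‖y - x‖ ^ 2 * t) t :=
    fun t => by
    have h1 := ((hd (x + t • (y - x))).hasFDerivAt).comp_hasDerivAt t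
      (hasDerivAt_line x (y - x) t)
    have h2 := (hasDerivAt_id t).mul_const (fderiv ℝ f x (y - x))
    have h3 := (hasDerivAt_pow 2 t).const_mul (ρ / 2 * ‖y - x‖ ^ 2)
    refine ((h1.sub h2).sub h3).congr_deriv ?_
    rw [one_mul]
    push_cast
    ring
  obtain ⟨t, ht, he⟩ := exists_hasDerivAt_eq_slope _ _ (zero_lt_one' ℝ)
    (fun t _ => (hder t).continuousAt.continuousWithinAt) (fun t _ => hder t)
  have h := grad_mono f hC s hs ρ hQ x _ hx (line_mem hs hx hy ht.1.le ht.2.le)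
  simp only [add_sub_cancel_left, norm_smul, map_smul, smul_eq_mul, Real.norm_eq_abs,
    abs_of_pos ht.1] at h
  have h' : t * (ρ * ‖y - x‖ ^ 2 * t) ≤
    t * (fderiv ℝ f (x + t • (y - x)) (y - x) - fderiv ℝ f x (y - x)) := by linarith
  have h'' := le_of_mul_le_mul_left h' ht.1
  simp [-map_sub] at he
  linarith

theorem hess_norm_s19 (f : E → ℝ) (hC : ContDiff ℝ 2 f) (L : ℝ) (hL : 0 ≤ L) (x : E)
    (hQ0 : ∀ v, 0 ≤ fderiv ℝ (fderiv ℝ f) x v v)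
    (hQ : ∀ v, fderiv ℝ (fderiv ℝ f) x v v ≤ L * ‖v‖ ^ 2) :
    ‖fderiv ℝ (fderiv ℝ f) x‖ ≤ L := by
  have hsym : IsSymmSndFDerivAt ℝ f x := hC.contDiffAt.isSymmSndFDerivAt (by simp)
  have key : ∀ w v : E, ‖w‖ = 1 → ‖v‖ = 1 → fderiv ℝ (fderiv ℝ f) x w v ≤ L := by
    intro w v hw hv
    have h1 := hQ (w + v)
    have h2 := hQ0 (w - v)
    have h3 : ‖w + v‖ ^ 2 ≤ 4 := by
      have := norm_add_le w v
      rw [hw, hv] at this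
      nlinarith [norm_nonneg (w + v)]
    have h4 := hsym.eq w v
    simp only [map_add, map_sub, _root_.add_apply, _root_.sub_apply]
      at h1 h2
    nlinarith [mul_le_mul_of_nonneg_left h3 hL]
  refine ContinuousLinearMap.opNorm_le_of_unit_norm hL fun w hw => ?_
  refine ContinuousLinearMap.opNorm_le_of_unit_norm hL fun v hv => ?_
  rw [Real.norm_eq_abs, abs_le]
  refine ⟨?_, key w v hw hv⟩
  have := key (-w) v (by simpa using hw) hv
  simp at this
  linarith

theorem grad_lip (f : E → ℝ) (hC : ContDiff ℝ 2 f) (s : Set E) (hs : Convex ℝ s) (L : ℝ)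
    (hL : 0 ≤ L) (hQ0 : ∀ x ∈ s, ∀ v, 0 ≤ fderiv ℝ (fderiv ℝ f) x v v)
    (hQ : ∀ x ∈ s, ∀ v, fderiv ℝ (fderiv ℝ f) x v v ≤ L * ‖v‖ ^ 2) (x y : E)
    (hx : x ∈ s) (hy : y ∈ s) :
    ‖fderiv ℝ f y - fderiv ℝ f x‖ ≤ L * ‖y - x‖ := by
  have hd1 : Differentiable ℝ (fderiv ℝ f) :=
    (hC.fderiv_right (m := 1) (by norm_num)).differentiable (by norm_num)
  exact hs.norm_image_sub_le_of_norm_fderiv_le (fun z _ => hd1 z)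
    (fun z hz => hess_norm_s19 f hC L hL z (hQ0 z hz) (hQ z hz)) hx hy

theorem growth (f : E → ℝ) (hc : ConvexOn ℝ Set.univ f) (hC : ContDiff ℝ 2 f) (s : Set E)
    (hs : Convex ℝ s) (ρ : ℝ) (r : ℝ) (hr : 0 < r)
    (hQ : ∀ x ∈ s, ∀ v, ρ * ‖v‖ ^ 2 ≤ fderiv ℝ (fderiv ℝ f) x v v) (a : E)
    (ha : fderiv ℝ f a = 0) (hball : closedBall a r ⊆ s) (x : E) :
    f a + ρ * (if ‖x - a‖ ≤ r then ‖x - a‖ ^ 2 / 2 else r * (‖x - a‖ - r / 2)) ≤ f x := by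
  have has : a ∈ s := hball (mem_closedBall_self hr.le)
  split_ifs with h
  · have := strong f hC s hs ρ hQ a x has (hball (by simpa [dist_eq_norm] using h))
    rw [ha] at this
    simp at this
    linarith
  · push Not at h
    have ht : 0 < ‖x - a‖ := hr.trans h
    set t := ‖x - a‖ with htd
    set y := a + (r / t) • (x - a) with hy
    have hya : y - a = (r / t) • (x - a) := by simp [hy]
    have hn : ‖y - a‖ = r := by
      rw [hya, norm_smul, ← htd, Real.norm_eq_abs, abs_of_pos (div_pos hr ht)]
      field_simp
    have hys : y ∈ s := hball (by simp [dist_eq_norm, hn])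
    have h1 := strong f hC s hs ρ hQ a y has hys
    have h2 := grad_mono f hC s hs ρ hQ a y has hys
    have h3 := grad_ineq f hc (hC.differentiable (by norm_num)) y x
    have hxy : x - y = ((t - r) / r) • (y - a) := by
      rw [hya, smul_smul]
      have : (t - r) / r * (r / t) = 1 - r / t := by field_simp
      rw [this, hy, sub_smul, one_smul]
      abel
    rw [hxy, map_smul, smul_eq_mul] at h3
    rw [ha, hn] at h1 h2
    simp only [_root_.zero_apply, sub_zero, add_zero] at h1 h2
    have h4 := mul_le_mul_of_nonneg_left h2 (div_nonneg (sub_nonneg.2 h.le) hr.le)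
    have h5 : (t - r) / r * (ρ * r ^ 2) = (t - r) * ρ * r := by field_simp
    linarith

theorem exists_min [ProperSpace E] (f : E → ℝ) (hC : ContDiff ℝ 2 f) (ρ δ M : ℝ) (hρ : 0 < ρ)
    (hδ : 0 < δ) (a : E) (hM : 3 * δ / ρ ≤ M)
    (hQ : ∀ x ∈ closedBall a M, ∀ v, ρ * ‖v‖ ^ 2 ≤ fderiv ℝ (fderiv ℝ f) x v v)
    (hg : ‖fderiv ℝ f a‖ ≤ δ) :
    ∃ b, fderiv ℝ f b = 0 ∧ ‖b - a‖ ≤ δ / ρ := by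
  have hR : 0 < 3 * δ / ρ := by positivity
  obtain ⟨b, hb, hmin⟩ := (isCompact_closedBall a (3 * δ / ρ)).exists_isMinOn
    ⟨a, mem_closedBall_self hR.le⟩ hC.continuous.continuousOn
  have haM : a ∈ closedBall a M := mem_closedBall_self (hR.le.trans hM)
  have hbM : b ∈ closedBall a M := closedBall_subset_closedBall hM hb
  have h1 := strong f hC _ (convex_closedBall a M) ρ hQ a b haM hbM
  have h2 : f b ≤ f a := hmin (mem_closedBall_self hR.le)
  have hgb : ∀ v, |fderiv ℝ f a v| ≤ δ * ‖v‖ := fun v =>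
    ((fderiv ℝ f a).le_opNorm v).trans (by gcongr)
  have h3 := (abs_le.1 (hgb (b - a))).1
  have h4 : ‖b - a‖ < 3 * δ / ρ := by
    rw [lt_div_iff₀ hρ]
    by_contra! hcon
    have : 0 < ‖b - a‖ := by
      by_contra! h0
      nlinarith
    nlinarith
  have h5 : fderiv ℝ f b = 0 := by
    apply IsLocalMin.fderiv_eq_zero
    exact hmin.isLocalMin (closedBall_mem_nhds_of_mem (by simpa [dist_eq_norm] using h4))
  refine ⟨b, h5, ?_⟩
  have h6 := grad_mono f hC _ (convex_closedBall a M) ρ hQ a b haM hbM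
  rw [h5] at h6
  simp only [_root_.zero_apply, zero_sub] at h6
  rw [le_div_iff₀ hρ]
  by_contra! hcon
  have : 0 < ‖b - a‖ := by
    by_contra! h0
    nlinarith
  nlinarith

end core

theorem single {d : ℕ} (ρ L δ M r lam : ℝ) (hρ : 0 < ρ) (hρL : ρ ≤ L) (hδ : 0 < δ)
    (hr : 0 < r) (hlam0 : 0 < lam) (f : EuclideanSpace ℝ (Fin d) → ℝ)
    (hconv : ConvexOn ℝ Set.univ f) (hC2 : ContDiff ℝ 2 f) (θs : EuclideanSpace ℝ (Fin d))
    (hhess : ∀ θ ∈ closedBall θs M, ∀ v,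
      ρ * ‖v‖ ^ 2 ≤ hessQ f θ v ∧ hessQ f θ v ≤ L * ‖v‖ ^ 2)
    (hgrad : ‖gradient f θs‖ ≤ δ)
    (hlam1 : 3 * δ * L / ρ + L * r < lam) (hlam2 : lam < L * M)
    (ftil : EuclideanSpace ℝ (Fin d) → ℝ)
    (hftil : ∀ θ, ftil θ = sInf (Set.range fun ξ => f ξ + lam * ‖θ - ξ‖)) :
    (∀ θ ∈ closedBall θs (2 * δ / ρ + r), ftil θ = f θ) ∧
    ∃ b, ‖b - θs‖ ≤ δ / ρ ∧ f θs - f b ≤ δ ^ 2 / ρ ∧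
      (∀ θ, f b + ρ * (if ‖θ - b‖ ≤ r then ‖θ - b‖ ^ 2 / 2 else r * (‖θ - b‖ - r / 2)) ≤ f θ) ∧
      (∀ θ, f b + ρ * (if ‖θ - b‖ ≤ r then ‖θ - b‖ ^ 2 / 2 else r * (‖θ - b‖ - r / 2))
        ≤ ftil θ) := by
  have hL : 0 < L := hρ.trans_le hρL
  have hD : 0 < δ / ρ := by positivity
  have hMD : 3 * (δ / ρ) + r < M := by
    have : L * (3 * (δ / ρ) + r) < L * M := by
      calc L * (3 * (δ / ρ) + r) = 3 * δ * L / ρ + L * r := by ring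
        _ < L * M := hlam1.trans hlam2
    exact lt_of_mul_lt_mul_left this hL.le
  have hdiff : Differentiable ℝ f := hC2.differentiable (by norm_num)
  have hQ1 : ∀ x ∈ closedBall θs M, ∀ v, ρ * ‖v‖ ^ 2 ≤ fderiv ℝ (fderiv ℝ f) x v v := by
    intro x hx v
    have := (hhess x hx v).1
    rw [hessQ, iteratedFDeriv_two_apply] at this
    simpa using this
  have hQ2 : ∀ x ∈ closedBall θs M, ∀ v, fderiv ℝ (fderiv ℝ f) x v v ≤ L * ‖v‖ ^ 2 := by
    intro x hx v
    have := (hhess x hx v).2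
    rw [hessQ, iteratedFDeriv_two_apply] at this
    simpa using this
  have hQ0 : ∀ x ∈ closedBall θs M, ∀ v, 0 ≤ fderiv ℝ (fderiv ℝ f) x v v := fun x hx v =>
    le_trans (by positivity) (hQ1 x hx v)
  have hg : ‖fderiv ℝ f θs‖ ≤ δ := by
    simpa [gradient] using hgrad
  have hsM : θs ∈ closedBall θs M := mem_closedBall_self (by linarith)
  have e2 : 2 * δ / ρ = 2 * (δ / ρ) := by ring
  have e3 : 3 * δ / ρ = 3 * (δ / ρ) := by ring
  have lowf : ∀ θ ξ K, ‖fderiv ℝ f θ‖ ≤ K → f θ - K * ‖ξ - θ‖ ≤ f ξ := by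
    intro θ ξ K hK
    have h1 := grad_ineq f hconv hdiff θ ξ
    have h2 : |fderiv ℝ f θ (ξ - θ)| ≤ K * ‖ξ - θ‖ :=
      ((fderiv ℝ f θ).le_opNorm _).trans (by gcongr)
    linarith [(abs_le.1 h2).1]
  refine ⟨?_, ?_⟩
  · intro θ hθ
    have hθM : θ ∈ closedBall θs M := closedBall_subset_closedBall (by rw [e2]; linarith) hθ
    have h1 := grad_lip f hC2 _ (convex_closedBall θs M) L hL.le hQ0 hQ2 θs θ hsM hθM
    have hn : ‖θ - θs‖ ≤ 2 * (δ / ρ) + r := by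
      rw [← e2]; simpa [dist_eq_norm] using hθ
    have h2 : ‖fderiv ℝ f θ‖ ≤ lam := by
      have h3 : ‖fderiv ℝ f θ‖ ≤ ‖fderiv ℝ f θ - fderiv ℝ f θs‖ + ‖fderiv ℝ f θs‖ := by
        simpa using norm_add_le (fderiv ℝ f θ - fderiv ℝ f θs) (fderiv ℝ f θs)
      have h4 : δ ≤ L * (δ / ρ) := by
        calc δ = ρ * (δ / ρ) := by field_simp
          _ ≤ L * (δ / ρ) := by gcongr
      have h5 := mul_le_mul_of_nonneg_left hn hL.le
      have h6 : 3 * δ * L / ρ = 3 * (L * (δ / ρ)) := by ring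
      linarith
    rw [hftil]
    refine IsLeast.csInf_eq ⟨⟨θ, by simp⟩, ?_⟩
    rintro _ ⟨ξ, rfl⟩
    have := lowf θ ξ lam h2
    rw [norm_sub_rev] at this
    simp only
    linarith
  · obtain ⟨b, hb0, hbn⟩ := exists_min f hC2 ρ δ M hρ hδ θs (by rw [e3]; linarith) hQ1 hg
    have hgr := growth f hconv hC2 _ (convex_closedBall θs M) ρ r hr hQ1 b hb0
      (closedBall_subset_closedBall' (by rw [dist_eq_norm]; linarith))
    refine ⟨b, hbn, ?_, hgr, ?_⟩
    · have h1 := lowf θs b δ hg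
      have h2 := mul_le_mul_of_nonneg_left hbn hδ.le
      have : δ ^ 2 / ρ = δ * (δ / ρ) := by ring
      linarith
    · intro θ
      rw [hftil]
      refine le_csInf (Set.range_nonempty _) ?_
      rintro _ ⟨ξ, rfl⟩
      have h1 := hgr ξ
      have h2 := hub_lip r hr ‖ξ - b‖ ‖θ - b‖ ‖θ - ξ‖ (norm_nonneg _) (norm_nonneg _)
        (norm_nonneg _) (by
          have := norm_add_le (θ - ξ) (ξ - b)
          rw [sub_add_sub_cancel] at this
          linarith)
      have h3 := mul_le_mul_of_nonneg_left h2 hρ.le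
      have h4 : ρ * r ≤ lam := by
        have : 0 < 3 * δ * L / ρ := by positivity
        nlinarith
      have h5 := mul_le_mul_of_nonneg_right h4 (norm_nonneg (θ - ξ))
      simp only
      linarith

/-- Lower bound lemma for sums of infimal convolutions of locally strongly convex losses:
the infimal convolutions agree with the losses near the targets, the losses have unique
minimizers near the targets, and the penalized objective grows at a Huber-type rate. -/
theorem stmt_19 (d m : ℕ) (hd : 1 ≤ d) (hm : 1 ≤ m)
    (ρ L δ M r lam : ℝ) (hρ : 0 < ρ) (hρL : ρ ≤ L) (hδ : 0 < δ) (hM : 0 < M)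
    (hr : 0 < r) (hlam0 : 0 < lam)
    (f : Fin m → EuclideanSpace ℝ (Fin d) → ℝ)
    (hconv : ∀ j, ConvexOn ℝ Set.univ (f j)) (hC2 : ∀ j, ContDiff ℝ 2 (f j))
    (θs : Fin m → EuclideanSpace ℝ (Fin d))
    (hhess : ∀ j, ∀ θ ∈ closedBall (θs j) M, ∀ v,
      ρ * ‖v‖ ^ 2 ≤ hessQ (f j) θ v ∧ hessQ (f j) θ v ≤ L * ‖v‖ ^ 2)
    (hgrad : ∀ j, ‖gradient (f j) (θs j)‖ ≤ δ)
    (hlam1 : 3 * δ * L / ρ + L * r < lam) (hlam2 : lam < L * M)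
    (ftil : Fin m → EuclideanSpace ℝ (Fin d) → ℝ)
    (hftil : ∀ j θ, ftil j θ = sInf (Set.range fun ξ => f j ξ + lam * ‖θ - ξ‖))
    (H : ℝ → ℝ) (hH : ∀ t, H t = if t ≤ r then t ^ 2 / 2 else r * (t - r / 2)) :
    (∀ j, ∀ θ ∈ closedBall (θs j) (2 * δ / ρ + r), ftil j θ = f j θ) ∧
    (∀ j, ∃ θt : EuclideanSpace ℝ (Fin d),
      (∀ θ, f j θt ≤ f j θ) ∧ (∀ θ', (∀ θ, f j θ' ≤ f j θ) → θ' = θt) ∧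
      (∀ θ, ftil j θt ≤ ftil j θ) ∧ (∀ θ', (∀ θ, ftil j θ' ≤ ftil j θ) → θ' = θt) ∧
      ‖θt - θs j‖ ≤ δ / ρ) ∧
    (∀ θ : Fin m → EuclideanSpace ℝ (Fin d),
      ρ * ∑ j, H (max (‖θ j - θs j‖ - δ / ρ) 0) - m * δ ^ 2 / ρ ≤
        ∑ j, ftil j (θ j) - ∑ j, ftil j (θs j)) := by
  have key := fun j => single ρ L δ M r lam hρ hρL hδ hr hlam0 (f j) (hconv j) (hC2 j) (θs j)
    (hhess j) (hgrad j) hlam1 hlam2 (ftil j) (hftil j)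
  have hD : 0 < δ / ρ := by positivity
  refine ⟨fun j => (key j).1, ?_, ?_⟩
  · intro j
    obtain ⟨hag, b, hbn, hfb, hgr, hlow⟩ := key j
    have hb : ftil j b = f j b := hag b (by
      rw [mem_closedBall, dist_eq_norm]
      have : 2 * δ / ρ = 2 * (δ / ρ) := by ring
      linarith)
    have hnn : ∀ t : ℝ, 0 ≤ t → 0 ≤ (if t ≤ r then t ^ 2 / 2 else r * (t - r / 2)) := by
      intro t ht
      rcases ht.eq_or_lt with h | h
      · rw [← h]; simp [hr.le]
      · exact (hub_pos r hr t h).le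
    refine ⟨b, ?_, ?_, ?_, ?_, hbn⟩
    · intro θ
      linarith [hgr θ, mul_nonneg hρ.le (hnn _ (norm_nonneg (θ - b)))]
    · intro θ' h
      by_contra hne
      linarith [hgr θ', h b, mul_pos hρ (hub_pos r hr _ (norm_pos_iff.2 (sub_ne_zero.2 hne)))]
    · intro θ
      linarith [hlow θ, mul_nonneg hρ.le (hnn _ (norm_nonneg (θ - b)))]
    · intro θ' h
      by_contra hne
      linarith [hlow θ', h b, mul_pos hρ (hub_pos r hr _ (norm_pos_iff.2 (sub_ne_zero.2 hne)))]
  · intro θ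
    have each : ∀ j, ρ * H (max (‖θ j - θs j‖ - δ / ρ) 0) - δ ^ 2 / ρ ≤
        ftil j (θ j) - ftil j (θs j) := by
      intro j
      obtain ⟨hag, b, hbn, hfb, hgr, hlow⟩ := key j
      have hs : ftil j (θs j) = f j (θs j) := hag _ (mem_closedBall_self (by positivity))
      have h1 := hub_lip r hr ‖θ j - b‖ (max (‖θ j - θs j‖ - δ / ρ) 0) 0 (norm_nonneg _)
        (le_max_right _ _) le_rfl (by
          rw [add_zero]
          refine max_le ?_ (norm_nonneg _)
          have := norm_add_le (θ j - b) (b - θs j)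
          rw [sub_add_sub_cancel] at this
          linarith)
      rw [hH]
      have h2 := mul_le_mul_of_nonneg_left h1 hρ.le
      have h3 := hlow (θ j)
      linarith
    have h := Finset.sum_le_sum (fun j (_ : j ∈ Finset.univ) => each j)
    rw [Finset.sum_sub_distrib, Finset.sum_sub_distrib, ← Finset.mul_sum] at h
    simp only [Finset.sum_const, Finset.card_univ, Fintype.card_fin, nsmul_eq_mul] at h
    rw [mul_div_assoc]
    exact h
end
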